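/- Let n > 2. Every loose non-homotopic drawing in the sphere with n vertices and m edges satisfies m ≤ 3n − 6. -/

import Mathlib

open unitInterval

/-- A drawing in the sphere (`OnePoint ℂ`) with `n` vertices and `m` edges. -/
structure SphereDrawing (n m : ℕ) where
  V : Set (OnePoint ℂ)
  finV : V.Finite
  cardV : V.ncard = n
  f : Fin m → I → OnePoint ℂ
  cont : ∀ e, Continuous (f e)
  source_mem : ∀ e, f e 0 ∈ V
  target_mem : ∀ e, f e 1 ∈ V
  interior_not_mem : ∀ e, ∀ t : I, t ≠ 0 → t ≠ 1 → f e t ∉ V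

/-- Homotopy between two curves on the sphere, fixing the endpoints of the first,
with interior avoiding the vertex set `V`. -/
def SphereHomotopicIn (V : Set (OnePoint ℂ)) (a b : I → OnePoint ℂ) : Prop :=
  ∃ g : I × I → OnePoint ℂ, Continuous g ∧
    (∀ t, g (0, t) = a t) ∧ (∀ t, g (1, t) = b t) ∧
    (∀ s, g (s, 0) = a 0) ∧ (∀ s, g (s, 1) = a 1) ∧
    (∀ s t : I, s ≠ 0 → s ≠ 1 → t ≠ 0 → t ≠ 1 → g (s, t) ∉ V)

/-- Two edges are homotopic if one is homotopic to the other or to its reversal. -/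
def SphereEdgeHomotopic (V : Set (OnePoint ℂ)) (a b : I → OnePoint ℂ) : Prop :=
  SphereHomotopicIn V a b ∨ SphereHomotopicIn V (fun t => a (σ t)) b

/-- An edge is a trivial loop if it is homotopic to the constant map at its endpoint. -/
def SphereIsTrivialLoop (V : Set (OnePoint ℂ)) (a : I → OnePoint ℂ) : Prop :=
  SphereEdgeHomotopic V a fun _ => a 0

/-- A sphere drawing is non-homotopic if no two distinct edges are homotopic and
no edge is a trivial loop. -/
def SphereDrawing.NonHomotopic {n m : ℕ} (D : SphereDrawing n m) : Prop :=
  (∀ e e' : Fin m, e ≠ e' → ¬ SphereEdgeHomotopic D.V (D.f e) (D.f e')) ∧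
  (∀ e : Fin m, ¬ SphereIsTrivialLoop D.V (D.f e))

/-- A sphere drawing is loose if no two distinct edges cross. -/
def SphereDrawing.Loose {n m : ℕ} (D : SphereDrawing n m) : Prop :=
  ∀ e e' : Fin m, e ≠ e' → ∀ t t' : I, t ≠ 0 → t ≠ 1 → t' ≠ 0 → t' ≠ 1 →
    D.f e t ≠ D.f e' t'

/-- An ordered two-dimensional `Δ`-complex with vertices `X`, edges `E` and triangles `T`. -/
structure TriComplex (X E T : Type*) where
  src : E → X
  tgt : E → X
  va : T → X
  vb : T → X
  vc : T → X
  d0 : T → E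
  d1 : T → E
  d2 : T → E
  src_d0 : ∀ t, src (d0 t) = vb t
  tgt_d0 : ∀ t, tgt (d0 t) = vc t
  src_d1 : ∀ t, src (d1 t) = va t
  tgt_d1 : ∀ t, tgt (d1 t) = vc t
  src_d2 : ∀ t, src (d2 t) = va t
  tgt_d2 : ∀ t, tgt (d2 t) = vb t

namespace TriComplex

open scoped Classical

variable {X E T : Type*} (K : TriComplex X E T)

/-- The number of sides of the triangle `t` equal to the edge `e`. -/
noncomputable def sideCount (t : T) (e : E) : ℕ :=
  (if K.d0 t = e then 1 else 0) + (if K.d1 t = e then 1 else 0) + (if K.d2 t = e then 1 else 0)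

/-- Both ends of the edge `e` lie in `A`. -/
def EIn (A : Set X) (e : E) : Prop := K.src e ∈ A ∧ K.tgt e ∈ A

/-- The three vertices of the triangle `t` lie in `A`. -/
def TIn (A : Set X) (t : T) : Prop := K.va t ∈ A ∧ K.vb t ∈ A ∧ K.vc t ∈ A

/-- Exactly one end of the edge `e` lies in `A`. -/
def Cut (A : Set X) (e : E) : Prop := ¬ (K.src e ∈ A ↔ K.tgt e ∈ A)

/-- A relation system over the edges, together with its compatibility on a triangle. -/
def TwoOfThree (Q : E → Prop) (t : T) : Prop :=
  (Q (K.d0 t) → Q (K.d1 t) → Q (K.d2 t)) ∧ (Q (K.d0 t) → Q (K.d2 t) → Q (K.d1 t)) ∧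
    (Q (K.d1 t) → Q (K.d2 t) → Q (K.d0 t))

theorem cut_d0 {A : Set X} {t : T} (h : K.Cut A (K.d0 t)) :
    K.Cut A (K.d1 t) ∨ K.Cut A (K.d2 t) := by
  simp only [Cut, K.src_d0, K.src_d1, K.src_d2, K.tgt_d0, K.tgt_d1, K.tgt_d2] at h ⊢
  grind

theorem cut_d1 {A : Set X} {t : T} (h : K.Cut A (K.d1 t)) :
    K.Cut A (K.d0 t) ∨ K.Cut A (K.d2 t) := by
  simp only [Cut, K.src_d0, K.src_d1, K.src_d2, K.tgt_d0, K.tgt_d1, K.tgt_d2] at h ⊢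
  grind

theorem cut_d2 {A : Set X} {t : T} (h : K.Cut A (K.d2 t)) :
    K.Cut A (K.d0 t) ∨ K.Cut A (K.d1 t) := by
  simp only [Cut, K.src_d0, K.src_d1, K.src_d2, K.tgt_d0, K.tgt_d1, K.tgt_d2] at h ⊢
  grind

variable {K}

theorem graph_extension {D : Set X} {S : Type*} (W : Finset X) (Ek : Finset E)
    (hW : ∀ x ∈ W, x ∉ D)
    (hE : ∀ e ∈ Ek, (K.src e ∈ W ∨ K.src e ∈ D) ∧ (K.tgt e ∈ W ∨ K.tgt e ∈ D) ∧
      (K.src e ∈ W ∨ K.tgt e ∈ W))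
    (hcut : ∀ A : Finset X, A ⊆ W → A.Nonempty → ∃ e ∈ Ek, K.Cut (A : Set X) e)
    (hcount : Ek.card ≤ W.card)
    (R : E → S → S → Prop) (s0 : X → S)
    (fwd : ∀ e ∈ Ek, K.tgt e ∈ W → ∀ a, ∃ b, R e a b)
    (bwd : ∀ e ∈ Ek, K.src e ∈ W → ∀ b, ∃ a, R e a b) :
    Ek.card = W.card ∧
      ∃ s : X → S, (∀ x ∈ D, s x = s0 x) ∧ ∀ e ∈ Ek, R e (s (K.src e)) (s (K.tgt e)) := by
  induction hn : W.card generalizing W Ek with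
  | zero =>
    have hW0 : W = ∅ := Finset.card_eq_zero.1 hn
    have : Ek = ∅ := by
      rw [Finset.card_eq_zero.symm]; omega
    subst this
    exact ⟨by simp, s0, fun _ _ => rfl, by simp⟩
  | succ k ih =>
    have hWne : W.Nonempty := by
      rw [← Finset.card_pos]; omega
    let deg : X → ℕ := fun w =>
      ∑ e ∈ Ek, ((if K.src e = w then 1 else 0) + (if K.tgt e = w then 1 else 0))
    have hsum : ∑ w ∈ W, deg w =
        ∑ e ∈ Ek, ((if K.src e ∈ W then 1 else 0) + (if K.tgt e ∈ W then 1 else 0)) := by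
      simp only [deg]
      rw [Finset.sum_comm]
      refine Finset.sum_congr rfl fun e _ => ?_
      rw [Finset.sum_add_distrib, Finset.sum_ite_eq, Finset.sum_ite_eq]
    obtain ⟨e0, he0, hc0⟩ := hcut W subset_rfl hWne
    have hlt : ∑ w ∈ W, deg w < ∑ e ∈ Ek, 2 := by
      rw [hsum]
      refine Finset.sum_lt_sum (fun e _ => by split_ifs <;> simp) ⟨e0, he0, ?_⟩
      simp only [Cut, Finset.mem_coe] at hc0
      grind
    have : ∃ w ∈ W, deg w < 2 := by
      by_contra! h
      have := Finset.sum_le_sum h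
      simp only [Finset.sum_const, smul_eq_mul] at this hlt
      omega
    obtain ⟨w, hw, hdeg⟩ := this
    obtain ⟨e, he, hce⟩ := hcut {w} (by simpa using hw) (by simp)
    have huniq : ∀ e' ∈ Ek, e' ≠ e → K.src e' ≠ w ∧ K.tgt e' ≠ w := by
      intro e' he' hne
      by_contra hcon
      have h2 : ∑ i ∈ ({e, e'} : Finset E),
          ((if K.src i = w then 1 else 0) + (if K.tgt i = w then 1 else 0)) ≤ deg w := by
        refine Finset.sum_le_sum_of_subset ?_
        intro i hi
        simp only [Finset.mem_insert, Finset.mem_singleton] at hi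
        rcases hi with rfl | rfl <;> assumption
      rw [Finset.sum_pair hne.symm] at h2
      simp only [Cut, Finset.coe_singleton, Set.mem_singleton_iff] at hce
      clear ih hcut fwd bwd hsum hlt
      grind
    have hcw : ¬ (K.src e = w ↔ K.tgt e = w) := by simpa [Cut] using hce
    obtain ⟨hcard, s, hs, hR⟩ := ih (W.erase w) (Ek.erase e)
      (fun x hx => hW x (Finset.mem_of_mem_erase hx))
      (by
        intro e' he'
        have h1 := Finset.mem_erase.1 he'
        have h2 := huniq e' h1.2 h1.1
        have h3 := hE e' h1.2
        simp only [Finset.mem_erase]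
        grind)
      (by
        intro A hA hAne
        have hwA : w ∉ A := fun h => by simpa using hA h
        obtain ⟨e1, he1, hc1⟩ := hcut A (hA.trans (Finset.erase_subset _ _)) hAne
        by_cases h1 : e1 = e
        · subst h1
          obtain ⟨e2, he2, hc2⟩ := hcut (insert w A)
            (Finset.insert_subset hw (hA.trans (Finset.erase_subset _ _))) (by simp)
          refine ⟨e2, Finset.mem_erase.2 ⟨?_, he2⟩, ?_⟩
          · rintro rfl
            simp only [Cut, Finset.mem_coe, Finset.mem_insert] at hc1 hc2
            grind
          · have h21 : e2 ≠ e1 := by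
              rintro rfl
              simp only [Cut, Finset.mem_coe, Finset.mem_insert] at hc1 hc2
              grind
            have := huniq e2 he2 h21
            simp only [Cut, Finset.mem_coe, Finset.mem_insert] at hc1 hc2 ⊢
            grind
        · exact ⟨e1, Finset.mem_erase.2 ⟨h1, he1⟩, hc1⟩)
      (by rw [Finset.card_erase_of_mem hw, Finset.card_erase_of_mem he]; omega)
      (fun e' he' h => fwd e' (Finset.mem_of_mem_erase he') (Finset.mem_of_mem_erase h))
      (fun e' he' h => bwd e' (Finset.mem_of_mem_erase he') (Finset.mem_of_mem_erase h))
      (by rw [Finset.card_erase_of_mem hw]; omega)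
    have hpos : 0 < Ek.card := Finset.card_pos.2 ⟨e, he⟩
    rw [Finset.card_erase_of_mem he] at hcard
    refine ⟨by omega, ?_⟩
    have hb : ∃ b, R e (Function.update s w b (K.src e)) (Function.update s w b (K.tgt e)) := by
      by_cases h : K.tgt e = w
      · have h' : K.src e ≠ w := fun h' => hcw (iff_of_true h' h)
        obtain ⟨b, hb⟩ := fwd e he (h ▸ hw) (s (K.src e))
        exact ⟨b, by rw [Function.update_of_ne h', h, Function.update_self]; exact hb⟩
      · have h' : K.src e = w := by_contra fun h' => hcw (iff_of_false h' h)
        obtain ⟨b, hb⟩ := bwd e he (h' ▸ hw) (s (K.tgt e))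
        exact ⟨b, by rw [Function.update_of_ne h, h', Function.update_self]; exact hb⟩
    obtain ⟨b, hb⟩ := hb
    refine ⟨Function.update s w b, ?_, ?_⟩
    · intro x hx
      rw [Function.update_of_ne (by rintro rfl; exact hW _ hw hx)]
      exact hs x hx
    · intro e' he'
      by_cases h : e' = e
      · subst h; exact hb
      · have h2 := huniq e' he' h
        rw [Function.update_of_ne h2.1, Function.update_of_ne h2.2]
        exact hR e' (Finset.mem_erase.2 ⟨h, he'⟩)

theorem complex_extension {D : Set X} {S : Type*} (W : Finset X) (Ek : Finset E) (Tk : Finset T)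
    (hW : ∀ x ∈ W, x ∉ D)
    (hE : ∀ e ∈ Ek, (K.src e ∈ W ∨ K.src e ∈ D) ∧ (K.tgt e ∈ W ∨ K.tgt e ∈ D) ∧
      (K.src e ∈ W ∨ K.tgt e ∈ W))
    (hT : ∀ t ∈ Tk, (K.d0 t ∈ Ek ∨ K.EIn D (K.d0 t)) ∧ (K.d1 t ∈ Ek ∨ K.EIn D (K.d1 t)) ∧
      (K.d2 t ∈ Ek ∨ K.EIn D (K.d2 t)))
    (hcut : ∀ A : Finset X, A ⊆ W → A.Nonempty → ∃ e ∈ Ek, K.Cut (A : Set X) e)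
    (hfree : ∀ T' ⊆ Tk, T'.Nonempty → ∃ e, ¬ K.EIn D e ∧ ∑ t ∈ T', K.sideCount t e = 1)
    (hcount : Ek.card ≤ W.card + Tk.card)
    (R : E → S → S → Prop) (s0 : X → S)
    (fwd : ∀ e ∈ Ek, K.tgt e ∈ W → ∀ a, ∃ b, R e a b)
    (bwd : ∀ e ∈ Ek, K.src e ∈ W → ∀ b, ∃ a, R e a b)
    (tri : ∀ t ∈ Tk, ∀ s : X → S, (∀ x ∈ D, s x = s0 x) →
      K.TwoOfThree (fun e => K.EIn D e ∨ R e (s (K.src e)) (s (K.tgt e))) t) :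
    Ek.card = W.card + Tk.card ∧
      ∃ s : X → S, (∀ x ∈ D, s x = s0 x) ∧ ∀ e ∈ Ek, R e (s (K.src e)) (s (K.tgt e)) := by
  induction hn : Tk.card generalizing Ek Tk with
  | zero =>
    exact graph_extension W Ek hW hE hcut (by omega) R s0 fwd bwd
  | succ k ih =>
    obtain ⟨e, heD, hsum⟩ := hfree Tk subset_rfl (by rw [← Finset.card_pos]; omega)
    obtain ⟨t, ht, ht0⟩ : ∃ t ∈ Tk, K.sideCount t e ≠ 0 := by
      by_contra! h
      rw [Finset.sum_eq_zero h] at hsum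
      omega
    rw [← Finset.add_sum_erase Tk _ ht] at hsum
    have ht1 : K.sideCount t e = 1 := by omega
    have hoth : ∀ t' ∈ Tk.erase t, K.sideCount t' e = 0 :=
      Finset.sum_eq_zero_iff.1 (by omega)
    have hTt := hT t ht
    have he : e ∈ Ek := by
      by_contra hne
      have hd : ∀ e', (e' ∈ Ek ∨ K.EIn D e') → e' ≠ e := by
        rintro e' (h | h) rfl
        exacts [hne h, heD h]
      exact ht0 (by simp [sideCount, hd _ hTt.1, hd _ hTt.2.1, hd _ hTt.2.2])
    obtain ⟨hcard, s, hs, hR⟩ := ih (Ek.erase e) (Tk.erase t)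
      (fun e' he' => hE e' (Finset.mem_of_mem_erase he'))
      (by
        intro t' ht'
        have h1 := hT t' (Finset.mem_of_mem_erase ht')
        have h2 := hoth t' ht'
        simp only [sideCount, Nat.add_eq_zero_iff, ite_eq_right_iff, one_ne_zero, imp_false] at h2
        simp only [Finset.mem_erase]
        exact ⟨h1.1.imp_left fun h => ⟨h2.1.1, h⟩, h1.2.1.imp_left fun h => ⟨h2.1.2, h⟩,
          h1.2.2.imp_left fun h => ⟨h2.2, h⟩⟩)
      (by
        intro A hA hAne
        obtain ⟨e1, he1, hc1⟩ := hcut A hA hAne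
        by_cases h1 : e1 = e
        swap
        · exact ⟨e1, Finset.mem_erase.2 ⟨h1, he1⟩, hc1⟩
        subst h1
        have hnD : ∀ e', K.EIn D e' → ¬ K.Cut (A : Set X) e' := by
          intro e' h h'
          have h1 : K.src e' ∉ A := fun hh => hW _ (hA hh) h.1
          have h2 : K.tgt e' ∉ A := fun hh => hW _ (hA hh) h.2
          simp [Cut, h1, h2] at h'
        have h3 : (K.d0 t ≠ e1 ∧ K.Cut (A : Set X) (K.d0 t)) ∨
            (K.d1 t ≠ e1 ∧ K.Cut (A : Set X) (K.d1 t)) ∨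
            (K.d2 t ≠ e1 ∧ K.Cut (A : Set X) (K.d2 t)) := by
          simp only [sideCount] at ht1
          by_cases h0 : K.d0 t = e1
          · have ha : K.d1 t ≠ e1 := by rintro h; simp [h0, h] at ht1; omega
            have hb : K.d2 t ≠ e1 := by rintro h; simp [h0, h] at ht1
            exact (K.cut_d0 (h0 ▸ hc1)).elim (fun h => .inr (.inl ⟨ha, h⟩))
              fun h => .inr (.inr ⟨hb, h⟩)
          · by_cases h1 : K.d1 t = e1
            · have hb : K.d2 t ≠ e1 := by rintro h; simp [h1, h] at ht1
              exact (K.cut_d1 (h1 ▸ hc1)).elim (fun h => .inl ⟨h0, h⟩)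
                fun h => .inr (.inr ⟨hb, h⟩)
            · have h2 : K.d2 t = e1 := by
                by_contra h2
                simp [h0, h1, h2] at ht1
              exact (K.cut_d2 (h2 ▸ hc1)).elim (fun h => .inl ⟨h0, h⟩)
                fun h => .inr (.inl ⟨h1, h⟩)
        rcases h3 with h | h | h
        · exact ⟨_, Finset.mem_erase.2 ⟨h.1, hTt.1.resolve_right fun hh => hnD _ hh h.2⟩, h.2⟩
        · exact ⟨_, Finset.mem_erase.2 ⟨h.1, hTt.2.1.resolve_right fun hh => hnD _ hh h.2⟩, h.2⟩
        · exact ⟨_, Finset.mem_erase.2 ⟨h.1, hTt.2.2.resolve_right fun hh => hnD _ hh h.2⟩, h.2⟩)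
      (fun T' hT' => hfree T' (hT'.trans (Finset.erase_subset _ _)))
      (by rw [Finset.card_erase_of_mem ht, Finset.card_erase_of_mem he]; omega)
      (fun e' he' h => fwd e' (Finset.mem_of_mem_erase he') h)
      (fun e' he' h => bwd e' (Finset.mem_of_mem_erase he') h)
      (fun t' ht' => tri t' (Finset.mem_of_mem_erase ht'))
      (by rw [Finset.card_erase_of_mem ht]; omega)
    have hpos : 0 < Ek.card := Finset.card_pos.2 ⟨e, he⟩
    rw [Finset.card_erase_of_mem he] at hcard
    refine ⟨by omega, s, hs, ?_⟩
    intro e' he'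
    by_cases h : e' = e
    swap
    · exact hR e' (Finset.mem_erase.2 ⟨h, he'⟩)
    subst h
    have hQ : ∀ e1, e1 ≠ e' → (e1 ∈ Ek ∨ K.EIn D e1) →
        (K.EIn D e1 ∨ R e1 (s (K.src e1)) (s (K.tgt e1))) := by
      rintro e1 h1 (h2 | h2)
      · exact Or.inr (hR e1 (Finset.mem_erase.2 ⟨h1, h2⟩))
      · exact Or.inl h2
    obtain ⟨q2, q1, q0⟩ := tri t ht s hs
    refine Or.resolve_left (a := K.EIn D e') ?_ heD
    simp only [sideCount] at ht1
    by_cases h0 : K.d0 t = e'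
    · have ha : K.d1 t ≠ e' := by rintro h; simp [h0, h] at ht1; omega
      have hb : K.d2 t ≠ e' := by rintro h; simp [h0, h] at ht1
      have := q0 (hQ _ ha hTt.2.1) (hQ _ hb hTt.2.2)
      rwa [h0] at this
    · by_cases h1 : K.d1 t = e'
      · have hb : K.d2 t ≠ e' := by rintro h; simp [h1, h] at ht1
        have := q1 (hQ _ h0 hTt.1) (hQ _ hb hTt.2.2)
        rwa [h1] at this
      · have h2 : K.d2 t = e' := by
          by_contra h2
          simp [h0, h1, h2] at ht1
        have := q2 (hQ _ h0 hTt.1) (hQ _ h1 hTt.2.1)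
        rwa [h2] at this

end TriComplex

namespace TriComplex

open scoped Classical

/-- The number of elements satisfying `p`, as an integer. -/
noncomputable def cnt {α : Type*} [Fintype α] (p : α → Prop) : ℤ := ∑ x, if p x then 1 else 0

theorem cnt_eq_card {α : Type*} [Fintype α] (p : α → Prop) [DecidablePred p] :
    cnt p = ((Finset.univ.filter p).card : ℤ) := by
  rw [cnt, Finset.card_filter]
  push_cast
  exact Finset.sum_congr rfl fun x _ => by congr

theorem cnt_nonneg {α : Type*} [Fintype α] (p : α → Prop) : 0 ≤ cnt p := by
  rw [cnt_eq_card]; positivity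

variable {X E T : Type*} (K : TriComplex X E T)

/-- The edge `e` joins `A` to `B`. -/
def Cross (A B : Set X) (e : E) : Prop :=
  (K.src e ∈ A ∧ K.tgt e ∈ B) ∨ (K.src e ∈ B ∧ K.tgt e ∈ A)

/-- The triangle `t` lies in `A ∪ B` but neither in `A` nor in `B`. -/
def TMixed (A B : Set X) (t : T) : Prop := K.TIn (A ∪ B) t ∧ ¬ K.TIn A t ∧ ¬ K.TIn B t

/-- The triangle `t` has a vertex in `A`. -/
def TMeets (A : Set X) (t : T) : Prop := K.va t ∈ A ∨ K.vb t ∈ A ∨ K.vc t ∈ A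

/-- The triangle `t` has a side in `Ω`. -/
def HasSide (Ω : Set E) (t : T) : Prop := K.d0 t ∈ Ω ∨ K.d1 t ∈ Ω ∨ K.d2 t ∈ Ω

/-- Cut formulation of connectedness of the subgraph induced on `A`. -/
def Conn (A : Set X) : Prop :=
  ∀ B ⊆ A, B.Nonempty → B ≠ A → ∃ e, K.EIn A e ∧ K.Cut B e

/-- Some edge joins `A` to `B`. -/
def Adj (A B : Set X) : Prop := ∃ e, K.Cross A B e

/-- The triangles not contained in `D` are connected through edges not contained in `D`. -/
def DualConn (D : Set X) : Prop :=
  ∀ T' : Set T, T'.Nonempty → (∀ t ∈ T', ¬ K.TIn D t) → (∃ t, ¬ K.TIn D t ∧ t ∉ T') →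
    ∃ t ∈ T', ∃ t' ∉ T', ¬ K.TIn D t' ∧ ∃ e, ¬ K.EIn D e ∧
      K.sideCount t e ≠ 0 ∧ K.sideCount t' e ≠ 0

/-- `Ω` contains all or none of the `A`-`D` sides of each triangle mixed between `A` and `D`. -/
def ClosedCross (A D : Set X) (Ω : Set E) : Prop :=
  (∀ e ∈ Ω, K.Cross A D e) ∧ ∀ t, K.TMixed A D t → K.HasSide Ω t →
    (K.Cross A D (K.d0 t) → K.d0 t ∈ Ω) ∧ (K.Cross A D (K.d1 t) → K.d1 t ∈ Ω) ∧
    (K.Cross A D (K.d2 t) → K.d2 t ∈ Ω)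

/-- Each edge is a side of exactly two triangles, counted with multiplicity. -/
def Closed [Fintype T] : Prop := ∀ e, ∑ t, K.sideCount t e = 2

/-- Euler characteristic of the subcomplex induced on `A`. -/
noncomputable def chi [Fintype X] [Fintype E] [Fintype T] (A : Set X) : ℤ :=
  cnt (fun x => x ∈ A) - cnt (K.EIn A) + cnt (K.TIn A)

/-- Number of edges in `Ω` minus the number of mixed triangles having a side in `Ω`. -/
noncomputable def exc [Fintype E] [Fintype T] (A D : Set X) (Ω : Set E) : ℤ :=
  cnt (fun e => e ∈ Ω) - cnt (fun t => K.TMixed A D t ∧ K.HasSide Ω t)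

/-- The relative Euler characteristic (negated) between two disjoint sets. -/
noncomputable def link [Fintype E] [Fintype T] (A D : Set X) : ℤ :=
  cnt (K.Cross A D) - cnt (K.TMixed A D)

variable {K}

theorem Conn.union {A B : Set X} (hA : K.Conn A) (hB : K.Conn B) (hAB : K.Adj A B) :
    K.Conn (A ∪ B) := by
  intro C hC hne hCne
  by_cases h1 : (C ∩ A).Nonempty ∧ C ∩ A ≠ A
  · obtain ⟨e, he, hc⟩ := hA _ Set.inter_subset_right h1.1 h1.2
    refine ⟨e, ⟨Or.inl he.1, Or.inl he.2⟩, ?_⟩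
    simpa [Cut, he.1, he.2] using hc
  by_cases h2 : (C ∩ B).Nonempty ∧ C ∩ B ≠ B
  · obtain ⟨e, he, hc⟩ := hB _ Set.inter_subset_right h2.1 h2.2
    refine ⟨e, ⟨Or.inr he.1, Or.inr he.2⟩, ?_⟩
    simpa [Cut, he.1, he.2] using hc
  have h1' : (∀ x ∈ A, x ∉ C) ∨ A ⊆ C := by
    by_cases h : (C ∩ A).Nonempty
    · right
      have : C ∩ A = A := by_contra fun h' => h1 ⟨h, h'⟩
      exact Set.inter_eq_right.1 this
    · left
      exact fun x hx hx' => h ⟨x, hx', hx⟩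
  have h2' : (∀ x ∈ B, x ∉ C) ∨ B ⊆ C := by
    by_cases h : (C ∩ B).Nonempty
    · right
      have : C ∩ B = B := by_contra fun h' => h2 ⟨h, h'⟩
      exact Set.inter_eq_right.1 this
    · left
      exact fun x hx hx' => h ⟨x, hx', hx⟩
  obtain ⟨e, he⟩ := hAB
  obtain ⟨y, hy⟩ := hne
  rcases h1' with h1' | h1' <;> rcases h2' with h2' | h2'
  · exact absurd hy ((hC hy).elim (h1' y) (h2' y))
  · refine ⟨e, ?_, ?_⟩
    · rcases he with he | he
      exacts [⟨.inl he.1, .inr he.2⟩, ⟨.inr he.1, .inl he.2⟩]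
    · rcases he with he | he
      · simp [Cut, h1' _ he.1, h2' he.2]
      · simp [Cut, h1' _ he.2, h2' he.1]
  · refine ⟨e, ?_, ?_⟩
    · rcases he with he | he
      exacts [⟨.inl he.1, .inr he.2⟩, ⟨.inr he.1, .inl he.2⟩]
    · rcases he with he | he
      · simp [Cut, h1' he.1, h2' _ he.2]
      · simp [Cut, h1' he.2, h2' _ he.1]
  · exact absurd (subset_antisymm hC (Set.union_subset h1' h2')) hCne

theorem DualConn.exists_free [Fintype T] {D : Set X} (hK : K.Closed) (hD : K.DualConn D)
    (T' : Finset T) (hne : T'.Nonempty) (hT' : ∀ t ∈ T', ¬ K.TIn D t)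
    (hout : ∃ t, ¬ K.TIn D t ∧ t ∉ T') :
    ∃ e, ¬ K.EIn D e ∧ ∑ t ∈ T', K.sideCount t e = 1 := by
  obtain ⟨t, ht, t', ht', -, e, he, h1, h2⟩ := hD (T' : Set T) hne hT' hout
  refine ⟨e, he, ?_⟩
  have h3 := hK e
  rw [← Finset.sum_add_sum_compl T'] at h3
  have h4 := Finset.single_le_sum (f := fun t => K.sideCount t e) (fun _ _ => Nat.zero_le _)
    (Finset.mem_coe.1 ht)
  have h5 := Finset.single_le_sum (f := fun t => K.sideCount t e) (fun _ _ => Nat.zero_le _)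
    (Finset.mem_compl.2 ht')
  omega

section Counting

variable [Fintype X] [Fintype E] [Fintype T]

theorem sum_sides (hK : K.Closed) (f : E → ℤ) :
    ∑ t, (f (K.d0 t) + f (K.d1 t) + f (K.d2 t)) = 2 * ∑ e, f e := by
  have h : ∀ t, f (K.d0 t) + f (K.d1 t) + f (K.d2 t) = ∑ e, (K.sideCount t e : ℤ) * f e := by
    intro t
    simp [sideCount, add_mul, Finset.sum_add_distrib]
  simp_rw [h]
  rw [Finset.sum_comm, Finset.mul_sum]
  refine Finset.sum_congr rfl fun e _ => ?_
  rw [← Finset.sum_mul]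
  have := hK e
  rw [show (∑ t, (K.sideCount t e : ℤ)) = 2 by exact_mod_cast this]

theorem chi_union {A B : Set X} (h : Disjoint A B) :
    K.chi (A ∪ B) = K.chi A + K.chi B - K.link A B := by
  have hAB : ∀ x, x ∈ A → x ∉ B := fun x hx hx' => Set.disjoint_left.1 h hx hx'
  have h0 : cnt (fun x => x ∈ A ∪ B) = cnt (fun x => x ∈ A) + cnt (fun x => x ∈ B) := by
    simp only [cnt, ← Finset.sum_add_distrib]
    refine Finset.sum_congr rfl fun x _ => ?_
    have := hAB x
    simp only [Set.mem_union]
    split_ifs <;> grind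
  have h1 : cnt (K.EIn (A ∪ B)) = cnt (K.EIn A) + cnt (K.EIn B) + cnt (K.Cross A B) := by
    simp only [cnt, ← Finset.sum_add_distrib]
    refine Finset.sum_congr rfl fun e _ => ?_
    have h1 := hAB (K.src e)
    have h2 := hAB (K.tgt e)
    simp only [EIn, Cross, Set.mem_union]
    grind
  have h2 : cnt (K.TIn (A ∪ B)) = cnt (K.TIn A) + cnt (K.TIn B) + cnt (K.TMixed A B) := by
    simp only [cnt, ← Finset.sum_add_distrib]
    refine Finset.sum_congr rfl fun t _ => ?_
    have h1 := hAB (K.va t)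
    have h2 := hAB (K.vb t)
    have h3 := hAB (K.vc t)
    simp only [TIn, TMixed, Set.mem_union]
    grind
  simp only [chi, link]
  linarith

theorem two_link (hK : K.Closed) {A B : Set X} (h : Disjoint A B) :
    2 * K.link A B =
      cnt (fun t => K.TMeets A t ∧ K.TMeets B t ∧ K.TMeets (A ∪ B)ᶜ t) := by
  have hAB : ∀ x, x ∈ A → x ∉ B := fun x hx hx' => Set.disjoint_left.1 h hx hx'
  have h1 := K.sum_sides hK (fun e => if K.Cross A B e then 1 else 0)
  rw [link, mul_sub, cnt, ← h1, cnt, cnt, Finset.mul_sum, ← Finset.sum_sub_distrib]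
  refine Finset.sum_congr rfl fun t _ => ?_
  have h1 := hAB (K.va t)
  have h2 := hAB (K.vb t)
  have h3 := hAB (K.vc t)
  simp only [TIn, TMixed, TMeets, Cross, Set.mem_union, Set.mem_compl_iff,
    K.src_d0, K.src_d1, K.src_d2, K.tgt_d0, K.tgt_d1, K.tgt_d2]
  grind

theorem link_union_left {A B C : Set X} (hK : K.Closed) (hAB : Disjoint A B) (hAC : Disjoint A C)
    (hBC : Disjoint B C) :
    K.link (A ∪ B) C = K.link A C + K.link B C -
      cnt (fun t => K.TMeets A t ∧ K.TMeets B t ∧ K.TMeets C t) := by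
  have h1 := K.two_link hK (A := A ∪ B) (B := C) (hAC.union_left hBC)
  have h2 := K.two_link hK hAC
  have h3 := K.two_link hK hBC
  have hAB : ∀ x, x ∈ A → x ∉ B := fun x hx hx' => Set.disjoint_left.1 hAB hx hx'
  have hAC : ∀ x, x ∈ A → x ∉ C := fun x hx hx' => Set.disjoint_left.1 hAC hx hx'
  have hBC : ∀ x, x ∈ B → x ∉ C := fun x hx hx' => Set.disjoint_left.1 hBC hx hx'
  have h4 : cnt (fun t => K.TMeets (A ∪ B) t ∧ K.TMeets C t ∧ K.TMeets (A ∪ B ∪ C)ᶜ t) =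
      cnt (fun t => K.TMeets A t ∧ K.TMeets C t ∧ K.TMeets (A ∪ C)ᶜ t) +
      cnt (fun t => K.TMeets B t ∧ K.TMeets C t ∧ K.TMeets (B ∪ C)ᶜ t) -
      2 * cnt (fun t => K.TMeets A t ∧ K.TMeets B t ∧ K.TMeets C t) := by
    simp only [cnt, ← Finset.sum_add_distrib, Finset.mul_sum, ← Finset.sum_sub_distrib]
    refine Finset.sum_congr rfl fun t _ => ?_
    have a1 := hAB (K.va t)
    have a2 := hAB (K.vb t)
    have a3 := hAB (K.vc t)
    have b1 := hAC (K.va t)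
    have b2 := hAC (K.vb t)
    have b3 := hAC (K.vc t)
    have c1 := hBC (K.va t)
    have c2 := hBC (K.vb t)
    have c3 := hBC (K.vc t)
    simp only [TMeets, Set.mem_union, Set.mem_compl_iff]
    clear h1 h2 h3 hAB hAC hBC
    grind
  linarith

theorem link_eq_zero {A B : Set X} (h : ¬ K.Adj A B) : K.link A B = 0 := by
  have h1 : ∀ e, ¬ K.Cross A B e := fun e he => h ⟨e, he⟩
  have h2 : ∀ t, ¬ K.TMixed A B t := by
    intro t
    have h0 := h1 (K.d0 t)
    have h1 := h1 (K.d1 t)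
    simp only [TIn, TMixed, Cross, Set.mem_union,
      K.src_d0, K.src_d1, K.src_d2, K.tgt_d0, K.tgt_d1, K.tgt_d2] at *
    grind
  simp [link, cnt, h1, h2]

theorem exc_cross {A D : Set X} :
    K.exc A D {e | K.Cross A D e} = K.link A D := by
  have : ∀ t, K.TMixed A D t → K.HasSide {e | K.Cross A D e} t := by
    intro t
    simp only [TIn, TMixed, HasSide, Cross, Set.mem_union, Set.mem_ofPred_eq,
      K.src_d0, K.src_d1, K.src_d2, K.tgt_d0, K.tgt_d1, K.tgt_d2]
    grind
  have h2 : (fun t => K.TMixed A D t ∧ K.HasSide {e | K.Cross A D e} t) = K.TMixed A D := by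
    ext t
    exact and_iff_left_of_imp (this t)
  simp only [exc, link, h2]
  rfl

theorem closedCross_cross (A D : Set X) : K.ClosedCross A D {e | K.Cross A D e} :=
  ⟨fun _ h => h, fun _ _ _ => ⟨id, id, id⟩⟩

end Counting

end TriComplex

namespace TriComplex

open scoped Classical

variable {X E T : Type*} {K : TriComplex X E T} [Fintype X] [Fintype E] [Fintype T]

section Section

variable {G : Type*} [Group G]

/-- The relations cutting out a section over `A` of the coset system of `H`,
with boundary values prescribed by `c` on edges leaving `A`. -/
def CosetRel (K : TriComplex X E T) (A : Set X) (H : Subgroup G) (c : X → G) (g : X → X → G)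
    (e : E) (a b : G) : Prop :=
  if K.src e ∈ A then
    if K.tgt e ∈ A then a * g (K.src e) (K.tgt e) * b⁻¹ ∈ H else a * (c (K.src e))⁻¹ ∈ H
  else b * (c (K.tgt e))⁻¹ ∈ H

theorem cosetRel_twoOfThree {A D : Set X} (hAD : Disjoint A D)
    {H : Subgroup G} {c : X → G} {g : X → X → G}
    (hflat : ∀ t, K.TIn A t → g (K.va t) (K.vb t) * g (K.vb t) (K.vc t) = g (K.va t) (K.vc t))
    (htri : ∀ t, (K.va t ∈ D → K.EIn A (K.d0 t) →
        c (K.vb t) * g (K.vb t) (K.vc t) * (c (K.vc t))⁻¹ ∈ H) ∧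
      (K.vb t ∈ D → K.EIn A (K.d1 t) →
        c (K.va t) * g (K.va t) (K.vc t) * (c (K.vc t))⁻¹ ∈ H) ∧
      (K.vc t ∈ D → K.EIn A (K.d2 t) →
        c (K.va t) * g (K.va t) (K.vb t) * (c (K.vb t))⁻¹ ∈ H))
    {t : T} (ht : K.TIn A t ∨ K.TMixed A D t) (s : X → G) :
    K.TwoOfThree (fun e => K.EIn D e ∨
      K.CosetRel A H c g e (s (K.src e)) (s (K.tgt e))) t := by
  have hA : ∀ x, x ∈ A → x ∉ D := fun x hx hx' => Set.disjoint_left.1 hAD hx hx'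
  have key : ∀ {x y z : G}, x * y = z → (x ∈ H → y ∈ H → z ∈ H) ∧ (x ∈ H → z ∈ H → y ∈ H) ∧
      (y ∈ H → z ∈ H → x ∈ H) := by
    rintro x y z rfl
    refine ⟨H.mul_mem, fun h1 h2 => (H.mul_mem_cancel_left h1).1 h2,
      fun h1 h2 => (H.mul_mem_cancel_right h1).1 h2⟩
  have t0 := htri t
  simp only [EIn, K.src_d0, K.src_d1, K.src_d2, K.tgt_d0, K.tgt_d1, K.tgt_d2] at t0
  simp only [TwoOfThree, EIn, CosetRel,
    K.src_d0, K.src_d1, K.src_d2, K.tgt_d0, K.tgt_d1, K.tgt_d2]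
  simp only [TMixed, TIn, Set.mem_union] at ht
  have f := hflat t
  simp only [TIn] at f
  have ia := hA (K.va t)
  have ib := hA (K.vb t)
  have ic := hA (K.vc t)
  generalize K.va t = x at *
  generalize K.vb t = y at *
  generalize K.vc t = z at *
  have k1 := fun h => key (x := s x * g x y * (s y)⁻¹) (y := s y * g y z * (s z)⁻¹)
    (z := s x * g x z * (s z)⁻¹) (by rw [← f h]; group)
  have kk : ∀ w w', c w * g w w' * (c w')⁻¹ ∈ H →
      (s w * (c w)⁻¹ ∈ H → s w' * (c w')⁻¹ ∈ H → s w * g w w' * (s w')⁻¹ ∈ H) ∧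
      (s w * (c w)⁻¹ ∈ H → s w * g w w' * (s w')⁻¹ ∈ H → s w' * (c w')⁻¹ ∈ H) ∧
      (s w' * (c w')⁻¹ ∈ H → s w * g w w' * (s w')⁻¹ ∈ H → s w * (c w)⁻¹ ∈ H) := by
    intro w w' h
    have e1 : s w * g w w' * (s w')⁻¹ = (s w * (c w)⁻¹) * (c w * g w w' * (c w')⁻¹) *
      (s w' * (c w')⁻¹)⁻¹ := by group
    rw [e1]
    refine ⟨fun h1 h2 => H.mul_mem (H.mul_mem h1 h) (H.inv_mem h2), fun h1 h2 => ?_,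
      fun h1 h2 => ?_⟩
    · exact (H.inv_mem_iff).1 ((H.mul_mem_cancel_left (H.mul_mem h1 h)).1 h2)
    · exact (H.mul_mem_cancel_right h).1 ((H.mul_mem_cancel_right (H.inv_mem h1)).1 h2)
  have kxy := kk x y
  have kyz := kk y z
  have kxz := kk x z
  clear kk key hflat htri hA f
  by_cases hx : x ∈ A <;> by_cases hy : y ∈ A <;> by_cases hz : z ∈ A <;>
    simp only [hx, hy, hz, if_true, if_false, true_and, and_true, and_false, false_and, or_false,
      false_or, not_true, not_false_iff, forall_const, true_or, or_true, and_self] at * <;>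
    grind

theorem extension_over {A D : Set X} (hK : K.Closed) (hAD : Disjoint A D) (hA : K.Conn A)
    (hD : K.DualConn D) (hout : ∃ t, ¬ K.TIn (A ∪ D) t) {Ω : Set E}
    (hΩ : K.ClosedCross A D Ω) (hne : Ω.Nonempty)
    {S : Type*} (R : E → S → S → Prop) (s0 : X → S)
    (fwd : ∀ e, K.tgt e ∈ A → ∀ a, ∃ b, R e a b)
    (bwd : ∀ e, K.src e ∈ A → ∀ b, ∃ a, R e a b)
    (tri : ∀ t, K.TIn A t ∨ K.TMixed A D t → ∀ s : X → S, (∀ x ∈ D, s x = s0 x) →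
      K.TwoOfThree (fun e => K.EIn D e ∨ R e (s (K.src e)) (s (K.tgt e))) t)
    (hexc : K.exc A D Ω ≤ K.chi A) :
    K.exc A D Ω = K.chi A ∧ ∃ s : X → S, ∀ e, K.EIn A e ∨ e ∈ Ω →
      R e (s (K.src e)) (s (K.tgt e)) := by
  have hA' : ∀ x, x ∈ A → x ∉ D := fun x hx hx' => Set.disjoint_left.1 hAD hx hx'
  set W : Finset X := Finset.univ.filter (· ∈ A) with hW
  set Ek : Finset E := Finset.univ.filter (fun e => K.EIn A e ∨ e ∈ Ω) with hEk
  set Tk : Finset T :=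
    Finset.univ.filter (fun t => K.TIn A t ∨ (K.TMixed A D t ∧ K.HasSide Ω t)) with hTk
  have cW : (W.card : ℤ) = cnt (fun x => x ∈ A) := (cnt_eq_card _).symm
  have cE : (Ek.card : ℤ) = cnt (K.EIn A) + cnt (fun e => e ∈ Ω) := by
    rw [hEk, ← cnt_eq_card]
    simp only [cnt, ← Finset.sum_add_distrib]
    refine Finset.sum_congr rfl fun e _ => ?_
    have h1 := hΩ.1 e
    have h2 := hA' (K.src e)
    have h3 := hA' (K.tgt e)
    simp only [EIn, Cross] at *
    grind
  have cT : (Tk.card : ℤ) = cnt (K.TIn A) + cnt (fun t => K.TMixed A D t ∧ K.HasSide Ω t) := by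
    rw [hTk, ← cnt_eq_card]
    simp only [cnt, ← Finset.sum_add_distrib]
    refine Finset.sum_congr rfl fun t _ => ?_
    simp only [TMixed]
    grind
  have hcount : (Ek.card : ℤ) ≤ W.card + Tk.card := by
    simp only [exc, chi] at hexc
    linarith
  have main := complex_extension (K := K) (D := D) W Ek Tk
    (by simpa [W] using hA')
    (by
      intro e he
      have he : K.EIn A e ∨ e ∈ Ω := by simpa [Ek] using he
      have h1 := hΩ.1 e
      simp only [W, Finset.mem_filter, Finset.mem_univ, true_and]
      simp only [EIn, Cross] at *
      grind)
    (by
      intro t ht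
      have ht : K.TIn A t ∨ (K.TMixed A D t ∧ K.HasSide Ω t) := by simpa [Tk] using ht
      simp only [Ek, Finset.mem_filter, Finset.mem_univ, true_and]
      rcases ht with ht | ht
      · simp only [TIn] at ht
        simp [EIn, K.src_d0, K.src_d1, K.src_d2, K.tgt_d0, K.tgt_d1, K.tgt_d2, ht]
      · have h1 := hΩ.2 t ht.1 ht.2
        have h2 := ht.1
        simp only [TMixed, TIn, Set.mem_union] at h2
        simp only [EIn, Cross, K.src_d0, K.src_d1, K.src_d2, K.tgt_d0, K.tgt_d1,
          K.tgt_d2] at h1 ⊢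
        clear hcount cT cE cW hexc tri fwd bwd hΩ hD hA
        refine ⟨?_, ?_, ?_⟩ <;> grind)
    (by
      intro B hB hBne
      by_cases hBA : (B : Set X) = A
      · obtain ⟨e, he⟩ := hne
        refine ⟨e, by simp [Ek, he], ?_⟩
        rw [hBA]
        have h1 := hΩ.1 e he
        have h2 := hA' (K.src e)
        have h3 := hA' (K.tgt e)
        simp only [Cut, Cross] at *
        grind
      · obtain ⟨e, he, hc⟩ := hA B (fun x hx => by simpa [W] using hB hx) hBne hBA
        exact ⟨e, by simp [Ek, he], hc⟩)
    (by
      intro T' hT' hT'ne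
      have hsub : ∀ t ∈ T', K.TIn A t ∨ (K.TMixed A D t ∧ K.HasSide Ω t) := by
        intro t ht
        simpa [Tk] using hT' ht
      refine hD.exists_free hK T' hT'ne ?_ ?_
      · intro t ht
        rcases hsub t ht with h | h
        · exact fun h' => hA' _ h.1 h'.1
        · exact h.1.2.2
      · obtain ⟨t, ht⟩ := hout
        refine ⟨t, fun h => ht ⟨.inr h.1, .inr h.2.1, .inr h.2.2⟩, fun h => ht ?_⟩
        rcases hsub t h with h | h
        · exact ⟨.inl h.1, .inl h.2.1, .inl h.2.2⟩
        · exact h.1.1)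
    (by exact_mod_cast hcount) R s0
    (fun e _ he => fwd e (by simpa [W] using he))
    (fun e _ he => bwd e (by simpa [W] using he))
    (fun t ht => tri t (by
      have ht : K.TIn A t ∨ (K.TMixed A D t ∧ K.HasSide Ω t) := by simpa [Tk] using ht
      exact ht.imp_right And.left))
  obtain ⟨hcard, s, -, hs⟩ := main
  refine ⟨?_, s, fun e he => hs e (by simpa [Ek] using he)⟩
  have : (Ek.card : ℤ) = W.card + Tk.card := by exact_mod_cast hcard
  simp only [exc, chi]
  linarith

theorem chi_le_exc {A D : Set X} (hK : K.Closed) (hAD : Disjoint A D) (hA : K.Conn A)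
    (hD : K.DualConn D) (hout : ∃ t, ¬ K.TIn (A ∪ D) t) {Ω : Set E}
    (hΩ : K.ClosedCross A D Ω) (hne : Ω.Nonempty) : K.chi A ≤ K.exc A D Ω := by
  by_contra! h
  have := (extension_over hK hAD hA hD hout hΩ hne (S := Unit) (fun _ _ _ => True)
    (fun _ => ()) (fun _ _ _ => ⟨(), trivial⟩) (fun _ _ _ => ⟨(), trivial⟩)
    (fun _ _ _ _ => ⟨fun _ _ => .inr trivial, fun _ _ => .inr trivial, fun _ _ => .inr trivial⟩)
    h.le).1
  omega

theorem chi_le_link {A D : Set X} (hK : K.Closed) (hAD : Disjoint A D) (hA : K.Conn A)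
    (hD : K.DualConn D) (hout : ∃ t, ¬ K.TIn (A ∪ D) t) (hadj : K.Adj A D) :
    K.chi A ≤ K.link A D := by
  rw [← exc_cross]
  exact chi_le_exc hK hAD hA hD hout (closedCross_cross A D) hadj

/-- A section over `A` of the coset system of `H`, with boundary values on the edges of `Ω`. -/
theorem exists_section {A D : Set X} (hK : K.Closed) (hAD : Disjoint A D) (hA : K.Conn A)
    (hD : K.DualConn D) (hout : ∃ t, ¬ K.TIn (A ∪ D) t) {Ω : Set E}
    (hΩ : K.ClosedCross A D Ω) (hne : Ω.Nonempty)
    {H : Subgroup G} {c : X → G} {g : X → X → G}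
    (hflat : ∀ t, K.TIn A t → g (K.va t) (K.vb t) * g (K.vb t) (K.vc t) = g (K.va t) (K.vc t))
    (htri : ∀ t, (K.va t ∈ D → K.EIn A (K.d0 t) →
        c (K.vb t) * g (K.vb t) (K.vc t) * (c (K.vc t))⁻¹ ∈ H) ∧
      (K.vb t ∈ D → K.EIn A (K.d1 t) →
        c (K.va t) * g (K.va t) (K.vc t) * (c (K.vc t))⁻¹ ∈ H) ∧
      (K.vc t ∈ D → K.EIn A (K.d2 t) →
        c (K.va t) * g (K.va t) (K.vb t) * (c (K.vb t))⁻¹ ∈ H))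
    (hexc : K.exc A D Ω ≤ K.chi A) :
    ∃ s : X → G, (∀ e, K.EIn A e → s (K.src e) * g (K.src e) (K.tgt e) * (s (K.tgt e))⁻¹ ∈ H) ∧
      ∀ e ∈ Ω, (K.src e ∈ A → s (K.src e) * (c (K.src e))⁻¹ ∈ H) ∧
        (K.tgt e ∈ A → s (K.tgt e) * (c (K.tgt e))⁻¹ ∈ H) := by
  have hA' : ∀ x, x ∈ A → x ∉ D := fun x hx hx' => Set.disjoint_left.1 hAD hx hx'
  obtain ⟨-, s, hs⟩ := extension_over hK hAD hA hD hout hΩ hne (K.CosetRel A H c g) (fun _ => 1)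
    (by
      intro e he a
      by_cases h : K.src e ∈ A
      · exact ⟨a * g (K.src e) (K.tgt e), by simp [CosetRel, h, he, H.one_mem]⟩
      · exact ⟨c (K.tgt e), by simp [CosetRel, h, H.one_mem]⟩)
    (by
      intro e he b
      by_cases h : K.tgt e ∈ A
      · exact ⟨b * (g (K.src e) (K.tgt e))⁻¹, by simp [CosetRel, h, he, H.one_mem]⟩
      · exact ⟨c (K.src e), by simp [CosetRel, h, he, H.one_mem]⟩)
    (fun t ht s _ => cosetRel_twoOfThree hAD hflat htri ht s) hexc
  refine ⟨s, fun e he => ?_, fun e he => ?_⟩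
  · have := hs e (.inl he)
    simpa [CosetRel, he.1, he.2] using this
  · have h1 := hs e (.inr he)
    have h2 := hΩ.1 e he
    simp only [CosetRel] at h1
    rcases h2 with h2 | h2
    · have h3 : K.tgt e ∉ A := fun h => hA' _ h h2.2
      simp only [h2.1, h3, if_true, if_false] at h1
      exact ⟨fun _ => h1, fun h => absurd h h3⟩
    · have h3 : K.src e ∉ A := fun h => hA' _ h h2.1
      simp only [h3, if_false] at h1
      exact ⟨fun h => absurd h h3, fun _ => h1⟩

end Section

theorem chi_le_one {A : Set X} {x0 : X} (hK : K.Closed) (hA : K.Conn A) (hx0 : x0 ∈ A)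
    (hloop : ∀ e, K.src e ≠ K.tgt e) (hD : K.DualConn {x0}) (hout : ∃ t, ¬ K.TIn A t) :
    K.chi A ≤ 1 := by
  by_contra! hlt
  set D : Set X := {x0}
  set W : Finset X := Finset.univ.filter (fun x => x ∈ A ∧ x ≠ x0) with hW
  set Ek : Finset E := Finset.univ.filter (K.EIn A) with hEk
  set Tk : Finset T := Finset.univ.filter (K.TIn A) with hTk
  have cW : (W.card : ℤ) = cnt (fun x => x ∈ A) - 1 := by
    have h1 : cnt (fun x => x ∈ A) = cnt (fun x => x ∈ A ∧ x ≠ x0) + cnt (fun x => x = x0) := by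
      simp only [cnt, ← Finset.sum_add_distrib]
      refine Finset.sum_congr rfl fun x _ => ?_
      grind
    have h2 : cnt (fun x => x = x0) = 1 := by simp [cnt]
    rw [h1, h2, hW, ← cnt_eq_card]; ring
  have cE : (Ek.card : ℤ) = cnt (K.EIn A) := by rw [hEk, ← cnt_eq_card]
  have cT : (Tk.card : ℤ) = cnt (K.TIn A) := by rw [hTk, ← cnt_eq_card]
  have hcount : (Ek.card : ℤ) ≤ W.card + Tk.card := by
    simp only [chi] at hlt
    linarith
  have hTD : ∀ t, ¬ K.TIn D t := by
    rintro t ⟨h1, h2, -⟩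
    apply hloop (K.d2 t)
    rw [K.src_d2, K.tgt_d2]
    exact h1.trans h2.symm
  have main := complex_extension (K := K) (D := D) W Ek Tk
    (by simp [W, D])
    (by
      intro e he
      have he : K.EIn A e := by simpa [Ek] using he
      have h1 := hloop e
      simp only [W, Finset.mem_filter, Finset.mem_univ, true_and, D, Set.mem_singleton_iff]
      simp only [EIn] at he
      grind)
    (by
      intro t ht
      have ht : K.TIn A t := by simpa [Tk] using ht
      simp only [Ek, Finset.mem_filter, Finset.mem_univ, true_and]
      simp only [TIn] at ht
      simp [EIn, K.src_d0, K.src_d1, K.src_d2, K.tgt_d0, K.tgt_d1, K.tgt_d2, ht])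
    (by
      intro B hB hBne
      have hB' : ∀ x ∈ B, x ∈ A ∧ x ≠ x0 := fun x hx => by simpa [W] using hB hx
      obtain ⟨e, he, hc⟩ := hA B (fun x hx => (hB' x hx).1) hBne
        (fun h => (hB' x0 (by rw [← Finset.mem_coe, h]; exact hx0)).2 rfl)
      exact ⟨e, by simp [Ek, he], hc⟩)
    (by
      intro T' hT' hT'ne
      refine hD.exists_free hK T' hT'ne (fun t _ => hTD t) ?_
      obtain ⟨t, ht⟩ := hout
      exact ⟨t, hTD t, fun h => ht (by simpa [Tk] using hT' h)⟩)
    (by exact_mod_cast hcount) (S := Unit) (fun _ _ _ => True)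
    (fun _ => ()) (fun _ _ _ _ => ⟨(), trivial⟩) (fun _ _ _ _ => ⟨(), trivial⟩)
    (fun _ _ _ _ => ⟨fun _ _ => .inr trivial, fun _ _ => .inr trivial, fun _ _ => .inr trivial⟩)
  have : (Ek.card : ℤ) = W.card + Tk.card := by exact_mod_cast main.1
  simp only [chi] at hlt
  linarith

end TriComplex

namespace TriComplex

open scoped Classical

variable {X E T : Type*} {K : TriComplex X E T} [Fintype X] [Fintype E] [Fintype T]

theorem ClosedCross.sdiff {A D : Set X} {Ω B : Set E} (hΩ : K.ClosedCross A D Ω)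
    (hB : K.ClosedCross A D B) : K.ClosedCross A D (Ω \ B) := by
  refine ⟨fun e he => hΩ.1 e he.1, fun t ht hs => ?_⟩
  have h1 := hΩ.2 t ht
  have h2 := hB.2 t ht
  have h3 := hB.1 (K.d0 t)
  have h4 := hB.1 (K.d1 t)
  have h5 := hB.1 (K.d2 t)
  have h6 := hΩ.1 (K.d0 t)
  have h7 := hΩ.1 (K.d1 t)
  have h8 := hΩ.1 (K.d2 t)
  simp only [HasSide, Set.mem_sdiff] at *
  grind

theorem exc_sdiff {A D : Set X} {Ω B : Set E} (hBΩ : B ⊆ Ω) (hΩ : K.ClosedCross A D Ω)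
    (hB : K.ClosedCross A D B) : K.exc A D Ω = K.exc A D B + K.exc A D (Ω \ B) := by
  have h1 : cnt (fun e => e ∈ Ω) = cnt (fun e => e ∈ B) + cnt (fun e => e ∈ Ω \ B) := by
    simp only [cnt, ← Finset.sum_add_distrib]
    refine Finset.sum_congr rfl fun e _ => ?_
    have := @hBΩ e
    simp only [Set.mem_sdiff]
    grind
  have h2 : cnt (fun t => K.TMixed A D t ∧ K.HasSide Ω t) =
      cnt (fun t => K.TMixed A D t ∧ K.HasSide B t) +
      cnt (fun t => K.TMixed A D t ∧ K.HasSide (Ω \ B) t) := by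
    simp only [cnt, ← Finset.sum_add_distrib]
    refine Finset.sum_congr rfl fun t _ => ?_
    by_cases ht : K.TMixed A D t
    swap
    · simp [ht]
    have h2 := hB.2 t ht
    have h6 := hΩ.1 (K.d0 t)
    have h7 := hΩ.1 (K.d1 t)
    have h8 := hΩ.1 (K.d2 t)
    have b0 := @hBΩ (K.d0 t)
    have b1 := @hBΩ (K.d1 t)
    have b2 := @hBΩ (K.d2 t)
    simp only [HasSide, Set.mem_sdiff, ht, true_and] at *
    grind
  simp only [exc]
  linarith

theorem exc_le_one {A D : Set X} (hAD : Disjoint A D) (hloop : ∀ e, K.src e ≠ K.tgt e)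
    {Ω : Set E} (hΩ : K.ClosedCross A D Ω) (hne : Ω.Nonempty)
    (hmin : ∀ B ⊆ Ω, B.Nonempty → K.ClosedCross A D B → B = Ω) : K.exc A D Ω ≤ 1 := by
  have hA' : ∀ x, x ∈ A → x ∉ D := fun x hx hx' => Set.disjoint_left.1 hAD hx hx'
  let K' : TriComplex E T Empty :=
    { src := fun t => if K.Cross A D (K.d0 t) then K.d0 t else K.d1 t
      tgt := fun t => if K.Cross A D (K.d2 t) then K.d2 t else K.d1 t
      va := Empty.elim, vb := Empty.elim, vc := Empty.elim
      d0 := Empty.elim, d1 := Empty.elim, d2 := Empty.elim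
      src_d0 := fun t => t.elim, tgt_d0 := fun t => t.elim, src_d1 := fun t => t.elim
      tgt_d1 := fun t => t.elim, src_d2 := fun t => t.elim, tgt_d2 := fun t => t.elim }
  have hsrc : ∀ t, K'.src t = if K.Cross A D (K.d0 t) then K.d0 t else K.d1 t := fun _ => rfl
  have htgt : ∀ t, K'.tgt t = if K.Cross A D (K.d2 t) then K.d2 t else K.d1 t := fun _ => rfl
  have hends : ∀ t, K.TMixed A D t → K'.src t ≠ K'.tgt t ∧
      ∀ e, (e = K'.src t ∨ e = K'.tgt t) ↔
        (e = K.d0 t ∨ e = K.d1 t ∨ e = K.d2 t) ∧ K.Cross A D e := by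
    intro t ht
    have n0 : K.d0 t ≠ K.d1 t := fun h => hloop (K.d2 t) (by
      rw [K.src_d2, K.tgt_d2, ← K.src_d1, ← h, K.src_d0])
    have n1 : K.d0 t ≠ K.d2 t := fun h => hloop (K.d1 t) (by
      rw [K.src_d1, K.tgt_d1, ← K.src_d2, ← h, K.src_d0, ← K.tgt_d0, h, K.tgt_d2])
    have n2 : K.d1 t ≠ K.d2 t := fun h => hloop (K.d0 t) (by
      rw [K.src_d0, K.tgt_d0, ← K.tgt_d2, ← h, K.tgt_d1])
    have c0 : K.Cross A D (K.d0 t) ↔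
      (K.vb t ∈ A ∧ K.vc t ∈ D) ∨ (K.vb t ∈ D ∧ K.vc t ∈ A) := by
      rw [Cross, K.src_d0, K.tgt_d0]
    have c1 : K.Cross A D (K.d1 t) ↔
      (K.va t ∈ A ∧ K.vc t ∈ D) ∨ (K.va t ∈ D ∧ K.vc t ∈ A) := by
      rw [Cross, K.src_d1, K.tgt_d1]
    have c2 : K.Cross A D (K.d2 t) ↔
      (K.va t ∈ A ∧ K.vb t ∈ D) ∨ (K.va t ∈ D ∧ K.vb t ∈ A) := by
      rw [Cross, K.src_d2, K.tgt_d2]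
    have x1 := hA' (K.va t)
    have x2 := hA' (K.vb t)
    have x3 := hA' (K.vc t)
    simp only [TMixed, TIn, Set.mem_union] at ht
    rw [hsrc, htgt]
    clear hsrc htgt hmin hloop hA'
    by_cases y0 : K.Cross A D (K.d0 t) <;> by_cases y1 : K.Cross A D (K.d1 t) <;>
      by_cases y2 : K.Cross A D (K.d2 t) <;> simp only [y0, y1, y2, if_true, if_false] <;> grind
  obtain ⟨e0, he0⟩ := hne
  set W : Finset E := Finset.univ.filter (fun e => e ∈ Ω ∧ e ≠ e0) with hW
  set Ek : Finset T := Finset.univ.filter (fun t => K.TMixed A D t ∧ K.HasSide Ω t) with hEk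
  have cW : (W.card : ℤ) = cnt (fun e => e ∈ Ω) - 1 := by
    have h1 : cnt (fun e => e ∈ Ω) = cnt (fun e => e ∈ Ω ∧ e ≠ e0) + cnt (fun x => x = e0) := by
      simp only [cnt, ← Finset.sum_add_distrib]
      refine Finset.sum_congr rfl fun x _ => ?_
      grind
    have h2 : cnt (fun x => x = e0) = 1 := by simp [cnt]
    rw [h1, h2, hW, ← cnt_eq_card]; ring
  have cE : (Ek.card : ℤ) = cnt (fun t => K.TMixed A D t ∧ K.HasSide Ω t) := by
    rw [hEk, ← cnt_eq_card]
  by_contra! hlt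
  have hcount : (Ek.card : ℤ) ≤ W.card := by
    simp only [exc] at hlt
    linarith
  have main := graph_extension (K := K') (D := {e0}) W Ek
    (by simp [W])
    (by
      intro t ht
      have ht : K.TMixed A D t ∧ K.HasSide Ω t := by simpa [Ek] using ht
      have h1 := hΩ.2 t ht.1 ht.2
      have h2 := hends t ht.1
      have h3 := (h2.2 (K'.src t)).1 (.inl rfl)
      have h4 := (h2.2 (K'.tgt t)).1 (.inr rfl)
      have h5 : ∀ e, (e = K.d0 t ∨ e = K.d1 t ∨ e = K.d2 t) ∧ K.Cross A D e → e ∈ Ω := by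
        rintro e ⟨rfl | rfl | rfl, h⟩
        exacts [h1.1 h, h1.2.1 h, h1.2.2 h]
      have h6 := h5 _ h3
      have h7 := h5 _ h4
      have h8 := h2.1
      simp only [W, Finset.mem_filter, Finset.mem_univ, true_and, Set.mem_singleton_iff]
      clear h1 h2 h3 h4 h5 hends hsrc htgt hmin
      grind)
    (by
      intro B hB hBne
      have hB' : ∀ x ∈ B, x ∈ Ω ∧ x ≠ e0 := fun x hx => by simpa [W] using hB hx
      have hnc : ¬ K.ClosedCross A D (B : Set E) := fun h => by
        have := hmin B (fun x hx => (hB' x hx).1) hBne h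
        exact (hB' e0 (by rw [← Finset.mem_coe, this]; exact he0)).2 rfl
      simp only [ClosedCross, not_and_or, not_forall] at hnc
      rcases hnc with ⟨e, he, h⟩ | ⟨t, ht, hs, h⟩
      · exact absurd (hΩ.1 e (hB' e he).1) h
      · have h2 := hends t ht
        have hside : ∀ {e}, (e = K.d0 t ∨ e = K.d1 t ∨ e = K.d2 t) → e ∈ Ω → K.HasSide Ω t := by
          rintro e (rfl | rfl | rfl) h
          exacts [.inl h, .inr (.inl h), .inr (.inr h)]
        have h3 : ∃ e ∈ B, (e = K.d0 t ∨ e = K.d1 t ∨ e = K.d2 t) := by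
          rcases hs with h | h | h
          exacts [⟨_, h, .inl rfl⟩, ⟨_, h, .inr (.inl rfl)⟩, ⟨_, h, .inr (.inr rfl)⟩]
        have h4 : ∃ e ∉ B, (e = K.d0 t ∨ e = K.d1 t ∨ e = K.d2 t) ∧ K.Cross A D e := by
          rcases h with ⟨hc, h⟩ | ⟨hc, h⟩ | ⟨hc, h⟩
          exacts [⟨_, h, .inl rfl, hc⟩, ⟨_, h, .inr (.inl rfl), hc⟩, ⟨_, h, .inr (.inr rfl), hc⟩]
        obtain ⟨e, heB, he⟩ := h3
        obtain ⟨e', heB', he'⟩ := h4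
        have h5 := (h2.2 e).2 ⟨he, hΩ.1 e (hB' e heB).1⟩
        have h6 := (h2.2 e').2 he'
        refine ⟨t, by simpa [Ek] using ⟨ht, hside he (hB' e heB).1⟩, ?_⟩
        simp only [Cut, Finset.mem_coe]
        clear hside hends hsrc htgt h2
        grind)
    (by exact_mod_cast hcount) (S := Unit) (fun _ _ _ => True)
    (fun _ => ()) (fun _ _ _ _ => ⟨(), trivial⟩) (fun _ _ _ _ => ⟨(), trivial⟩)
  have : (Ek.card : ℤ) = W.card := by exact_mod_cast main.1
  simp only [exc] at hlt
  linarith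

theorem exists_split {A D : Set X} (hAD : Disjoint A D) (hloop : ∀ e, K.src e ≠ K.tgt e)
    (h2 : K.link A D = 2) :
    ∃ Ω, K.ClosedCross A D Ω ∧ Ω.Nonempty ∧ K.exc A D Ω = 1 ∧
      K.ClosedCross A D ({e | K.Cross A D e} \ Ω) ∧ ({e | K.Cross A D e} \ Ω).Nonempty ∧
      K.exc A D ({e | K.Cross A D e} \ Ω) = 1 := by
  have hpos : ∀ Ω : Set E, 1 ≤ K.exc A D Ω → Ω.Nonempty := by
    intro Ω h
    by_contra hne
    rw [Set.not_nonempty_iff_eq_empty] at hne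
    subst hne
    simp [exc, HasSide, cnt] at h
  rw [← exc_cross] at h2
  have hex : {Ω : Set E | K.ClosedCross A D Ω ∧ 1 ≤ K.exc A D Ω}.Nonempty :=
    ⟨_, closedCross_cross A D, by rw [h2]; norm_num⟩
  obtain ⟨Ω, ⟨hΩ, h1⟩, hmin⟩ := (Set.toFinite _).exists_minimal hex
  have hne := hpos Ω h1
  have hle : K.exc A D Ω ≤ 1 := by
    refine exc_le_one hAD hloop hΩ hne fun B hB hBne hBc => ?_
    by_contra hBΩ
    have hs := exc_sdiff hB hΩ hBc
    by_cases h : 1 ≤ K.exc A D B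
    · exact hBΩ (subset_antisymm hB (hmin ⟨hBc, h⟩ hB))
    · have := hmin (y := Ω \ B) ⟨hΩ.sdiff hBc, by omega⟩ Set.sdiff_subset
      obtain ⟨e, he⟩ := hBne
      exact (this (hB he)).2 he
  have hs := exc_sdiff (Ω := {e | K.Cross A D e}) (fun e he => hΩ.1 e he) (closedCross_cross A D) hΩ
  have h1' : K.exc A D ({e | K.Cross A D e} \ Ω) = 1 := by omega
  exact ⟨Ω, hΩ, hne, by omega, (closedCross_cross A D).sdiff hΩ, hpos _ h1'.ge, h1'⟩

end TriComplex

namespace TriComplex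

open scoped Classical

variable {X E T : Type*} {K : TriComplex X E T}

/-- `IsWalk K g A x y k`: there is an edge walk in `A` from `x` to `y` with holonomy `k`. -/
inductive IsWalk {G : Type*} [Group G] (K : TriComplex X E T) (g : X → X → G) (A : Set X) :
    X → X → G → Prop
  | refl (x : X) : x ∈ A → IsWalk K g A x x 1
  | fwd (x : X) (k : G) (e : E) : IsWalk K g A x (K.src e) k → K.tgt e ∈ A →
      IsWalk K g A x (K.tgt e) (k * g (K.src e) (K.tgt e))
  | bwd (x : X) (k : G) (e : E) : IsWalk K g A x (K.tgt e) k → K.src e ∈ A →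
      IsWalk K g A x (K.src e) (k * (g (K.src e) (K.tgt e))⁻¹)

theorem IsWalk.mem_right {G : Type*} [Group G] {g : X → X → G} {A : Set X} {x y : X} {k : G}
    (h : K.IsWalk g A x y k) : y ∈ A := by
  cases h <;> assumption

theorem IsWalk.mono {G : Type*} [Group G] {g : X → X → G} {A B : Set X} {x y : X} {k : G}
    (h : K.IsWalk g A x y k) (hAB : A ⊆ B) : K.IsWalk g B x y k := by
  induction h with
  | refl hx => exact .refl _ (hAB hx)
  | fwd k e _ he ih => exact .fwd _ k e ih (hAB he)
  | bwd k e _ he ih => exact .bwd _ k e ih (hAB he)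

/-- `s` is a section over `A` of the coset system of `H`. -/
def IsSection {G : Type*} [Group G] (K : TriComplex X E T) (g : X → X → G) (A : Set X)
    (H : Subgroup G) (s : X → G) : Prop :=
  ∀ e, K.EIn A e → s (K.src e) * g (K.src e) (K.tgt e) * (s (K.tgt e))⁻¹ ∈ H

theorem IsSection.walk {G : Type*} [Group G] {g : X → X → G} {A : Set X} {H : Subgroup G}
    {s : X → G} (hs : K.IsSection g A H s) {x y : X} {k : G} (h : K.IsWalk g A x y k) :
    s x * k * (s y)⁻¹ ∈ H := by
  induction h with
  | refl hx => simp
  | fwd k e h he ih =>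
    have := H.mul_mem ih (hs e ⟨h.mem_right, he⟩)
    convert this using 1
    group
  | bwd k e h he ih =>
    have := H.mul_mem ih (H.inv_mem (hs e ⟨he, h.mem_right⟩))
    convert this using 1
    group

/-- Two sections over a connected set determine a double coset. -/
theorem IsSection.doubleCoset {G : Type*} [Group G] {g : X → X → G} {A : Set X}
    {H H' : Subgroup G} {s r : X → G} (hA : K.Conn A) (hs : K.IsSection g A H s)
    (hr : K.IsSection g A H' r) {x y : X} (hx : x ∈ A) (hy : y ∈ A) :
    ∃ h ∈ H, ∃ h' ∈ H', s y * (r y)⁻¹ = h * (s x * (r x)⁻¹) * h' := by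
  have hstep : ∀ e, K.EIn A e →
      ∃ h ∈ H, ∃ h' ∈ H', s (K.tgt e) * (r (K.tgt e))⁻¹ =
        h * (s (K.src e) * (r (K.src e))⁻¹) * h' := by
    intro e he
    exact ⟨_, H.inv_mem (hs e he), _, hr e he, by group⟩
  have hstep' : ∀ e, K.EIn A e →
      ∃ h ∈ H, ∃ h' ∈ H', s (K.src e) * (r (K.src e))⁻¹ =
        h * (s (K.tgt e) * (r (K.tgt e))⁻¹) * h' := by
    intro e he
    exact ⟨_, hs e he, _, H'.inv_mem (hr e he), by group⟩
  have htr : ∀ a b : G, (∃ h ∈ H, ∃ h' ∈ H', a = h * (s x * (r x)⁻¹) * h') →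
      (∃ h ∈ H, ∃ h' ∈ H', b = h * a * h') → ∃ h ∈ H, ∃ h' ∈ H', b = h * (s x * (r x)⁻¹) * h' := by
    rintro a b ⟨h, hh, h', hh', rfl⟩ ⟨l, hl, l', hl', rfl⟩
    exact ⟨l * h, H.mul_mem hl hh, h' * l', H'.mul_mem hh' hl', by group⟩
  set B : Set X := {y | y ∈ A ∧ ∃ h ∈ H, ∃ h' ∈ H', s y * (r y)⁻¹ = h * (s x * (r x)⁻¹) * h'}
    with hB
  by_cases hBA : B = A
  · exact (hBA.symm ▸ hy : y ∈ B).2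
  · obtain ⟨e, he, hc⟩ := hA B (fun z hz => hz.1)
      ⟨x, hx, 1, H.one_mem, 1, H'.one_mem, by group⟩ hBA
    exfalso
    apply hc
    constructor
    · exact fun h => ⟨he.2, htr _ _ h.2 (hstep e he)⟩
    · exact fun h => ⟨he.1, htr _ _ h.2 (hstep' e he)⟩

end TriComplex

open TriComplex in
/-- A combinatorial model of a drawing: vertex regions `D u` and edge regions `N e` in a closed
triangulated surface, with holonomy labels recording homotopy classes. -/
structure DiscreteDrawing {X E T : Type*} [Fintype X] [Fintype E] [Fintype T]
    (K : TriComplex X E T) (ι : Type*) [Fintype ι] (m : ℕ) (G : Type*) [Group G] where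
  closed : K.Closed
  loopless : ∀ e, K.src e ≠ K.tgt e
  conn_univ : K.Conn Set.univ
  exists_triangle : ∀ x, ∃ t, K.va t = x
  D : ι → Set X
  D_disjoint : ∀ u w, u ≠ w → Disjoint (D u) (D w)
  D_nonadj : ∀ u w, u ≠ w → ¬ K.Adj (D u) (D w)
  D_conn : ∀ u, K.Conn (D u)
  D_nonempty : ∀ u, (D u).Nonempty
  D_dual : ∀ u, K.DualConn (D u)
  dual_singleton : ∀ x : X, K.DualConn {x}
  o : ι
  chi_D : ∀ u, u ≠ o → K.chi (D u) = 1
  euler : 2 - (Fintype.card ι : ℤ) + ∑ u, K.chi (D u) ≤ K.chi Set.univ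
  three_le : 3 ≤ Fintype.card ι
  N : Fin m → Set X
  N_disjoint : ∀ e e', e ≠ e' → Disjoint (N e) (N e')
  N_nonadj : ∀ e e', e ≠ e' → ¬ K.Adj (N e) (N e')
  N_conn : ∀ e, K.Conn (N e)
  N_out : ∀ e, ∀ x ∈ N e, ∀ u, x ∉ D u
  contacts : ∀ e, cnt (fun t => K.TMeets (N e) t ∧ K.TMeets (⋃ u, D u) t ∧
    K.TMeets (N e ∪ ⋃ u, D u)ᶜ t) ≤ 4
  H : ι → Subgroup G
  c : ι → X → G
  g : X → X → G
  flat : ∀ t, (∀ u, K.va t ∉ D u ∧ K.vb t ∉ D u ∧ K.vc t ∉ D u) →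
    g (K.va t) (K.vb t) * g (K.vb t) (K.vc t) = g (K.va t) (K.vc t)
  flat_D : ∀ u t, (K.va t ∈ D u → (∀ w, K.vb t ∉ D w) → (∀ w, K.vc t ∉ D w) →
        c u (K.vb t) * g (K.vb t) (K.vc t) * (c u (K.vc t))⁻¹ ∈ H u) ∧
      (K.vb t ∈ D u → (∀ w, K.va t ∉ D w) → (∀ w, K.vc t ∉ D w) →
        c u (K.va t) * g (K.va t) (K.vc t) * (c u (K.vc t))⁻¹ ∈ H u) ∧
      (K.vc t ∈ D u → (∀ w, K.va t ∉ D w) → (∀ w, K.vb t ∉ D w) →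
        c u (K.va t) * g (K.va t) (K.vb t) * (c u (K.vb t))⁻¹ ∈ H u)
  st : Fin m → ι
  en : Fin m → ι
  p : Fin m → X
  q : Fin m → X
  k : Fin m → G
  p_mem : ∀ e, p e ∈ N e
  p_adj : ∀ e, K.Adj {p e} (D (st e))
  q_adj : ∀ e, K.Adj {q e} (D (en e))
  walk : ∀ e, K.IsWalk g (N e) (p e) (q e) (k e)
  nontrivial : ∀ e, st e = en e →
    c (st e) (p e) * k e * (c (en e) (q e))⁻¹ ∉ H (st e)
  nonhomotopic : ∀ e e', e ≠ e' → st e = st e' → en e = en e' →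
    ∀ h ∈ H (st e), ∀ h' ∈ H (en e), c (st e') (p e') * k e' * (c (en e') (q e'))⁻¹ ≠
      h * (c (st e) (p e) * k e * (c (en e) (q e))⁻¹) * h'
  nonhomotopic' : ∀ e e', e ≠ e' → st e = en e' → en e = st e' →
    ∀ h ∈ H (st e), ∀ h' ∈ H (en e), (c (st e') (p e') * k e' * (c (en e') (q e'))⁻¹)⁻¹ ≠
      h * (c (st e) (p e) * k e * (c (en e) (q e))⁻¹) * h'

namespace DiscreteDrawing

open TriComplex

open scoped Classical

variable {X E T : Type*} [Fintype X] [Fintype E] [Fintype T] {K : TriComplex X E T} {ι : Type*}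
  [Fintype ι] {m : ℕ} {G : Type*} [Group G] (P : DiscreteDrawing K ι m G)

/-- The holonomy of an edge, from its start to its end. -/
def hol (e : Fin m) : G := P.c (P.st e) (P.p e) * P.k e * (P.c (P.en e) (P.q e))⁻¹

theorem q_mem (e : Fin m) : P.q e ∈ P.N e := (P.walk e).mem_right

theorem exists_ne_two (P : DiscreteDrawing K ι m G) (u w : ι) : ∃ v, v ≠ u ∧ v ≠ w := by
  have h := P.three_le
  have : ({u, w} : Finset ι).card < (Finset.univ : Finset ι).card :=
    lt_of_le_of_lt Finset.card_le_two (by rw [Finset.card_univ]; omega)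
  obtain ⟨v, -, hv⟩ := Finset.exists_mem_notMem_of_card_lt_card this
  exact ⟨v, by simpa using hv⟩

theorem exists_triangle_out {A : Set X} {v : ι} (hA : ∀ x ∈ A, x ∉ P.D v) :
    ∃ t, ¬ K.TIn A t := by
  obtain ⟨x, hx⟩ := P.D_nonempty v
  obtain ⟨t, ht⟩ := P.exists_triangle x
  exact ⟨t, fun h => hA _ h.1 (ht ▸ hx)⟩

theorem exists_section {A : Set X} (hAD : ∀ x ∈ A, ∀ u, x ∉ P.D u) (hA : K.Conn A) (u : ι)
    {Ω : Set E} (hΩ : K.ClosedCross A (P.D u) Ω) (hne : Ω.Nonempty)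
    (hexc : K.exc A (P.D u) Ω ≤ K.chi A) :
    ∃ s, K.IsSection P.g A (P.H u) s ∧ ∀ x ∈ A, (∃ e ∈ Ω, K.src e = x ∨ K.tgt e = x) →
      s x * (P.c u x)⁻¹ ∈ P.H u := by
  obtain ⟨v, hv, -⟩ := P.exists_ne_two u u
  obtain ⟨s, h1, h2⟩ := TriComplex.exists_section P.closed
    (Set.disjoint_left.2 fun x hx => hAD x hx u) hA (P.D_dual u)
    (P.exists_triangle_out (v := v) (by
      rintro x (hx | hx)
      · exact hAD x hx v
      · exact Set.disjoint_left.1 (P.D_disjoint u v hv.symm) hx)) hΩ hne (H := P.H u)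
    (c := P.c u) (g := P.g)
    (fun t ht => P.flat t fun w => ⟨hAD _ ht.1 w, hAD _ ht.2.1 w, hAD _ ht.2.2 w⟩)
    (fun t => by
      have := P.flat_D u t
      refine ⟨fun h h' => this.1 h (fun w => ?_) fun w => ?_,
        fun h h' => this.2.1 h (fun w => ?_) fun w => ?_,
        fun h h' => this.2.2 h (fun w => ?_) fun w => ?_⟩
      · exact hAD _ (K.src_d0 t ▸ h'.1) w
      · exact hAD _ (K.tgt_d0 t ▸ h'.2) w
      · exact hAD _ (K.src_d1 t ▸ h'.1) w
      · exact hAD _ (K.tgt_d1 t ▸ h'.2) w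
      · exact hAD _ (K.src_d2 t ▸ h'.1) w
      · exact hAD _ (K.tgt_d2 t ▸ h'.2) w)
    hexc
  refine ⟨s, h1, fun x hx => ?_⟩
  rintro ⟨e, he, rfl | rfl⟩
  · exact (h2 e he).1 hx
  · exact (h2 e he).2 hx

theorem hol_mem_of_section {A : Set X} {H : Subgroup G} {s : X → G}
    (hs : K.IsSection P.g A H s) {e : Fin m} (hNA : P.N e ⊆ A)
    (h1 : s (P.p e) * (P.c (P.st e) (P.p e))⁻¹ ∈ H)
    (h2 : s (P.q e) * (P.c (P.en e) (P.q e))⁻¹ ∈ H) : P.hol e ∈ H := by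
  have := hs.walk ((P.walk e).mono hNA)
  have h3 := H.mul_mem (H.mul_mem (H.inv_mem h1) this) h2
  convert h3 using 1
  rw [hol]
  group

/-- The start and end contacts of `e` are witnessed by the two sections `s` and `r`. -/
def Joins (a b : ι) (s r : X → G) (e : Fin m) : Prop :=
  P.st e = a ∧ P.en e = b ∧ s (P.p e) * (P.c (P.st e) (P.p e))⁻¹ ∈ P.H a ∧
    r (P.q e) * (P.c (P.en e) (P.q e))⁻¹ ∈ P.H b

theorem Joins.hol_eq {A : Set X} (hA : K.Conn A) {a b : ι} {s r : X → G}
    (hs : K.IsSection P.g A (P.H a) s) (hr : K.IsSection P.g A (P.H b) r) {x : X} (hx : x ∈ A)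
    {e : Fin m} (hNA : P.N e ⊆ A) (h : P.Joins a b s r e) :
    ∃ l ∈ P.H a, ∃ l' ∈ P.H b, P.hol e = l * (s x * (r x)⁻¹) * l' := by
  obtain ⟨rfl, rfl, h1, h2⟩ := h
  obtain ⟨l, hl, l', hl', heq⟩ := hs.doubleCoset hA hr hx (hNA (P.q_mem e))
  have hw := hs.walk ((P.walk e).mono hNA)
  refine ⟨_, (P.H _).mul_mem ((P.H _).mul_mem ((P.H _).inv_mem h1) hw) hl, _,
    (P.H _).mul_mem hl' h2, ?_⟩
  have : P.hol e = ((s (P.p e) * (P.c (P.st e) (P.p e))⁻¹)⁻¹ *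
      (s (P.p e) * P.k e * (s (P.q e))⁻¹)) * (s (P.q e) * (r (P.q e))⁻¹) *
      (r (P.q e) * (P.c (P.en e) (P.q e))⁻¹) := by
    rw [hol]; group
  rw [this, heq]
  group

theorem false_of_sections {A : Set X} (hA : K.Conn A) {a b : ι} {s r : X → G}
    (hs : K.IsSection P.g A (P.H a) s) (hr : K.IsSection P.g A (P.H b) r)
    {e e' : Fin m} (hne : e ≠ e') (hNA : P.N e ⊆ A) (hNA' : P.N e' ⊆ A)
    (h : P.Joins a b s r e ∨ P.Joins b a r s e)
    (h' : P.Joins a b s r e' ∨ P.Joins b a r s e') : False := by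
  have hx := hNA (P.q_mem e)
  have key : ∀ (a b : ι) (s r : X → G), K.IsSection P.g A (P.H a) s →
      K.IsSection P.g A (P.H b) r → P.Joins a b s r e →
      (P.Joins a b s r e' ∨ P.Joins b a r s e') → False := by
    intro a b s r hs hr h h'
    obtain ⟨l, hl, l', hl', heq⟩ := h.hol_eq P hA hs hr hx hNA
    obtain ⟨rfl, rfl, -, -⟩ := h
    rcases h' with h' | h'
    · obtain ⟨j, hj, j', hj', heq'⟩ := h'.hol_eq P hA hs hr hx hNA'
      refine P.nonhomotopic e e' hne h'.1.symm h'.2.1.symm _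
        ((P.H _).mul_mem hj ((P.H _).inv_mem hl)) _ ((P.H _).mul_mem ((P.H _).inv_mem hl') hj') ?_
      change P.hol e' = _ * P.hol e * _
      rw [heq, heq']; group
    · obtain ⟨j, hj, j', hj', heq'⟩ := h'.hol_eq P hA hr hs hx hNA'
      refine P.nonhomotopic' e e' hne h'.2.1.symm h'.1.symm _
        ((P.H _).mul_mem ((P.H _).inv_mem hj') ((P.H _).inv_mem hl)) _
        ((P.H _).mul_mem ((P.H _).inv_mem hl') ((P.H _).inv_mem hj)) ?_
      change (P.hol e')⁻¹ = _ * P.hol e * _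
      rw [heq, heq']; group
  rcases h with h | h
  · exact key a b s r hs hr h h'
  · exact key b a r s hr hs h h'.symm

end DiscreteDrawing

namespace TriComplex

open scoped Classical

variable {X E T C : Type*} (K : TriComplex X E T) (col : X → C)

/-- The triangle `t` has a vertex of colour `c`. -/
def Has (c : C) (t : T) : Prop := K.TMeets (col ⁻¹' {c}) t

/-- The three vertices of the triangle `t` have distinct colours. -/
def Tricolored (t : T) : Prop :=
  col (K.va t) ≠ col (K.vb t) ∧ col (K.vb t) ≠ col (K.vc t) ∧ col (K.va t) ≠ col (K.vc t)

/-- The number of tricoloured triangles with colour `c`. -/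
noncomputable def tau [Fintype T] (c : C) : ℤ := cnt fun t => K.Tricolored col t ∧ K.Has col c t

/-- The number of tricoloured triangles with colours `c` and `c'`. -/
noncomputable def tau₂ [Fintype T] (c c' : C) : ℤ :=
  cnt fun t => K.Tricolored col t ∧ K.Has col c t ∧ K.Has col c' t

variable {K col}

theorem cnt_mono {α : Type*} [Fintype α] {p q : α → Prop} (h : ∀ x, p x → q x) :
    cnt p ≤ cnt q := by
  refine Finset.sum_le_sum fun x _ => ?_
  have := h x
  grind

theorem exists_of_cnt_pos {α : Type*} [Fintype α] {p : α → Prop} (h : 0 < cnt p) : ∃ x, p x := by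
  by_contra! h'
  simp [cnt, h'] at h

theorem cnt_pos {α : Type*} [Fintype α] {p : α → Prop} {x : α} (h : p x) : 0 < cnt p := by
  rw [cnt_eq_card]
  exact_mod_cast Finset.card_pos.2 ⟨x, by simpa using h⟩

theorem adj_of_meets {A B : Set X} (hAB : Disjoint A B) {t : T} (hA : K.TMeets A t)
    (hB : K.TMeets B t) : K.Adj A B := by
  have h : ∀ x, x ∈ A → x ∉ B := fun x hx hx' => Set.disjoint_left.1 hAB hx hx'
  by_contra hne
  have h0 : ¬ K.Cross A B (K.d0 t) := fun h => hne ⟨_, h⟩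
  have h1 : ¬ K.Cross A B (K.d1 t) := fun h => hne ⟨_, h⟩
  have h2 : ¬ K.Cross A B (K.d2 t) := fun h => hne ⟨_, h⟩
  have ha := h (K.va t)
  have hb := h (K.vb t)
  have hc := h (K.vc t)
  simp only [TMeets, Cross, K.src_d0, K.src_d1, K.src_d2, K.tgt_d0, K.tgt_d1, K.tgt_d2] at *
  clear hne h hAB
  grind

theorem disjoint_fiber {c c' : C} (h : c ≠ c') : Disjoint (col ⁻¹' {c}) (col ⁻¹' {c'}) :=
  Set.disjoint_left.2 fun _ hx hx' => h (hx.symm.trans hx')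

theorem two_link_fiber [Fintype E] [Fintype T] [Fintype X] (hK : K.Closed) {c c' : C}
    (h : c ≠ c') : 2 * K.link (col ⁻¹' {c}) (col ⁻¹' {c'}) = K.tau₂ col c c' := by
  rw [two_link hK (disjoint_fiber h), tau₂]
  congr 1
  ext t
  simp only [Has, Tricolored, TMeets, Set.mem_preimage, Set.mem_singleton_iff,
    Set.mem_compl_iff, Set.mem_union]
  grind

theorem tau₂_comm [Fintype T] {c c' : C} : K.tau₂ col c c' = K.tau₂ col c' c := by
  simp only [tau₂, and_comm]

theorem two_chi_univ [Fintype E] [Fintype T] [Fintype X] [Fintype C] (hK : K.Closed) :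
    2 * K.chi Set.univ = 2 * ∑ c, K.chi (col ⁻¹' {c}) - cnt (K.Tricolored col) := by
  have h1 := K.sum_sides hK (fun e => if col (K.src e) = col (K.tgt e) then 0 else 1)
  have hX : ∑ c, cnt (fun x => x ∈ col ⁻¹' {c}) = cnt (fun x => x ∈ (Set.univ : Set X)) := by
    simp only [cnt]
    rw [Finset.sum_comm]
    simp
  have hE : ∑ c, cnt (K.EIn (col ⁻¹' {c})) = cnt (fun e => col (K.src e) = col (K.tgt e)) := by
    simp only [cnt]
    rw [Finset.sum_comm]
    refine Finset.sum_congr rfl fun e _ => ?_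
    simp only [EIn, Set.mem_preimage, Set.mem_singleton_iff]
    by_cases h : col (K.src e) = col (K.tgt e) 
    · simp [h]
    · rw [if_neg h]
      refine Finset.sum_eq_zero fun c _ => if_neg ?_
      grind
  have hT : ∑ c, cnt (K.TIn (col ⁻¹' {c})) =
      cnt (fun t => col (K.va t) = col (K.vb t) ∧ col (K.vb t) = col (K.vc t)) := by
    simp only [cnt]
    rw [Finset.sum_comm]
    refine Finset.sum_congr rfl fun t _ => ?_
    simp only [TIn, Set.mem_preimage, Set.mem_singleton_iff]
    by_cases h : col (K.va t) = col (K.vb t) ∧ col (K.vb t) = col (K.vc t)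
    · simp [h]
    · rw [if_neg h]
      refine Finset.sum_eq_zero fun c _ => if_neg ?_
      grind
  simp only [chi, Finset.sum_add_distrib, Finset.sum_sub_distrib, hX, hE, hT]
  have hE' : cnt (K.EIn Set.univ) = cnt (fun e => col (K.src e) = col (K.tgt e)) +
      ∑ e, (if col (K.src e) = col (K.tgt e) then (0 : ℤ) else 1) := by
    simp only [cnt, ← Finset.sum_add_distrib]
    refine Finset.sum_congr rfl fun e _ => ?_
    simp only [EIn, Set.mem_univ]
    grind
  have hT' : ∑ t, ((if col (K.src (K.d0 t)) = col (K.tgt (K.d0 t)) then (0 : ℤ) else 1) +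
      (if col (K.src (K.d1 t)) = col (K.tgt (K.d1 t)) then (0 : ℤ) else 1) +
      (if col (K.src (K.d2 t)) = col (K.tgt (K.d2 t)) then (0 : ℤ) else 1)) =
      2 * cnt (K.TIn Set.univ) - 2 * cnt (fun t => col (K.va t) = col (K.vb t) ∧
        col (K.vb t) = col (K.vc t)) + cnt (K.Tricolored col) := by
    simp only [cnt, ← Finset.sum_add_distrib, Finset.mul_sum, ← Finset.sum_sub_distrib]
    refine Finset.sum_congr rfl fun t _ => ?_
    simp only [TIn, Set.mem_univ, Tricolored,
      K.src_d0, K.src_d1, K.src_d2, K.tgt_d0, K.tgt_d1, K.tgt_d2]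
    clear h1 hX hE hT hE'
    grind
  linarith

theorem conn_quot {R : Set X} (φ : Quot fun x y => x ∈ R ∧ y ∈ R ∧ K.Adj {x} {y}) :
    K.Conn {x | x ∈ R ∧ Quot.mk _ x = φ} := by
  intro B hB hne hBne
  by_contra! hcut
  obtain ⟨b, hb⟩ := hne
  apply hBne
  refine subset_antisymm hB ?_
  rintro x ⟨hxR, hx⟩
  have hinv : ∀ a c, (a ∈ R ∧ c ∈ R ∧ K.Adj {a} {c}) → (a ∈ B) = (c ∈ B) := by
    rintro a c ⟨ha, hc, e, he⟩
    by_cases haφ : Quot.mk (fun x y => x ∈ R ∧ y ∈ R ∧ K.Adj {x} {y}) a = φ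
    · have hcφ : Quot.mk (fun x y => x ∈ R ∧ y ∈ R ∧ K.Adj {x} {y}) c = φ :=
        (Quot.sound ⟨ha, hc, e, he⟩).symm.trans haφ
      have := hcut e
      simp only [Cross, Set.mem_singleton_iff] at he
      rcases he with ⟨h1, h2⟩ | ⟨h1, h2⟩
      · have h := this ⟨by rw [h1]; exact ⟨ha, haφ⟩, by rw [h2]; exact ⟨hc, hcφ⟩⟩
        rw [Cut, not_not, h1, h2] at h
        exact propext h
      · have h := this ⟨by rw [h1]; exact ⟨hc, hcφ⟩, by rw [h2]; exact ⟨ha, haφ⟩⟩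
        rw [Cut, not_not, h1, h2] at h
        exact propext h.symm
    · have hcφ : Quot.mk (fun x y => x ∈ R ∧ y ∈ R ∧ K.Adj {x} {y}) c ≠ φ :=
        fun h => haφ ((Quot.sound ⟨ha, hc, e, he⟩).trans h)
      exact propext ⟨fun h => absurd (hB h).2 haφ, fun h => absurd (hB h).2 hcφ⟩
  have h1 := congrArg (Quot.lift (· ∈ B) hinv) (hx.trans (hB hb).2.symm)
  exact h1.mpr hb

theorem exists_kinds {U V W : Type*} {a b c : U ⊕ (V ⊕ W)} (h : a ≠ b ∧ b ≠ c ∧ a ≠ c)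
    (hU : ∀ u w, a = .inl u ∨ b = .inl u ∨ c = .inl u → a = .inl w ∨ b = .inl w ∨ c = .inl w →
      u = w)
    (hV : ∀ u w, a = .inr (.inl u) ∨ b = .inr (.inl u) ∨ c = .inr (.inl u) →
      a = .inr (.inl w) ∨ b = .inr (.inl w) ∨ c = .inr (.inl w) → u = w)
    (hW : ∀ u w, a = .inr (.inr u) ∨ b = .inr (.inr u) ∨ c = .inr (.inr u) →
      a = .inr (.inr w) ∨ b = .inr (.inr w) ∨ c = .inr (.inr w) → u = w) :
    ∃ u v w, ∀ x, (a = x ∨ b = x ∨ c = x) ↔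
      x = .inl u ∨ x = .inr (.inl v) ∨ x = .inr (.inr w) := by
  rcases a with a | a | a <;> rcases b with b | b | b <;> rcases c with c | c | c <;>
    first
    | exact ⟨a, b, c, fun x => by grind⟩
    | exact ⟨a, c, b, fun x => by grind⟩
    | exact ⟨b, a, c, fun x => by grind⟩
    | exact ⟨b, c, a, fun x => by grind⟩
    | exact ⟨c, a, b, fun x => by grind⟩
    | exact ⟨c, b, a, fun x => by grind⟩
    | exact absurd (congrArg _ (hU a b (by simp) (by simp))) h.1
    | exact absurd (congrArg _ (hU b c (by simp) (by simp))) h.2.1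
    | exact absurd (congrArg _ (hU a c (by simp) (by simp))) h.2.2
    | exact absurd (congrArg (fun x => Sum.inr (Sum.inl x)) (hV a b (by simp) (by simp))) h.1
    | exact absurd (congrArg (fun x => Sum.inr (Sum.inl x)) (hV b c (by simp) (by simp))) h.2.1
    | exact absurd (congrArg (fun x => Sum.inr (Sum.inl x)) (hV a c (by simp) (by simp))) h.2.2
    | exact absurd (congrArg (fun x => Sum.inr (Sum.inr x)) (hW a b (by simp) (by simp))) h.1
    | exact absurd (congrArg (fun x => Sum.inr (Sum.inr x)) (hW b c (by simp) (by simp))) h.2.1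
    | exact absurd (congrArg (fun x => Sum.inr (Sum.inr x)) (hW a c (by simp) (by simp))) h.2.2

end TriComplex

namespace DiscreteDrawing

open TriComplex

open scoped Classical

universe uX

variable {X : Type uX} {E T : Type*} [Fintype X] [Fintype E] [Fintype T] {K : TriComplex X E T} {ι : Type*}
  [Fintype ι] {m : ℕ} {G : Type*} [Group G] (P : DiscreteDrawing K ι m G)

/-- A colouring of the lattice by vertex, edge and face colours, compatible with the drawing. -/
structure Valid {Φ : Type*} (col : X → ι ⊕ (Fin m ⊕ Φ)) : Prop where
  vertex : ∀ u, col ⁻¹' {.inl u} = P.D u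
  edge : ∀ e, P.N e ⊆ col ⁻¹' {.inr (.inl e)}
  conn : ∀ c, K.Conn (col ⁻¹' {c})
  tri : ∀ t, K.Tricolored col t → ∃ u e φ, ∀ c, K.Has col c t ↔
    c = .inl u ∨ c = .inr (.inl e) ∨ c = .inr (.inr φ)
  face : ∀ φ ψ, φ ≠ ψ → ¬ K.Adj (col ⁻¹' {.inr (.inr φ)}) (col ⁻¹' {.inr (.inr ψ)})
  four : ∀ e, K.tau col (.inr (.inl e)) ≤ 4

theorem exists_valid : ∃ (Φ : Type uX) (_ : Fintype Φ) (col : X → ι ⊕ (Fin m ⊕ Φ)),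
    P.Valid col := by
  set R : Set X := ((⋃ u, P.D u) ∪ ⋃ e, P.N e)ᶜ with hR
  refine ⟨Quot fun x y : X => x ∈ R ∧ y ∈ R ∧ K.Adj {x} {y}, Fintype.ofFinite _, fun x =>
    if h : ∃ u, x ∈ P.D u then .inl h.choose else
      if h : ∃ e, x ∈ P.N e then .inr (.inl h.choose) else .inr (.inr (Quot.mk _ x)), ?_⟩
  set col : X → ι ⊕ (Fin m ⊕ Quot fun x y => x ∈ R ∧ y ∈ R ∧ K.Adj {x} {y}) := fun x =>
    if h : ∃ u, x ∈ P.D u then .inl h.choose else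
      if h : ∃ e, x ∈ P.N e then .inr (.inl h.choose) else .inr (.inr (Quot.mk _ x)) with hcol
  have hDu : ∀ x u w, x ∈ P.D u → x ∈ P.D w → u = w := fun x u w hu hw => by
    by_contra hne
    exact Set.disjoint_left.1 (P.D_disjoint u w hne) hu hw
  have hNu : ∀ x e e', x ∈ P.N e → x ∈ P.N e' → e = e' := fun x u w hu hw => by
    by_contra hne
    exact Set.disjoint_left.1 (P.N_disjoint u w hne) hu hw
  have hcD : ∀ x u, x ∈ P.D u → col x = .inl u := by
    intro x u hx
    have h : ∃ u, x ∈ P.D u := ⟨u, hx⟩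
    simp only [hcol, dif_pos h]
    exact congrArg _ (hDu x _ _ h.choose_spec hx)
  have hcN : ∀ x e, x ∈ P.N e → col x = .inr (.inl e) := by
    intro x e hx
    have h : ¬ ∃ u, x ∈ P.D u := fun ⟨u, hu⟩ => P.N_out e x hx u hu
    have h' : ∃ e, x ∈ P.N e := ⟨e, hx⟩
    simp only [hcol, dif_neg h, dif_pos h']
    exact congrArg _ (congrArg _ (hNu x _ _ h'.choose_spec hx))
  have hcR : ∀ x, x ∈ R → col x = .inr (.inr (Quot.mk _ x)) := by
    intro x hx
    have h : ¬ ∃ u, x ∈ P.D u := fun ⟨u, hu⟩ => hx (.inl (Set.mem_iUnion.2 ⟨u, hu⟩))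
    have h' : ¬ ∃ e, x ∈ P.N e := fun ⟨u, hu⟩ => hx (.inr (Set.mem_iUnion.2 ⟨u, hu⟩))
    simp only [hcol, dif_neg h, dif_neg h']
  have hcases : ∀ x, (∃ u, x ∈ P.D u ∧ col x = .inl u) ∨
      (∃ e, x ∈ P.N e ∧ col x = .inr (.inl e)) ∨
      (x ∈ R ∧ col x = .inr (.inr (Quot.mk _ x))) := by
    intro x
    by_cases h : ∃ u, x ∈ P.D u
    · obtain ⟨u, hu⟩ := h
      exact .inl ⟨u, hu, hcD x u hu⟩
    by_cases h' : ∃ e, x ∈ P.N e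
    · obtain ⟨u, hu⟩ := h'
      exact .inr (.inl ⟨u, hu, hcN x u hu⟩)
    have hx : x ∈ R := by
      rintro (h1 | h1)
      · exact h (Set.mem_iUnion.1 h1)
      · exact h' (Set.mem_iUnion.1 h1)
    exact .inr (.inr ⟨hx, hcR x hx⟩)
  have hvD : ∀ u, col ⁻¹' {.inl u} = P.D u := by
    intro u
    ext x
    refine ⟨fun hx => ?_, fun hx => hcD x u hx⟩
    rw [Set.mem_preimage, Set.mem_singleton_iff] at hx
    rcases hcases x with ⟨w, hw, h⟩ | ⟨w, hw, h⟩ | ⟨hw, h⟩ <;> rw [h] at hx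
    · exact Sum.inl_injective hx ▸ hw
    all_goals simp at hx
  have hvN : ∀ e, col ⁻¹' {.inr (.inl e)} = P.N e := by
    intro u
    ext x
    refine ⟨fun hx => ?_, fun hx => hcN x u hx⟩
    rw [Set.mem_preimage, Set.mem_singleton_iff] at hx
    rcases hcases x with ⟨w, hw, h⟩ | ⟨w, hw, h⟩ | ⟨hw, h⟩ <;> rw [h] at hx
    · simp at hx
    · exact Sum.inl_injective (Sum.inr_injective hx) ▸ hw
    · simp at hx
  have hvR : ∀ φ, col ⁻¹' {.inr (.inr φ)} = {x | x ∈ R ∧ Quot.mk _ x = φ} := by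
    intro φ
    ext x
    rw [Set.mem_preimage, Set.mem_singleton_iff, Set.mem_ofPred_eq]
    refine ⟨fun hx => ?_, fun hx => (hcR x hx.1).trans (by rw [hx.2])⟩
    rcases hcases x with ⟨w, hw, h⟩ | ⟨w, hw, h⟩ | ⟨hw, h⟩ <;> rw [h] at hx
    · simp at hx
    · simp at hx
    · exact ⟨hw, Sum.inr_injective (Sum.inr_injective hx)⟩
  have hface : ∀ φ ψ, φ ≠ ψ →
      ¬ K.Adj (col ⁻¹' {.inr (.inr φ)}) (col ⁻¹' {.inr (.inr ψ)}) := by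
    rintro φ ψ hne ⟨e, he⟩
    rw [hvR, hvR] at he
    rcases he with ⟨⟨h1, rfl⟩, ⟨h2, rfl⟩⟩ | ⟨⟨h1, rfl⟩, ⟨h2, rfl⟩⟩
    · exact hne (Quot.sound ⟨h1, h2, e, .inl ⟨rfl, rfl⟩⟩)
    · exact hne (Quot.sound ⟨h2, h1, e, .inr ⟨rfl, rfl⟩⟩)
  have hsame : ∀ t, K.Tricolored col t → ∃ u e φ, ∀ c, K.Has col c t ↔
      c = .inl u ∨ c = .inr (.inl e) ∨ c = .inr (.inr φ) := by
    intro t ht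
    have hD : ∀ u w, K.Has col (.inl u) t → K.Has col (.inl w) t → u = w := by
      intro u w hu hw
      by_contra hne
      have := adj_of_meets (disjoint_fiber (fun h => hne (Sum.inl_injective h))) hu hw
      rw [hvD, hvD] at this
      exact P.D_nonadj u w hne this
    have hN : ∀ u w, K.Has col (.inr (.inl u)) t → K.Has col (.inr (.inl w)) t → u = w := by
      intro u w hu hw
      by_contra hne
      have := adj_of_meets (disjoint_fiber
        (fun h => hne (Sum.inl_injective (Sum.inr_injective h)))) hu hw
      rw [hvN, hvN] at this
      exact P.N_nonadj u w hne this
    have hF : ∀ u w, K.Has col (.inr (.inr u)) t → K.Has col (.inr (.inr w)) t → u = w := by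
      intro u w hu hw
      by_contra hne
      exact hface u w hne (adj_of_meets (disjoint_fiber
        (fun h => hne (Sum.inr_injective (Sum.inr_injective h)))) hu hw)
    simp only [Has, TMeets, Set.mem_preimage, Set.mem_singleton_iff, Tricolored] at *
    exact exists_kinds ht hD hN hF
  refine ⟨hvD, fun e => (hvN e).ge, ?_, hsame, hface, ?_⟩
  · rintro (u | e | φ)
    · rw [hvD]; exact P.D_conn u
    · rw [hvN]; exact P.N_conn e
    · rw [hvR]; exact conn_quot φ
  · intro e
    refine le_trans (cnt_mono ?_) (P.contacts e)
    rintro t ⟨ht, he⟩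
    obtain ⟨u, e', φ, h⟩ := hsame t ht
    have h1 := (h (.inl u)).2 (.inl rfl)
    have h2 := (h (.inr (.inr φ))).2 (.inr (.inr rfl))
    rw [Has, hvD] at h1
    rw [Has, hvN] at he
    rw [Has, hvR] at h2
    refine ⟨he, ?_, ?_⟩
    · have : P.D u ⊆ ⋃ u, P.D u := Set.subset_iUnion _ u
      exact h1.imp (@this _) (Or.imp (@this _) (@this _))
    · have : {x | x ∈ R ∧ Quot.mk (fun x y => x ∈ R ∧ y ∈ R ∧ K.Adj {x} {y}) x = φ} ⊆
          (P.N e ∪ ⋃ u, P.D u)ᶜ := by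
        rintro x ⟨hx, -⟩ (hx' | hx')
        · exact hx (.inr (Set.mem_iUnion.2 ⟨e, hx'⟩))
        · exact hx (.inl hx')
      exact h2.imp (@this _) (Or.imp (@this _) (@this _))

variable {P}

theorem Valid.exists_nonabsorbing {Φ : Type*} {col₀ : X → ι ⊕ (Fin m ⊕ Φ)} (h₀ : P.Valid col₀) :
    ∃ col : X → ι ⊕ (Fin m ⊕ Φ), P.Valid col ∧
      ∀ φ e, K.Adj (col ⁻¹' {.inr (.inr φ)}) (col ⁻¹' {.inr (.inl e)}) →
        ∃ t, K.Tricolored col t ∧ K.Has col (.inr (.inr φ)) t ∧ ¬ K.Has col (.inr (.inl e)) t := by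
  induction hN : (Finset.univ.filter fun x => ∃ φ, col₀ x = .inr (.inr φ)).card using
    Nat.strong_induction_on generalizing col₀ with
  | _ N ih =>
  by_cases hgood : ∀ φ e, K.Adj (col₀ ⁻¹' {.inr (.inr φ)}) (col₀ ⁻¹' {.inr (.inl e)}) →
        ∃ t, K.Tricolored col₀ t ∧ K.Has col₀ (.inr (.inr φ)) t ∧ ¬ K.Has col₀ (.inr (.inl e)) t
  · exact ⟨col₀, h₀, hgood⟩
  push Not at hgood
  obtain ⟨φ, e, hadj, habs⟩ := hgood
  set col : X → ι ⊕ (Fin m ⊕ Φ) :=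
    fun x => if col₀ x = .inr (.inr φ) then .inr (.inl e) else col₀ x with hcol
  have hfib : ∀ c, c ≠ .inr (.inr φ) → c ≠ .inr (.inl e) → col ⁻¹' {c} = col₀ ⁻¹' {c} := by
    intro c h1 h2
    ext x
    simp only [hcol, Set.mem_preimage, Set.mem_singleton_iff]
    grind
  have hfibe : col ⁻¹' {.inr (.inl e)} =
      col₀ ⁻¹' {.inr (.inr φ)} ∪ col₀ ⁻¹' {.inr (.inl e)} := by
    ext x
    simp only [hcol, Set.mem_preimage, Set.mem_singleton_iff, Set.mem_union]
    grind
  have hfibφ : col ⁻¹' {.inr (.inr φ)} = ∅ := by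
    ext x
    simp only [hcol, Set.mem_preimage, Set.mem_singleton_iff, Set.mem_empty_iff_false, iff_false]
    grind
  have htri : ∀ t, K.Tricolored col t → K.Tricolored col₀ t ∧ ∀ c, K.Has col c t ↔ K.Has col₀ c t := by
    intro t ht
    have h1 : K.Tricolored col₀ t := by
      simp only [Tricolored, hcol] at ht ⊢
      grind
    have h2 := habs t h1
    refine ⟨h1, fun c => ?_⟩
    simp only [Tricolored, hcol, Has, TMeets, Set.mem_preimage, Set.mem_singleton_iff] at *
    clear hfib hfibe hfibφ habs hadj ih hcol
    grind
  have hcount : (Finset.univ.filter fun x => ∃ φ, col x = .inr (.inr φ)).card < N := by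
    rw [← hN]
    apply Finset.card_lt_card
    rw [Finset.ssubset_iff_subset_ne]
    constructor
    · intro x
      simp only [Finset.mem_filter, Finset.mem_univ, true_and, hcol]
      grind
    · obtain ⟨d, hd⟩ := hadj
      have : ∃ x, col₀ x = .inr (.inr φ) := by
        rcases hd with hd | hd
        exacts [⟨_, hd.1⟩, ⟨_, hd.2⟩]
      obtain ⟨x, hx⟩ := this
      intro heq
      have h1 : x ∈ Finset.univ.filter fun x => ∃ φ, col₀ x = .inr (.inr φ) := by
        simp [hx]
      rw [← heq] at h1
      simp [hcol, hx] at h1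
  refine ih _ hcount ⟨fun u => ?_, fun e' => ?_, fun c => ?_, fun t ht => ?_, fun ψ ψ' hne => ?_,
    fun e' => ?_⟩ rfl
  · rw [hfib _ (by simp) (by simp), h₀.vertex]
  · by_cases he : e' = e
    · subst he
      rw [hfibe]
      exact (h₀.edge e').trans Set.subset_union_right
    · rw [hfib _ (by simp) (by simpa using he)]
      exact h₀.edge e'
  · by_cases h1 : c = .inr (.inr φ)
    · rw [h1, hfibφ]
      intro B hB hne
      exact absurd (Set.subset_empty_iff.1 hB) hne.ne_empty
    by_cases h2 : c = .inr (.inl e)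
    · rw [h2, hfibe]
      exact (h₀.conn _).union (h₀.conn _) hadj
    · rw [hfib _ h1 h2]
      exact h₀.conn c
  · obtain ⟨u, e', ψ, h⟩ := h₀.tri t (htri t ht).1
    exact ⟨u, e', ψ, fun c => ((htri t ht).2 c).trans (h c)⟩
  · have hsub : ∀ ψ, col ⁻¹' {.inr (.inr ψ)} ⊆ col₀ ⁻¹' {.inr (.inr ψ)} := by
      intro ψ x
      simp only [hcol, Set.mem_preimage, Set.mem_singleton_iff]
      grind
    rintro ⟨d, hd⟩
    exact h₀.face ψ ψ' hne ⟨d, hd.imp (And.imp (@hsub _ _) (@hsub _ _))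
      (And.imp (@hsub _ _) (@hsub _ _))⟩
  · refine le_trans (cnt_mono ?_) (h₀.four e')
    exact fun t ht => ⟨(htri t ht.1).1, ((htri t ht.1).2 _).1 ht.2⟩

end DiscreteDrawing

namespace DiscreteDrawing

open TriComplex

open scoped Classical

variable {X E T : Type*} [Fintype X] [Fintype E] [Fintype T] {K : TriComplex X E T} {ι : Type*}
  [Fintype ι] {m : ℕ} {G : Type*} [Group G] {P : DiscreteDrawing K ι m G} {Φ : Type*}
  {col : X → ι ⊕ (Fin m ⊕ Φ)}

theorem sum_cnt_eq {α β : Type*} [Fintype α] [Fintype β] {p : β → Prop} {q : α → β → Prop}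
    (h : ∀ t, p t → ∃ a, ∀ b, q b t ↔ b = a) :
    ∑ a, cnt (fun t => p t ∧ q a t) = cnt p := by
  simp only [cnt]
  rw [Finset.sum_comm]
  refine Finset.sum_congr rfl fun t _ => ?_
  by_cases hp : p t
  · obtain ⟨a, ha⟩ := h t hp
    simp [hp, ha]
  · simp [hp]

namespace Valid

theorem sum_vertex (hc : P.Valid col) (Q : T → Prop) :
    ∑ u, cnt (fun t => (K.Tricolored col t ∧ Q t) ∧ K.Has col (.inl u) t) =
      cnt (fun t => K.Tricolored col t ∧ Q t) := by
  refine sum_cnt_eq (q := fun u t => K.Has col (.inl u) t) fun t ht => ?_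
  obtain ⟨u, e, φ, h⟩ := hc.tri t ht.1
  exact ⟨u, fun b => by simp [h]⟩

theorem sum_edge (hc : P.Valid col) (Q : T → Prop) :
    ∑ e, cnt (fun t => (K.Tricolored col t ∧ Q t) ∧ K.Has col (.inr (.inl e)) t) =
      cnt (fun t => K.Tricolored col t ∧ Q t) := by
  refine sum_cnt_eq (q := fun u t => K.Has col (.inr (.inl u)) t) fun t ht => ?_
  obtain ⟨u, e, φ, h⟩ := hc.tri t ht.1
  exact ⟨e, fun b => by simp [h]⟩

theorem sum_face (hc : P.Valid col) [Fintype Φ] (Q : T → Prop) :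
    ∑ φ, cnt (fun t => (K.Tricolored col t ∧ Q t) ∧ K.Has col (.inr (.inr φ)) t) =
      cnt (fun t => K.Tricolored col t ∧ Q t) := by
  refine sum_cnt_eq (q := fun u t => K.Has col (.inr (.inr u)) t) fun t ht => ?_
  obtain ⟨u, e, φ, h⟩ := hc.tri t ht.1
  exact ⟨φ, fun b => by simp [h]⟩

theorem sum_tau₂_vertex (hc : P.Valid col) (c : ι ⊕ (Fin m ⊕ Φ)) :
    ∑ u, K.tau₂ col c (.inl u) = K.tau col c := by
  rw [tau, ← hc.sum_vertex]
  simp only [tau₂, and_assoc]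

theorem sum_tau₂_edge (hc : P.Valid col) (c : ι ⊕ (Fin m ⊕ Φ)) :
    ∑ e, K.tau₂ col c (.inr (.inl e)) = K.tau col c := by
  rw [tau, ← hc.sum_edge]
  simp only [tau₂, and_assoc]

theorem sum_tau₂_face (hc : P.Valid col) [Fintype Φ] (c : ι ⊕ (Fin m ⊕ Φ)) :
    ∑ φ, K.tau₂ col c (.inr (.inr φ)) = K.tau col c := by
  rw [tau, ← hc.sum_face]
  simp only [tau₂, and_assoc]

theorem sum_tau_edge (hc : P.Valid col) : ∑ e, K.tau col (.inr (.inl e)) = cnt (K.Tricolored col) := by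
  have := hc.sum_edge (fun _ => True)
  simp only [and_true] at this
  exact this

theorem sum_tau_face (hc : P.Valid col) [Fintype Φ] :
    ∑ φ, K.tau col (.inr (.inr φ)) = cnt (K.Tricolored col) := by
  have := hc.sum_face (fun _ => True)
  simp only [and_true] at this
  exact this

theorem not_mem_D (hc : P.Valid col) {c : Fin m ⊕ Φ} {x : X} (hx : col x = .inr c) (u : ι) : x ∉ P.D u := by
  rw [← hc.vertex]
  intro h
  rw [Set.mem_preimage, hx] at h
  simp at h

theorem not_mem_D' (hc : P.Valid col) (c : Fin m ⊕ Φ) : ∀ x ∈ col ⁻¹' {.inr c}, ∀ u, x ∉ P.D u :=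
  fun _ hx => hc.not_mem_D hx

theorem link_le_of_sum {A : Set X} {k : ℤ}
    (h : ∑ u, 2 * K.link A (P.D u) = k) (hA : ∀ x ∈ A, ∀ u, x ∉ P.D u) (u : ι) :
    2 * K.link A (P.D u) ≤ k := by
  rw [← h]
  refine Finset.single_le_sum (f := fun u => 2 * K.link A (P.D u)) (fun w _ => ?_)
    (Finset.mem_univ u)
  rw [two_link P.closed (Set.disjoint_left.2 fun x hx => hA x hx w)]
  exact cnt_nonneg _

theorem link_add_le_of_sum {A : Set X} {k : ℤ}
    (h : ∑ u, 2 * K.link A (P.D u) = k) (hA : ∀ x ∈ A, ∀ u, x ∉ P.D u) {u w : ι} (huw : u ≠ w) :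
    2 * K.link A (P.D u) + 2 * K.link A (P.D w) ≤ k := by
  rw [← h, ← Finset.sum_pair (f := fun u => 2 * K.link A (P.D u)) huw]
  refine Finset.sum_le_univ_sum_of_nonneg fun w => ?_
  rw [two_link P.closed (Set.disjoint_left.2 fun x hx => hA x hx w)]
  exact cnt_nonneg _

theorem sum_link (hc : P.Valid col) (c : Fin m ⊕ Φ) :
    ∑ u, 2 * K.link (col ⁻¹' {.inr c}) (P.D u) = K.tau col (.inr c) := by
  rw [← hc.sum_tau₂_vertex]
  refine Finset.sum_congr rfl fun u _ => ?_
  rw [← two_link_fiber P.closed (by simp), hc.vertex]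

theorem adj_start (hc : P.Valid col) (e : Fin m) {A : Set X} (hA : P.N e ⊆ A) : K.Adj A (P.D (P.st e)) := by
  obtain ⟨d, hd⟩ := P.p_adj e
  have h1 := hA (P.p_mem e)
  simp only [Cross, Set.mem_singleton_iff] at hd
  rcases hd with ⟨hd, h2⟩ | ⟨h2, hd⟩
  · exact ⟨d, .inl ⟨hd ▸ h1, h2⟩⟩
  · exact ⟨d, .inr ⟨h2, hd ▸ h1⟩⟩

theorem adj_end (hc : P.Valid col) (e : Fin m) {A : Set X} (hA : P.N e ⊆ A) : K.Adj A (P.D (P.en e)) := by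
  obtain ⟨d, hd⟩ := P.q_adj e
  have h1 := hA (P.q_mem e)
  simp only [Cross, Set.mem_singleton_iff] at hd
  rcases hd with ⟨hd, h2⟩ | ⟨h2, hd⟩
  · exact ⟨d, .inl ⟨hd ▸ h1, h2⟩⟩
  · exact ⟨d, .inr ⟨h2, hd ▸ h1⟩⟩

end Valid

/-- A region adjacent to a vertex region through as few links as possible carries a section. -/
theorem exists_full_section {A : Set X} (hAD : ∀ x ∈ A, ∀ u, x ∉ P.D u) (hA : K.Conn A) (u : ι)
    (hadj : K.Adj A (P.D u)) (hl : K.link A (P.D u) ≤ K.chi A) :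
    ∃ s, K.IsSection P.g A (P.H u) s ∧
      (∀ e, P.N e ⊆ A → P.st e = u → s (P.p e) * (P.c (P.st e) (P.p e))⁻¹ ∈ P.H u) ∧
      (∀ e, P.N e ⊆ A → P.en e = u → s (P.q e) * (P.c (P.en e) (P.q e))⁻¹ ∈ P.H u) := by
  obtain ⟨s, hs, hs'⟩ := P.exists_section hAD hA u (closedCross_cross A (P.D u))
    hadj (by rw [exc_cross]; exact hl)
  refine ⟨s, hs, ?_, ?_⟩
  · rintro e he rfl
    have h1 := he (P.p_mem e)
    refine hs' _ h1 ?_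
    obtain ⟨d, hd⟩ := P.p_adj e
    simp only [Cross, Set.mem_singleton_iff] at hd
    rcases hd with ⟨hd, h2⟩ | ⟨h2, hd⟩
    · exact ⟨d, .inl ⟨hd ▸ h1, h2⟩, .inl hd⟩
    · exact ⟨d, .inr ⟨h2, hd ▸ h1⟩, .inr hd⟩
  · rintro e he rfl
    have h1 := he (P.q_mem e)
    refine hs' _ h1 ?_
    obtain ⟨d, hd⟩ := P.q_adj e
    simp only [Cross, Set.mem_singleton_iff] at hd
    rcases hd with ⟨hd, h2⟩ | ⟨h2, hd⟩
    · exact ⟨d, .inl ⟨hd ▸ h1, h2⟩, .inl hd⟩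
    · exact ⟨d, .inr ⟨h2, hd ▸ h1⟩, .inr hd⟩

theorem not_mem_H_of_loop {e : Fin m} {u : ι} (h1 : P.st e = u) (h2 : P.en e = u)
    (h : P.hol e ∈ P.H u) : False := by
  subst h1
  exact P.nontrivial e h2.symm h

theorem chi_le_link_D {A : Set X} (hAD : ∀ x ∈ A, ∀ u, x ∉ P.D u) (hA : K.Conn A) (u : ι)
    (hadj : K.Adj A (P.D u)) : K.chi A ≤ K.link A (P.D u) := by
  obtain ⟨v, hv, -⟩ := P.exists_ne_two u u
  refine chi_le_link P.closed (Set.disjoint_left.2 fun x hx => hAD x hx u) hA (P.D_dual u) ?_ hadj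
  refine P.exists_triangle_out (v := v) ?_
  rintro x (hx | hx)
  · exact hAD x hx v
  · exact Set.disjoint_left.1 (P.D_disjoint u v hv.symm) hx

/-- A loop region is linked to its vertex more than its Euler characteristic. -/
theorem chi_lt_link_of_loop {A : Set X} (hAD : ∀ x ∈ A, ∀ u, x ∉ P.D u) (hA : K.Conn A)
    {e : Fin m} (he : P.N e ⊆ A) {u : ι} (h1 : P.st e = u) (h2 : P.en e = u)
    (hadj : K.Adj A (P.D u)) : K.chi A < K.link A (P.D u) := by
  by_contra! hle
  obtain ⟨s, hs, hp, hq⟩ := exists_full_section hAD hA u hadj hle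
  exact not_mem_H_of_loop h1 h2 (P.hol_mem_of_section hs he (hp e he h1) (hq e he h2))

theorem chi_lt_link_add {A : Set X} (hAD : ∀ x ∈ A, ∀ u, x ∉ P.D u) (hA : K.Conn A)
    {a b : ι} (hab : a ≠ b) (hao : a ≠ P.o) (ha : K.Adj A (P.D a)) (hb : K.Adj A (P.D b)) :
    K.chi A < K.link A (P.D a) + K.link A (P.D b) := by
  have dAa : Disjoint A (P.D a) := Set.disjoint_left.2 fun x hx => hAD x hx a
  have dAb : Disjoint A (P.D b) := Set.disjoint_left.2 fun x hx => hAD x hx b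
  have dab := P.D_disjoint a b hab
  obtain ⟨v, hva, hvb⟩ := P.exists_ne_two a b
  have h1 := chi_le_link P.closed (dAb.union_left dab) (hA.union (P.D_conn a) ha) (P.D_dual b)
    (P.exists_triangle_out (v := v) (by
      rintro x ((hx | hx) | hx)
      · exact hAD x hx v
      · exact Set.disjoint_left.1 (P.D_disjoint a v hva.symm) hx
      · exact Set.disjoint_left.1 (P.D_disjoint b v hvb.symm) hx))
    (by
      obtain ⟨d, hd⟩ := hb
      exact ⟨d, hd.imp (And.imp_left .inl) (And.imp_right .inl)⟩)
  rw [link_union_left P.closed dAa dAb dab, chi_union dAa, P.chi_D a hao,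
    link_eq_zero (P.D_nonadj a b hab)] at h1
  have := cnt_nonneg fun t => K.TMeets A t ∧ K.TMeets (P.D a) t ∧ K.TMeets (P.D b) t
  omega

namespace Valid

theorem two_chi_edge_le (hc : P.Valid col) (e : Fin m) :
    2 * K.chi (col ⁻¹' {.inr (.inl e)}) + 2 ≤ K.tau col (.inr (.inl e)) := by
  have hAD := hc.not_mem_D' (.inl e)
  have hA := hc.conn (.inr (.inl e))
  have hs := hc.adj_start e (hc.edge e)
  have ht := hc.adj_end e (hc.edge e)
  have hsum := hc.sum_link (.inl e)
  by_cases hl : P.st e = P.en e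
  · have h1 := chi_lt_link_of_loop hAD hA (hc.edge e) rfl hl.symm hs
    have h2 := link_le_of_sum hsum hAD (P.st e)
    omega
  · have h2 := link_add_le_of_sum hsum hAD hl
    by_cases ho : P.st e = P.o
    · have h1 := chi_lt_link_add hAD hA (Ne.symm hl) (fun h => hl (ho.trans h.symm)) ht hs
      omega
    · have h1 := chi_lt_link_add hAD hA hl ho hs ht
      omega

theorem chi_le_one (hc : P.Valid col) {c : Fin m ⊕ Φ} (hne : (col ⁻¹' {.inr c}).Nonempty) :
    K.chi (col ⁻¹' {.inr c}) ≤ 1 := by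
  obtain ⟨x, hx⟩ := hne
  exact TriComplex.chi_le_one P.closed (hc.conn _) hx P.loopless (P.dual_singleton x)
    (P.exists_triangle_out (v := P.o) fun x hx => hc.not_mem_D hx _)

theorem chi_edge_le_one (hc : P.Valid col) (e : Fin m) : K.chi (col ⁻¹' {.inr (.inl e)}) ≤ 1 :=
  hc.chi_le_one ⟨_, hc.edge e (P.p_mem e)⟩

theorem exists_face_edge (hc : P.Valid col) {φ : Φ} (hne : (col ⁻¹' {.inr (.inr φ)}).Nonempty)
    (hchi : 1 ≤ K.chi (col ⁻¹' {.inr (.inr φ)}))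
    (hna : ∀ φ e, K.Adj (col ⁻¹' {.inr (.inr φ)}) (col ⁻¹' {.inr (.inl e)}) →
        ∃ t, K.Tricolored col t ∧ K.Has col (.inr (.inr φ)) t ∧ ¬ K.Has col (.inr (.inl e)) t) :
    ∃ e₁ e₂, e₁ ≠ e₂ ∧ 0 < K.tau₂ col (.inr (.inr φ)) (.inr (.inl e₁)) ∧
      0 < K.tau₂ col (.inr (.inr φ)) (.inr (.inl e₂)) := by
  have hnext : ∀ e, K.Adj (col ⁻¹' {.inr (.inr φ)}) (col ⁻¹' {.inr (.inl e)}) →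
      ∃ e', e' ≠ e ∧ 0 < K.tau₂ col (.inr (.inr φ)) (.inr (.inl e')) := by
    intro e he
    obtain ⟨t, ht, h1, h2⟩ := hna φ e he
    obtain ⟨u, e', ψ, h⟩ := hc.tri t ht
    refine ⟨e', ?_, cnt_pos ⟨ht, h1, (h _).2 (.inr (.inl rfl))⟩⟩
    rintro rfl
    exact h2 ((h _).2 (.inr (.inl rfl)))
  have hadj : ∀ e, 0 < K.tau₂ col (.inr (.inr φ)) (.inr (.inl e)) →
      K.Adj (col ⁻¹' {.inr (.inr φ)}) (col ⁻¹' {.inr (.inl e)}) := by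
    intro e he
    obtain ⟨t, -, h1, h2⟩ := exists_of_cnt_pos he
    exact adj_of_meets (disjoint_fiber (by simp)) h1 h2
  suffices ∃ e, 0 < K.tau₂ col (.inr (.inr φ)) (.inr (.inl e)) by
    obtain ⟨e, he⟩ := this
    obtain ⟨e', hne, he'⟩ := hnext e (hadj e he)
    exact ⟨e, e', hne.symm, he, he'⟩
  obtain ⟨x, hx⟩ := P.D_nonempty P.o
  obtain ⟨d, -, hd⟩ := P.conn_univ (col ⁻¹' {.inr (.inr φ)}) (Set.subset_univ _) hne (by
    intro h
    exact hc.not_mem_D' (.inr φ) x (h ▸ Set.mem_univ x) _ hx)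
  have hd' : ∃ c, c ≠ .inr (.inr φ) ∧ K.Cross (col ⁻¹' {.inr (.inr φ)}) (col ⁻¹' {c}) d := by
    simp only [Cut, Cross, Set.mem_preimage, Set.mem_singleton_iff] at hd ⊢
    by_cases h : col (K.src d) = .inr (.inr φ)
    · exact ⟨col (K.tgt d), by grind⟩
    · exact ⟨col (K.src d), by grind⟩
  obtain ⟨c, hcφ, hd'⟩ := hd'
  rcases c with u | e | ψ
  · have h1 := chi_le_link_D (hc.not_mem_D' (.inr φ)) (hc.conn _) u
      (hc.vertex u ▸ ⟨d, hd'⟩)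
    have h2 := two_link_fiber P.closed (col := col) (c := .inr (.inr φ)) (c' := .inl u) (by simp)
    rw [hc.vertex] at h2
    have h5 : 0 < K.tau₂ col (.inr (.inr φ)) (.inl u) := by omega
    obtain ⟨t, ht, h3, h4⟩ := exists_of_cnt_pos h5
    obtain ⟨u, e', ψ, h⟩ := hc.tri t ht
    exact ⟨e', cnt_pos ⟨ht, h3, (h _).2 (.inr (.inl rfl))⟩⟩
  · obtain ⟨e', -, he'⟩ := hnext e ⟨d, hd'⟩
    exact ⟨e', he'⟩
  · exact absurd ⟨d, hd'⟩ (hc.face φ ψ (by rintro rfl; exact hcφ rfl))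

theorem exists_bigon (hc : P.Valid col) {φ : Φ} (hchi : 1 ≤ K.chi (col ⁻¹' {.inr (.inr φ)}))
    (hna : ∀ φ e, K.Adj (col ⁻¹' {.inr (.inr φ)}) (col ⁻¹' {.inr (.inl e)}) →
        ∃ t, K.Tricolored col t ∧ K.Has col (.inr (.inr φ)) t ∧ ¬ K.Has col (.inr (.inl e)) t)
    (hlt : K.tau col (.inr (.inr φ)) < 6) :
    K.tau col (.inr (.inr φ)) = 4 ∧ K.chi (col ⁻¹' {.inr (.inr φ)}) = 1 ∧
    ∃ e₁ e₂, e₁ ≠ e₂ ∧ K.tau₂ col (.inr (.inr φ)) (.inr (.inl e₁)) = 2 ∧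
      K.tau₂ col (.inr (.inr φ)) (.inr (.inl e₂)) = 2 := by
  have hne : (col ⁻¹' {.inr (.inr φ)}).Nonempty := by
    by_contra h
    rw [Set.not_nonempty_iff_eq_empty] at h
    simp [h, chi, cnt, EIn, TIn] at hchi
  obtain ⟨e₁, e₂, hne', h1, h2⟩ := hc.exists_face_edge hne hchi hna
  have h3 := hc.sum_tau₂_edge (.inr (.inr φ))
  have h4 := fun e => two_link_fiber P.closed (col := col) (c := .inr (.inr φ))
    (c' := .inr (.inl e)) (by simp)
  have h5 : K.tau₂ col (.inr (.inr φ)) (.inr (.inl e₁)) +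
      K.tau₂ col (.inr (.inr φ)) (.inr (.inl e₂)) ≤ K.tau col (.inr (.inr φ)) := by
    rw [← h3, ← Finset.sum_pair (f := fun e => K.tau₂ col (.inr (.inr φ)) (.inr (.inl e))) hne']
    exact Finset.sum_le_univ_sum_of_nonneg fun e => cnt_nonneg _
  have h6 : 2 * ∑ e : Fin m, K.link (col ⁻¹' {.inr (.inr φ)}) (col ⁻¹' {.inr (.inl e)}) =
      K.tau col (.inr (.inr φ)) := by
    rw [← h3, Finset.mul_sum]
    exact Finset.sum_congr rfl fun e _ => h4 e
  have h7 := h4 e₁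
  have h8 := h4 e₂
  exact ⟨by omega, le_antisymm (hc.chi_le_one hne) hchi, e₁, e₂, hne', by omega, by omega⟩

end Valid

end DiscreteDrawing

namespace DiscreteDrawing

open TriComplex

open scoped Classical

variable {X E T : Type*} [Fintype X] [Fintype E] [Fintype T] {K : TriComplex X E T} {ι : Type*}
  [Fintype ι] {m : ℕ} {G : Type*} [Group G] {P : DiscreteDrawing K ι m G} {Φ : Type*}
  {col : X → ι ⊕ (Fin m ⊕ Φ)}

theorem tricolored_of_has {C : Type*} {col : X → C} {t : T} {a b c : C} (hab : a ≠ b)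
    (hbc : b ≠ c) (hac : a ≠ c) (ha : K.Has col a t) (hb : K.Has col b t) (hc : K.Has col c t) :
    K.Tricolored col t := by
  simp only [Has, Tricolored, TMeets, Set.mem_preimage, Set.mem_singleton_iff] at *
  grind

/-- Two edges cannot be contacted only once or twice in a connected region of Euler
characteristic one whose boundary has four links to the vertices. -/
theorem false_of_links {Z : Set X} (hZD : ∀ x ∈ Z, ∀ u, x ∉ P.D u) (hZ : K.Conn Z)
    (hchi : K.chi Z = 1) (hsum : ∑ u, 2 * K.link Z (P.D u) = 4) {e₁ e₂ : Fin m} (hne : e₁ ≠ e₂)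
    (h1 : P.N e₁ ⊆ Z) (h2 : P.N e₂ ⊆ Z) (hs : ∀ e, P.N e ⊆ Z → K.Adj Z (P.D (P.st e)))
    (ht : ∀ e, P.N e ⊆ Z → K.Adj Z (P.D (P.en e))) : False := by
  have hlink : ∀ u, K.Adj Z (P.D u) → 1 ≤ K.link Z (P.D u) := fun u h =>
    hchi ▸ chi_le_link_D hZD hZ u h
  have hone := Valid.link_le_of_sum hsum hZD
  have htwo := fun u w => Valid.link_add_le_of_sum hsum hZD (u := u) (w := w)
  have hx := h1 (P.p_mem e₁)
  by_cases hl : P.st e₁ = P.en e₁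
  · set u := P.st e₁ with hu
    have hlt : K.chi Z < K.link Z (P.D u) := chi_lt_link_of_loop hZD hZ h1 rfl hl.symm (hs e₁ h1)
    have h4 := hone u
    have hu2 : K.link Z (P.D u) = 2 := by omega
    have hend : ∀ w, K.Adj Z (P.D w) → w = u := by
      intro w hw
      by_contra hwu
      have h5 := htwo u w (Ne.symm hwu)
      have h6 := hlink w hw
      omega
    obtain ⟨Ω, hΩ, hΩne, hΩ1, hΩ', hΩne', hΩ1'⟩ := exists_split
      (Set.disjoint_left.2 fun x hx => hZD x hx u) P.loopless hu2
    obtain ⟨s, hsec, hs'⟩ := P.exists_section hZD hZ u hΩ hΩne (by rw [hΩ1, hchi])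
    obtain ⟨r, hrsec, hr'⟩ := P.exists_section hZD hZ u hΩ' hΩne' (by rw [hΩ1', hchi])
    have hin : ∀ x ∈ Z, K.Adj {x} (P.D u) →
        s x * (P.c u x)⁻¹ ∈ P.H u ∨ r x * (P.c u x)⁻¹ ∈ P.H u := by
      rintro x hx ⟨d, hd⟩
      have hd1 : K.Cross Z (P.D u) d := by
        simp only [Cross, Set.mem_singleton_iff] at hd ⊢
        rcases hd with hd | hd
        · exact .inl ⟨hd.1 ▸ hx, hd.2⟩
        · exact .inr ⟨hd.1, hd.2 ▸ hx⟩
      have hd2 : K.src d = x ∨ K.tgt d = x := by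
        rcases hd with hd | hd
        exacts [.inl hd.1, .inr hd.2]
      by_cases hdΩ : d ∈ Ω
      · exact .inl (hs' x hx ⟨d, hdΩ, hd2⟩)
      · exact .inr (hr' x hx ⟨d, ⟨hd1, hdΩ⟩, hd2⟩)
    have hjoin : ∀ e, P.N e ⊆ Z → P.Joins u u s r e ∨ P.Joins u u r s e := by
      intro e he
      have a1 := hend _ (hs e he)
      have a2 := hend _ (ht e he)
      have b1 := hin _ (he (P.p_mem e)) (a1 ▸ P.p_adj e)
      have b2 := hin _ (he (P.q_mem e)) (a2 ▸ P.q_adj e)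
      have hno : ∀ s, K.IsSection P.g Z (P.H u) s → s (P.p e) * (P.c u (P.p e))⁻¹ ∈ P.H u →
          s (P.q e) * (P.c u (P.q e))⁻¹ ∈ P.H u → False := fun s hs h h' =>
        not_mem_H_of_loop a1 a2 (P.hol_mem_of_section hs he (a1.symm ▸ h) (a2.symm ▸ h'))
      simp only [Joins, a1, a2, true_and]
      rcases b1 with b1 | b1 <;> rcases b2 with b2 | b2
      · exact (hno s hsec b1 b2).elim
      · exact .inl ⟨b1, b2⟩
      · exact .inr ⟨b1, b2⟩
      · exact (hno r hrsec b1 b2).elim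
    exact P.false_of_sections hZ hsec hrsec hne h1 h2 (hjoin e₁ h1) (hjoin e₂ h2)
  · set a := P.st e₁ with ha
    set b := P.en e₁ with hb
    have la := hlink a (hs e₁ h1)
    have lb := hlink b (ht e₁ h1)
    have lab := htwo a b hl
    have hend : ∀ w, K.Adj Z (P.D w) → w = a ∨ w = b := by
      intro w hw
      by_contra! hwu
      have h3 : ∑ i ∈ ({a, b, w} : Finset ι), 2 * K.link Z (P.D i) ≤ 4 := by
        rw [← hsum]
        refine Finset.sum_le_univ_sum_of_nonneg fun w => ?_
        rw [two_link P.closed (Set.disjoint_left.2 fun x hx => hZD x hx w)]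
        exact cnt_nonneg _
      rw [Finset.sum_insert (by simp [hl, hwu.1.symm]), Finset.sum_pair hwu.2.symm] at h3
      have h6 := hlink w hw
      omega
    obtain ⟨s, hsec, hs1, hs2⟩ := exists_full_section hZD hZ a (hs e₁ h1) (by omega)
    obtain ⟨r, hrsec, hr1, hr2⟩ := exists_full_section hZD hZ b (ht e₁ h1) (by omega)
    have hj1 : P.Joins a b s r e₁ := ⟨rfl, rfl, hs1 e₁ h1 rfl, hr2 e₁ h1 rfl⟩
    refine P.false_of_sections hZ hsec hrsec hne h1 h2 (.inl hj1) ?_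
    rcases hend _ (hs e₂ h2) with a1 | a1 <;> rcases hend _ (ht e₂ h2) with a2 | a2
    · exact (not_mem_H_of_loop a1 a2
        (P.hol_mem_of_section hsec h2 (hs1 e₂ h2 a1) (hs2 e₂ h2 a2))).elim
    · exact .inl ⟨a1, a2, hs1 e₂ h2 a1, hr2 e₂ h2 a2⟩
    · exact .inr ⟨a1, a2, hr1 e₂ h2 a1, hs2 e₂ h2 a2⟩
    · exact (not_mem_H_of_loop a1 a2
        (P.hol_mem_of_section hrsec h2 (hr1 e₂ h2 a1) (hr2 e₂ h2 a2))).elim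

theorem Valid.false_of_bigon (hc : P.Valid col) {φ : Φ} {e₁ e₂ : Fin m} (hne : e₁ ≠ e₂)
    (hφ : K.tau col (.inr (.inr φ)) = 4) (hχ : K.chi (col ⁻¹' {.inr (.inr φ)}) = 1)
    (h1 : K.tau₂ col (.inr (.inr φ)) (.inr (.inl e₁)) = 2)
    (h2 : K.tau₂ col (.inr (.inr φ)) (.inr (.inl e₂)) = 2)
    (hχ1 : 1 ≤ K.chi (col ⁻¹' {.inr (.inl e₁)})) (hχ2 : 1 ≤ K.chi (col ⁻¹' {.inr (.inl e₂)})) :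
    False := by
  have d1F : (.inr (.inl e₁) : ι ⊕ (Fin m ⊕ Φ)) ≠ .inr (.inr φ) := by simp
  have dF2 : (.inr (.inr φ) : ι ⊕ (Fin m ⊕ Φ)) ≠ .inr (.inl e₂) := by simp
  have d12 : (.inr (.inl e₁) : ι ⊕ (Fin m ⊕ Φ)) ≠ .inr (.inl e₂) := by simpa using hne
  have l1F := two_link_fiber P.closed (col := col) d1F
  rw [tau₂_comm, h1] at l1F
  have lF2 := two_link_fiber P.closed (col := col) dF2
  rw [h2] at lF2
  have no12 : ∀ t, K.Tricolored col t → K.Has col (.inr (.inl e₁)) t →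
      ¬ K.Has col (.inr (.inl e₂)) t := by
    intro t ht a1 a2
    obtain ⟨u, e, ψ, h⟩ := hc.tri t ht
    rw [h] at a1 a2
    simp only [reduceCtorEq, false_or, or_false, Sum.inr.injEq, Sum.inl.injEq] at a1 a2
    exact hne (a1.trans a2.symm)
  have l12 : K.link (col ⁻¹' {.inr (.inl e₁)}) (col ⁻¹' {.inr (.inl e₂)}) = 0 := by
    have := two_link_fiber P.closed (col := col) d12
    have h0 : K.tau₂ col (.inr (.inl e₁)) (.inr (.inl e₂)) = 0 := by
      rw [tau₂, cnt]
      exact Finset.sum_eq_zero fun t _ => if_neg fun h => no12 t h.1 h.2.1 h.2.2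
    omega
  have hU : Disjoint (col ⁻¹' {.inr (.inl e₁)} ∪ col ⁻¹' {.inr (.inr φ)})
      (col ⁻¹' {.inr (.inl e₂)}) := (disjoint_fiber d12).union_left (disjoint_fiber dF2)
  have hχZ := chi_union (K := K) hU
  rw [chi_union (disjoint_fiber d1F), link_union_left P.closed (disjoint_fiber d1F)
    (disjoint_fiber d12) (disjoint_fiber dF2), l12] at hχZ
  have h0 : cnt (fun t => K.TMeets (col ⁻¹' {.inr (.inl e₁)}) t ∧
      K.TMeets (col ⁻¹' {.inr (.inr φ)}) t ∧ K.TMeets (col ⁻¹' {.inr (.inl e₂)}) t) = 0 := by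
    rw [cnt]
    exact Finset.sum_eq_zero fun t _ => if_neg fun h =>
      no12 t (tricolored_of_has d1F dF2 d12 h.1 h.2.1 h.2.2) h.1 h.2.2
  have u1 := hc.chi_edge_le_one e₁
  have u2 := hc.chi_edge_le_one e₂
  have a1 := hc.two_chi_edge_le e₁
  have a2 := hc.two_chi_edge_le e₂
  have b1 := hc.four e₁
  have b2 := hc.four e₂
  refine false_of_links (P := P) (Z := col ⁻¹' {.inr (.inl e₁)} ∪ col ⁻¹' {.inr (.inr φ)} ∪
    col ⁻¹' {.inr (.inl e₂)}) ?_ ?_ (by omega) ?_ hne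
    (fun x hx => .inl (.inl (hc.edge e₁ hx))) (fun x hx => .inr (hc.edge e₂ hx))
    (fun e he => hc.adj_start e he) (fun e he => hc.adj_end e he)
  · rintro x ((hx | hx) | hx) <;> exact hc.not_mem_D' _ x hx
  · have hadj : ∀ c c', 0 < K.tau₂ col c c' → c ≠ c' → K.Adj (col ⁻¹' {c}) (col ⁻¹' {c'}) := by
      intro c c' hpos hcc
      obtain ⟨t, -, h1, h2⟩ := exists_of_cnt_pos hpos
      exact adj_of_meets (disjoint_fiber hcc) h1 h2
    refine Conn.union (Conn.union (hc.conn _) (hc.conn _)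
      (hadj _ _ (by rw [tau₂_comm, h1]; norm_num) d1F)) (hc.conn _) ?_
    obtain ⟨d, hd⟩ := hadj _ _ (by rw [h2]; norm_num) dF2
    exact ⟨d, hd.imp (And.imp_left .inr) (And.imp_right .inr)⟩
  · have hDd : ∀ c u, Disjoint (col ⁻¹' {(.inr c : ι ⊕ (Fin m ⊕ Φ))}) (P.D u) := fun c u =>
      Set.disjoint_left.2 fun x hx => hc.not_mem_D' c x hx u
    have hterm : ∀ u, 2 * K.link (col ⁻¹' {.inr (.inl e₁)} ∪ col ⁻¹' {.inr (.inr φ)} ∪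
        col ⁻¹' {.inr (.inl e₂)}) (P.D u) =
        2 * K.link (col ⁻¹' {.inr (.inl e₁)}) (P.D u) +
        2 * K.link (col ⁻¹' {.inr (.inr φ)}) (P.D u) +
        2 * K.link (col ⁻¹' {.inr (.inl e₂)}) (P.D u) -
        2 * cnt (fun t => (K.Tricolored col t ∧ K.Has col (.inr (.inr φ)) t ∧
          K.Has col (.inr (.inl e₁)) t) ∧ K.Has col (.inl u) t) -
        2 * cnt (fun t => (K.Tricolored col t ∧ K.Has col (.inr (.inr φ)) t ∧
          K.Has col (.inr (.inl e₂)) t) ∧ K.Has col (.inl u) t) := by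
      intro u
      rw [link_union_left P.closed hU ((hDd _ u).union_left (hDd _ u)) (hDd _ u),
        link_union_left P.closed (disjoint_fiber d1F) (hDd _ u) (hDd _ u), ← hc.vertex]
      have du : ∀ c, (.inr c : ι ⊕ (Fin m ⊕ Φ)) ≠ .inl u := by simp
      have c1 : (fun t => K.TMeets (col ⁻¹' {.inr (.inl e₁)}) t ∧
          K.TMeets (col ⁻¹' {.inr (.inr φ)}) t ∧ K.TMeets (col ⁻¹' {.inl u}) t) =
          (fun t => (K.Tricolored col t ∧ K.Has col (.inr (.inr φ)) t ∧
          K.Has col (.inr (.inl e₁)) t) ∧ K.Has col (.inl u) t) := by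
        ext t
        exact ⟨fun h => ⟨⟨tricolored_of_has d1F (du _) (du _) h.1 h.2.1 h.2.2, h.2.1, h.1⟩, h.2.2⟩,
          fun h => ⟨h.1.2.2, h.1.2.1, h.2⟩⟩
      have c2 : (fun t => K.TMeets (col ⁻¹' {.inr (.inl e₁)} ∪ col ⁻¹' {.inr (.inr φ)}) t ∧
          K.TMeets (col ⁻¹' {.inr (.inl e₂)}) t ∧ K.TMeets (col ⁻¹' {.inl u}) t) =
          (fun t => (K.Tricolored col t ∧ K.Has col (.inr (.inr φ)) t ∧
          K.Has col (.inr (.inl e₂)) t) ∧ K.Has col (.inl u) t) := by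
        ext t
        constructor
        · rintro ⟨h, h', h''⟩
          have h : K.Has col (.inr (.inl e₁)) t ∨ K.Has col (.inr (.inr φ)) t := by
            simp only [Has, TMeets, Set.mem_union] at h ⊢
            grind
          rcases h with h | h
          · exact (no12 t (tricolored_of_has d12 (du _) (du _) h h' h'') h h').elim
          · exact ⟨⟨tricolored_of_has dF2 (du _) (du _) h h' h'', h, h'⟩, h''⟩
        · rintro ⟨⟨-, h, h'⟩, h''⟩
          exact ⟨h.imp .inr (Or.imp .inr .inr), h', h''⟩
      rw [c1, c2]
      ring
    rw [Finset.sum_congr rfl fun u _ => hterm u]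
    simp only [Finset.sum_add_distrib, Finset.sum_sub_distrib, hc.sum_link]
    rw [← Finset.mul_sum, ← Finset.mul_sum, hc.sum_vertex, hc.sum_vertex]
    have e1 : cnt (fun t => K.Tricolored col t ∧ K.Has col (.inr (.inr φ)) t ∧
          K.Has col (.inr (.inl e₁)) t) = 2 := h1
    have e2 : cnt (fun t => K.Tricolored col t ∧ K.Has col (.inr (.inr φ)) t ∧
          K.Has col (.inr (.inl e₂)) t) = 2 := h2
    rw [e1, e2]
    omega

/-- A discrete drawing satisfies the edge bound. -/
theorem card_le (P : DiscreteDrawing K ι m G) : (m : ℤ) + 6 ≤ 3 * Fintype.card ι := by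
  obtain ⟨Φ, _, col₀, h₀⟩ := P.exists_valid
  obtain ⟨col, hc, hna⟩ := h₀.exists_nonabsorbing
  set big : Φ → Prop := fun φ => 1 ≤ K.chi (col ⁻¹' {.inr (.inr φ)}) ∧
    K.tau col (.inr (.inr φ)) < 6 with hbig
  have hex : ∀ φ, ∃ e : Option (Fin m), big φ → ∃ e', e = some e' ∧
      K.chi (col ⁻¹' {.inr (.inl e')}) ≤ 0 ∧
      K.tau₂ col (.inr (.inr φ)) (.inr (.inl e')) = 2 ∧ 4 ≤ K.tau col (.inr (.inr φ)) := by
    intro φ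
    by_cases hφ : big φ
    · obtain ⟨h4, h1, e₁, e₂, hne, t1, t2⟩ := hc.exists_bigon hφ.1 hna hφ.2
      by_cases hχ : K.chi (col ⁻¹' {.inr (.inl e₁)}) ≤ 0
      · exact ⟨some e₁, fun _ => ⟨e₁, rfl, hχ, t1, h4.ge⟩⟩
      by_cases hχ' : K.chi (col ⁻¹' {.inr (.inl e₂)}) ≤ 0
      · exact ⟨some e₂, fun _ => ⟨e₂, rfl, hχ', t2, h4.ge⟩⟩
      · exact (hc.false_of_bigon hne h4 h1 t1 t2 (by omega) (by omega)).elim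
    · exact ⟨none, fun h => absurd h hφ⟩
  choose ch hch using hex
  set b : Fin m → ℤ := fun e => cnt (fun φ => big φ ∧ ch φ = some e) with hb
  have hbsum : ∑ e, b e = cnt big := by
    refine sum_cnt_eq (q := fun e φ => ch φ = some e) fun φ hφ => ?_
    obtain ⟨e', he', -⟩ := hch φ hφ
    exact ⟨e', fun e => by rw [he']; simp [eq_comm]⟩
  have hb2 : ∀ e, 2 * b e ≤ K.tau col (.inr (.inl e)) := by
    intro e
    rw [← hc.sum_tau₂_face, hb]
    simp only [cnt, Finset.mul_sum]
    refine Finset.sum_le_sum fun φ _ => ?_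
    split_ifs with h
    · obtain ⟨e', he', -, h2, -⟩ := hch φ h.1
      rw [h.2, Option.some.injEq] at he'
      subst he'
      rw [tau₂_comm, h2]; norm_num
    · rw [mul_zero]
      exact cnt_nonneg _
  have hedge : ∀ e, 6 * K.chi (col ⁻¹' {.inr (.inl e)}) - 2 * K.tau col (.inr (.inl e)) +
      2 * b e ≤ -2 := by
    intro e
    have h1 := hb2 e
    have h2 := hc.two_chi_edge_le e
    have h3 := hc.chi_edge_le_one e
    have h4 := hc.four e
    by_cases h5 : K.chi (col ⁻¹' {.inr (.inl e)}) ≤ 0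
    · have h6 : 0 ≤ K.tau col (.inr (.inl e)) := cnt_nonneg _
      omega
    · have : b e = 0 := by
        simp only [hb, cnt]
        refine Finset.sum_eq_zero fun φ _ => if_neg fun h => ?_
        obtain ⟨e', he', h7, -⟩ := hch φ h.1
        rw [h.2, Option.some.injEq] at he'
        exact h5 (he' ▸ h7)
      omega
  have hface : ∀ φ, 6 * K.chi (col ⁻¹' {.inr (.inr φ)}) ≤ K.tau col (.inr (.inr φ)) +
      2 * (if big φ then 1 else 0) := by
    intro φ
    have h6 : 0 ≤ K.tau col (.inr (.inr φ)) := cnt_nonneg _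
    by_cases h : 1 ≤ K.chi (col ⁻¹' {.inr (.inr φ)})
    · have hne : (col ⁻¹' {.inr (.inr φ)}).Nonempty := by
        by_contra h'
        rw [Set.not_nonempty_iff_eq_empty] at h'
        simp [h', chi, cnt, EIn, TIn] at h
      have h1 := hc.chi_le_one hne
      by_cases hφ : big φ
      · obtain ⟨-, -, -, -, h2⟩ := hch φ hφ
        rw [if_pos hφ]
        omega
      · have : 6 ≤ K.tau col (.inr (.inr φ)) := by
          by_contra h7
          exact hφ ⟨h, by omega⟩
        rw [if_neg hφ]
        omega
    · split_ifs <;> omega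
  have s1 := Finset.sum_le_sum fun e (_ : e ∈ Finset.univ) => hedge e
  have s2 := Finset.sum_le_sum fun φ (_ : φ ∈ Finset.univ) => hface φ
  have s3 := two_chi_univ (K := K) (col := col) P.closed
  have s4 := P.euler
  simp only [Fintype.sum_sum_type, hc.vertex] at s3
  simp only [Finset.sum_add_distrib, Finset.sum_sub_distrib, ← Finset.mul_sum, hbsum,
    hc.sum_tau_edge, Finset.sum_const, Finset.card_univ, Fintype.card_fin, nsmul_eq_mul] at s1
  simp only [Finset.sum_add_distrib, ← Finset.mul_sum, hc.sum_tau_face] at s2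
  have s5 : cnt big = ∑ φ, if big φ then (1 : ℤ) else 0 := by
    rw [cnt]
    exact Finset.sum_congr rfl fun _ _ => by congr
  linarith

end DiscreteDrawing

namespace TorusLattice

open TriComplex

/-- The direction vectors of the triangulated square lattice. -/
def dir (M : ℕ) : Fin 3 → ZMod M × ZMod M := ![(1, 0), (0, 1), (1, 1)]

/-- The triangulation of the torus by the lattice `ZMod M × ZMod M`, each square being cut by the
diagonal of direction `(1, 1)`. -/
def complex (M : ℕ) :
    TriComplex (ZMod M × ZMod M) (Fin 3 × (ZMod M × ZMod M)) (Bool × (ZMod M × ZMod M)) where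
  src e := e.2
  tgt e := e.2 + dir M e.1
  va t := t.2
  vb t := t.2 + if t.1 then (0, 1) else (1, 0)
  vc t := t.2 + (1, 1)
  d0 t := if t.1 then (0, t.2 + (0, 1)) else (1, t.2 + (1, 0))
  d1 t := (2, t.2)
  d2 t := if t.1 then (1, t.2) else (0, t.2)
  src_d0 := by rintro ⟨_ | _, x⟩ <;> simp
  tgt_d0 := by rintro ⟨_ | _, x⟩ <;> simp [dir, add_assoc]
  src_d1 := by rintro ⟨_ | _, x⟩ <;> simp
  tgt_d1 := by rintro ⟨_ | _, x⟩ <;> simp [dir]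
  src_d2 := by rintro ⟨_ | _, x⟩ <;> simp
  tgt_d2 := by rintro ⟨_ | _, x⟩ <;> simp [dir]

variable {M : ℕ}

theorem val_add_one [NeZero M] (hM : 1 < M) (x : ZMod M) :
    (x + 1).val = if x.val + 1 = M then 0 else x.val + 1 := by
  have : Fact (1 < M) := ⟨hM⟩
  have hx := ZMod.val_lt x
  rw [ZMod.val_add, ZMod.val_one]
  split_ifs with h
  · rw [h, Nat.mod_self]
  · exact Nat.mod_eq_of_lt (by omega)

theorem val_sub_one [NeZero M] (hM : 1 < M) (x : ZMod M) :
    (x - 1).val = if x.val = 0 then M - 1 else x.val - 1 := by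
  have h := val_add_one hM (x - 1)
  rw [sub_add_cancel] at h
  have hx := ZMod.val_lt x
  have hx' := ZMod.val_lt (x - 1)
  split_ifs at h ⊢ <;> omega

section

variable [NeZero M]

theorem closed : (complex M).Closed := by
  classical
  have key : ∀ x y z : ZMod M × ZMod M, (x + z = y) = (x = y - z) := fun x y z => by
    rw [eq_sub_iff_add_eq]
  rintro ⟨i, x⟩
  rw [Fintype.sum_prod_type, Fintype.sum_bool]
  fin_cases i <;> simp [sideCount, complex, Finset.sum_add_distrib, key]

theorem loopless (hM : 1 < M) (e) : (complex M).src e ≠ (complex M).tgt e := by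
  have : Fact (1 < M) := ⟨hM⟩
  obtain ⟨i, x⟩ := e
  fin_cases i <;> simp [complex, dir, Prod.ext_iff]

theorem exists_triangle (x) : ∃ t, (complex M).va t = x := ⟨(true, x), rfl⟩

theorem chi_univ : (complex M).chi Set.univ = 0 := by
  simp only [chi, cnt, EIn, TIn, Set.mem_univ, and_self, if_true, Finset.sum_const,
    Finset.card_univ, Fintype.card_prod, Fintype.card_fin, Fintype.card_bool]
  simp
  ring

end

/-- The lattice points with coordinates in `[a, b) × [c, d)`. -/
def box (M a b c d : ℕ) : Set (ZMod M × ZMod M) :=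
  {x | (a ≤ x.1.val ∧ x.1.val < b) ∧ c ≤ x.2.val ∧ x.2.val < d}

theorem mem_box {a b c d : ℕ} {x : ZMod M × ZMod M} :
    x ∈ box M a b c d ↔ (a ≤ x.1.val ∧ x.1.val < b) ∧ c ≤ x.2.val ∧ x.2.val < d := Iff.rfl

theorem sum_interval [NeZero M] {a b : ℕ} (hab : a ≤ b) (hb : b ≤ M) :
    (∑ x : ZMod M, if a ≤ x.val ∧ x.val < b then (1 : ℤ) else 0) = b - a := by
  rw [← Finset.sum_filter, Finset.sum_const, nsmul_eq_mul, mul_one]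
  have : (Finset.univ.filter fun x : ZMod M => a ≤ x.val ∧ x.val < b).card = (Finset.Ico a b).card := by
    refine Finset.card_bij (fun x _ => x.val) (fun x hx => ?_) (fun x _ y _ h => ?_) fun k hk => ?_
    · simpa using hx
    · exact ZMod.val_injective M h
    · have hk' := Finset.mem_Ico.1 hk
      have : (k : ZMod M).val = k := ZMod.val_cast_of_lt (by omega)
      exact ⟨(k : ZMod M), by simp [this, hk'], this⟩
  rw [this, Nat.card_Ico]
  omega

theorem cnt_box [NeZero M] {a b c d : ℕ} (hab : a ≤ b) (hb : b ≤ M) (hcd : c ≤ d) (hd : d ≤ M)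
    {p : ZMod M × ZMod M → Prop}
    (hp : ∀ x, p x ↔ (a ≤ x.1.val ∧ x.1.val < b) ∧ c ≤ x.2.val ∧ x.2.val < d) :
    cnt p = (b - a) * (d - c) := by
  rw [← sum_interval hab hb, ← sum_interval hcd hd, Finset.sum_mul_sum, cnt,
    Fintype.sum_prod_type]
  refine Finset.sum_congr rfl fun x _ => Finset.sum_congr rfl fun y _ => ?_
  have := hp (x, y)
  split_ifs <;> simp_all

theorem cnt_prod {α β : Type*} [Fintype α] [Fintype β] (p : α × β → Prop) :
    cnt p = ∑ i, cnt fun x => p (i, x) := by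
  rw [cnt, Fintype.sum_prod_type]
  rfl

variable [NeZero M] {a b c d : ℕ}

theorem chi_box (ha : a < b) (hb : b < M) (hc : c < d) (hd : d < M) :
    (complex M).chi (box M a b c d) = 1 := by
  have hM : 1 < M := by omega
  rw [chi, cnt_prod ((complex M).EIn _), cnt_prod ((complex M).TIn _), Fin.sum_univ_three, Fintype.sum_bool,
    cnt_box ha.le hb.le hc.le hd.le (p := fun x => x ∈ box M a b c d) fun x => Iff.rfl,
    cnt_box (a := a) (b := b - 1) (c := c) (d := d) (by omega) (by omega) (by omega) (by omega),
    cnt_box (a := a) (b := b) (c := c) (d := d - 1) (by omega) (by omega) (by omega) (by omega),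
    cnt_box (a := a) (b := b - 1) (c := c) (d := d - 1) (by omega) (by omega) (by omega) (by omega),
    cnt_box (a := a) (b := b - 1) (c := c) (d := d - 1) (by omega) (by omega) (by omega) (by omega),
    cnt_box (a := a) (b := b - 1) (c := c) (d := d - 1) (by omega) (by omega) (by omega) (by omega)]
  · rw [Nat.cast_sub (by omega), Nat.cast_sub (by omega)]
    push_cast
    ring
  all_goals
    intro x
    have h1 := val_add_one hM x.1
    have h2 := val_add_one hM x.2
    have h3 := ZMod.val_lt x.1
    have h4 := ZMod.val_lt x.2
    simp [EIn, TIn, complex, dir, mem_box, h1, h2]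
    split_ifs <;> omega

end TorusLattice

namespace TorusLattice

open TriComplex

variable {M : ℕ} [NeZero M] {a b c d : ℕ}

theorem chi_compl_box (ha : a < b) (hb : b < M) (hc : c < d) (hd : d < M) :
    (complex M).chi (box M a b c d)ᶜ = -1 := by
  have h := (complex M).chi_union (disjoint_compl_right (a := box M a b c d))
  have h' := two_link closed (disjoint_compl_right (a := box M a b c d))
  rw [Set.union_compl_self, chi_univ, chi_box ha hb hc hd] at h
  simp [Set.union_compl_self, TMeets, cnt] at h'
  linarith

/-- `B` is stable under the unit steps of the lattice inside `A`. -/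
structure StepInvariant (A B : Set (ZMod M × ZMod M)) : Prop where
  right : ∀ x y, (x, y) ∈ A → (x + 1, y) ∈ A → ((x, y) ∈ B ↔ (x + 1, y) ∈ B)
  up : ∀ x y, (x, y) ∈ A → (x, y + 1) ∈ A → ((x, y) ∈ B ↔ (x, y + 1) ∈ B)

theorem conn_of_stepInvariant {A : Set (ZMod M × ZMod M)} (x₀ : ZMod M × ZMod M)
    (h : ∀ B, StepInvariant A B → ∀ x ∈ A, x ∈ B ↔ x₀ ∈ B) : (complex M).Conn A := by
  intro B hBA ⟨y, hy⟩ hne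
  by_contra! hcut
  have hinv : StepInvariant A B := by
    refine ⟨fun x y h1 h2 => ?_, fun x y h1 h2 => ?_⟩
    · simpa [Cut, complex, dir] using hcut (0, x, y) (by simpa [EIn, complex, dir] using ⟨h1, h2⟩)
    · simpa [Cut, complex, dir] using hcut (1, x, y) (by simpa [EIn, complex, dir] using ⟨h1, h2⟩)
  have h0 := (h B hinv y (hBA hy)).1 hy
  exact hne (hBA.antisymm fun x hx => (h B hinv x hx).2 h0)

namespace StepInvariant

variable {A B : Set (ZMod M × ZMod M)}

theorem row (h : StepInvariant A B) {y : ZMod M} {i j : ℕ} (hij : i ≤ j)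
    (hA : ∀ k, i ≤ k → k ≤ j → ((k : ZMod M), y) ∈ A) :
    ((i : ZMod M), y) ∈ B ↔ ((j : ZMod M), y) ∈ B := by
  induction j, hij using Nat.le_induction with
  | base => rfl
  | succ j hij ih =>
    have h1 := hA (j + 1) (by omega) le_rfl
    rw [ih fun k hk hk' => hA k hk (by omega), h.right _ _ (hA j hij (by omega)) (by exact_mod_cast h1)]
    push_cast
    rfl

theorem col (h : StepInvariant A B) {x : ZMod M} {i j : ℕ} (hij : i ≤ j)
    (hA : ∀ k, i ≤ k → k ≤ j → (x, (k : ZMod M)) ∈ A) :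
    (x, (i : ZMod M)) ∈ B ↔ (x, (j : ZMod M)) ∈ B := by
  induction j, hij using Nat.le_induction with
  | base => rfl
  | succ j hij ih =>
    have h1 := hA (j + 1) (by omega) le_rfl
    rw [ih fun k hk hk' => hA k hk (by omega), h.up _ _ (hA j hij (by omega)) (by exact_mod_cast h1)]
    push_cast
    rfl

theorem row' (h : StepInvariant A B) {y x : ZMod M} {i : ℕ} (hij : i ≤ x.val)
    (hA : ∀ k, i ≤ k → k ≤ x.val → ((k : ZMod M), y) ∈ A) :
    (x, y) ∈ B ↔ ((i : ZMod M), y) ∈ B := by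
  rw [h.row hij hA, ZMod.natCast_zmod_val]

theorem col' (h : StepInvariant A B) {y x : ZMod M} {i : ℕ} (hij : i ≤ y.val)
    (hA : ∀ k, i ≤ k → k ≤ y.val → (x, (k : ZMod M)) ∈ A) :
    (x, y) ∈ B ↔ (x, (i : ZMod M)) ∈ B := by
  rw [h.col hij hA, ZMod.natCast_zmod_val]

end StepInvariant

theorem conn_univ : (complex M).Conn Set.univ :=
  conn_of_stepInvariant 0 fun B h x _ => by
    have h1 := h.row' (x := x.1) (y := x.2) (Nat.zero_le _) fun _ _ _ => Set.mem_univ _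
    have h2 := h.col' (x := 0) (y := x.2) (Nat.zero_le _) fun _ _ _ => Set.mem_univ _
    simp only [Nat.cast_zero] at h1 h2
    exact h1.trans h2

theorem conn_box (ha : a < b) (hb : b < M) (hc : c < d) (hd : d < M) :
    (complex M).Conn (box M a b c d) :=
  conn_of_stepInvariant (a, c) fun B h x hx => by
    have hv : ∀ k : ℕ, k < M → (k : ZMod M).val = k := fun k hk => ZMod.val_cast_of_lt hk
    rw [mem_box] at hx
    have h1 := h.row' (x := x.1) (y := x.2) hx.1.1 fun k hk hk' => by
      simp only [mem_box]; rw [hv k (by omega)]; omega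
    have h2 := h.col' (x := a) (y := x.2) hx.2.1 fun k hk hk' => by
      simp only [mem_box]; rw [hv k (by omega), hv a (by omega)]; omega
    exact h1.trans h2

theorem conn_compl_box (ha : 0 < a) (hb : b < M) (hc : 0 < c) (hd : d < M) :
    (complex M).Conn (box M a b c d)ᶜ :=
  conn_of_stepInvariant 0 fun B h x hx => by
    have hv : ∀ k : ℕ, k < M → (k : ZMod M).val = k := fun k hk => ZMod.val_cast_of_lt hk
    have v0 : (0 : ZMod M).val = 0 := ZMod.val_zero
    have hx1 := ZMod.val_lt x.1
    have hx2 := ZMod.val_lt x.2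
    rw [Set.mem_compl_iff, mem_box] at hx
    by_cases h1 : a ≤ x.1.val ∧ x.1.val < b
    · have h1 := h.row' (x := x.1) (y := x.2) (Nat.zero_le _) fun k hk hk' => by
        simp only [mem_box, Set.mem_compl_iff]; rw [hv k (by omega)]; omega
      have h2 := h.col' (x := 0) (y := x.2) (Nat.zero_le _) fun k hk hk' => by
        simp only [mem_box, Set.mem_compl_iff]; rw [hv k (by omega), v0]; omega
      simp only [Nat.cast_zero] at h1 h2
      exact h1.trans h2
    · have h1 := h.col' (x := x.1) (y := x.2) (Nat.zero_le _) fun k hk hk' => by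
        simp only [mem_box, Set.mem_compl_iff]; rw [hv k (by omega)]; omega
      have h2 := h.row' (x := x.1) (y := 0) (Nat.zero_le _) fun k hk hk' => by
        simp only [mem_box, Set.mem_compl_iff]; rw [hv k (by omega), v0]; omega
      simp only [Nat.cast_zero] at h1 h2
      exact h1.trans h2

end TorusLattice

namespace TorusLattice

open TriComplex

open scoped Classical

variable {M : ℕ}

theorem dualConn_of_conn_compl {D : Set (ZMod M × ZMod M)} (hD : (complex M).Conn Dᶜ) :
    (complex M).DualConn D := by
  intro T' ⟨t₀, ht₀⟩ hT' ⟨t₁, ht₁, ht₁'⟩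
  by_contra! hcon
  have hinv : ∀ t t' e, ¬ (complex M).TIn D t → ¬ (complex M).TIn D t' → ¬ (complex M).EIn D e →
      (complex M).sideCount t e ≠ 0 → (complex M).sideCount t' e ≠ 0 → (t ∈ T' ↔ t' ∈ T') :=
    fun t t' e h1 h2 h3 h4 h5 => ⟨fun h => by_contra fun h' => h5 (hcon t h t' h' h2 e h3 h4),
      fun h => by_contra fun h' => h4 (hcon t' h t h' h1 e h3 h5)⟩
  have key : ∀ x ∉ D, ((false, x) ∈ T' ↔ (true, x) ∈ T') ∧
      ((false, x) ∈ T' ↔ (false, x - (1, 0)) ∈ T') ∧ ((false, x) ∈ T' ↔ (true, x - (1, 1)) ∈ T') ∧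
      ((false, x) ∈ T' ↔ (false, x - (1, 1)) ∈ T') ∧
      ((false, x) ∈ T' ↔ (true, x - (0, 1)) ∈ T') := by
    intro x hx
    have e1 : x - (1, 0) + (1, 1) = x + (0, 1) := by ext <;> simp
    have e2 : x - (1, 1) + (1, 0) = x - (0, 1) := by ext <;> simp
    have e3 : x - (1, 1) + (0, 1) = x - (1, 0) := by ext <;> simp
    have h1 := hinv (false, x) (true, x) (2, x) (by simp [TIn, complex, hx])
      (by simp [TIn, complex, hx]) (by simp [EIn, complex, hx]) (by simp [sideCount, complex])
      (by simp [sideCount, complex])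
    have h2 := hinv (true, x) (false, x - (1, 0)) (1, x) (by simp [TIn, complex, hx])
      (by simp [TIn, complex, hx]) (by simp [EIn, complex, hx]) (by simp [sideCount, complex])
      (by simp [sideCount, complex])
    have h3 := hinv (false, x - (1, 0)) (true, x - (1, 1)) (0, x - (1, 0))
      (by simp [TIn, complex, hx]) (by simp [TIn, complex, hx]) (by simp [EIn, complex, dir, hx])
      (by simp [sideCount, complex]) (by simp [sideCount, complex, e3])
    have h4 := hinv (true, x - (1, 1)) (false, x - (1, 1)) (2, x - (1, 1))
      (by simp [TIn, complex, hx]) (by simp [TIn, complex, hx]) (by simp [EIn, complex, dir, hx])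
      (by simp [sideCount, complex]) (by simp [sideCount, complex])
    have h5 := hinv (false, x - (1, 1)) (true, x - (0, 1)) (1, x - (0, 1))
      (by simp [TIn, complex, hx]) (by simp [TIn, complex, hx]) (by simp [EIn, complex, dir, hx])
      (by simp [sideCount, complex, e2]) (by simp [sideCount, complex])
    exact ⟨h1, h1.trans h2, (h1.trans h2).trans h3, ((h1.trans h2).trans h3).trans h4,
      (((h1.trans h2).trans h3).trans h4).trans h5⟩
  have hva : ∀ t, (complex M).va t ∉ D → (t ∈ T' ↔ (false, (complex M).va t) ∈ T') := by
    rintro ⟨_ | _, x⟩ hx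
    · rfl
    · exact (key x hx).1.symm
  have hvb : ∀ t, (complex M).vb t ∉ D → (t ∈ T' ↔ (false, (complex M).vb t) ∈ T') := by
    rintro ⟨_ | _, x⟩ hx
    · simpa [complex] using (key _ hx).2.1.symm
    · simpa [complex] using (key _ hx).2.2.2.2.symm
  have hvc : ∀ t, (complex M).vc t ∉ D → (t ∈ T' ↔ (false, (complex M).vc t) ∈ T') := by
    rintro ⟨_ | _, x⟩ hx
    · simpa [complex] using (key _ hx).2.2.2.1.symm
    · simpa [complex] using (key _ hx).2.2.1.symm
  have hex : ∀ t, ¬ (complex M).TIn D t → ∃ x ∉ D, (t ∈ T' ↔ (false, x) ∈ T') := by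
    intro t ht
    by_contra! h
    refine ht ⟨?_, ?_, ?_⟩ <;> by_contra hx
    · rcases h _ hx with h | h <;> have := hva t hx <;> tauto
    · rcases h _ hx with h | h <;> have := hvb t hx <;> tauto
    · rcases h _ hx with h | h <;> have := hvc t hx <;> tauto
  obtain ⟨x₀, hx₀, h₀⟩ := hex t₀ (hT' _ ht₀)
  obtain ⟨x₁, hx₁, h₁⟩ := hex t₁ ht₁
  obtain ⟨⟨i, x⟩, ⟨he1, he2⟩, hcut⟩ := hD {x | x ∉ D ∧ (false, x) ∈ T'} (fun x hx => hx.1)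
    ⟨x₀, hx₀, h₀.1 ht₀⟩ fun h => ht₁' (h₁.2 (h.ge hx₁).2)
  refine hcut ?_
  have h2 : (false, (complex M).src (i, x)) ∈ T' ↔ (false, (complex M).tgt (i, x)) ∈ T' := by
    fin_cases i
    · exact hvb (false, x) he2
    · exact (hva (true, x) he1).symm.trans (hvb (true, x) he2)
    · exact hvc (false, x) he2
  exact ⟨fun h => ⟨he2, h2.1 h.2⟩, fun h => ⟨he1, h2.2 h.2⟩⟩

/-- The six triangles around a lattice point, in cyclic order. -/
def star (x : ZMod M × ZMod M) : Fin 6 → Bool × (ZMod M × ZMod M) :=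
  ![(false, x), (true, x), (false, x - (1, 0)), (true, x - (1, 1)), (false, x - (1, 1)),
    (true, x - (0, 1))]

theorem exists_star_eq {x : ZMod M × ZMod M} {t} (h : (complex M).TMeets {x} t) :
    ∃ i, star x i = t := by
  obtain ⟨_ | _, y⟩ := t <;> rcases h with h | h | h <;> obtain rfl := Set.mem_singleton_iff.1 h
  · exact ⟨0, rfl⟩
  · exact ⟨2, by simp [star, complex]⟩
  · exact ⟨4, by simp [star, complex]⟩
  · exact ⟨1, rfl⟩
  · exact ⟨5, by simp [star, complex]⟩
  · exact ⟨3, by simp [star, complex]⟩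

variable [NeZero M]

/-- The number of changes of `D` in the cyclic sequence of neighbours of `p` bounds the number of
triangles at `p` with exactly one further vertex in `D`. -/
theorem cnt_star_le {D : Set (ZMod M × ZMod M)} {p : ZMod M × ZMod M} (hp : p ∉ D) :
    cnt (fun t => (complex M).TMeets {p} t ∧ (complex M).TMeets D t ∧
      (complex M).TMeets ({p} ∪ D)ᶜ t) ≤
      (if p + (1, 0) ∈ D ↔ p + (1, 1) ∈ D then 0 else 1) +
      (if p + (1, 1) ∈ D ↔ p + (0, 1) ∈ D then 0 else 1) +
      (if p + (0, 1) ∈ D ↔ p - (1, 0) ∈ D then 0 else 1) +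
      (if p - (1, 0) ∈ D ↔ p - (1, 1) ∈ D then 0 else 1) +
      (if p - (1, 1) ∈ D ↔ p - (0, 1) ∈ D then 0 else 1) +
      (if p - (0, 1) ∈ D ↔ p + (1, 0) ∈ D then 0 else 1) := by
  set Q := fun t => (complex M).TMeets {p} t ∧ (complex M).TMeets D t ∧
      (complex M).TMeets ({p} ∪ D)ᶜ t with hQ
  have h1 : cnt Q ≤ ∑ i, if Q (star p i) then 1 else 0 := by
    rw [cnt_eq_card, Finset.sum_boole, Nat.cast_le]
    refine (Finset.card_le_card fun t ht => ?_).trans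
      (Finset.card_image_le (f := star p) (s := Finset.univ.filter fun i => Q (star p i)))
    obtain ⟨i, rfl⟩ := exists_star_eq (Finset.mem_filter.1 ht).2.1
    exact Finset.mem_image_of_mem _
      (Finset.mem_filter.2 ⟨Finset.mem_univ _, (Finset.mem_filter.1 ht).2⟩)
  have e1 : p - (1, 0) + (1, 1) = p + (0, 1) := by ext <;> simp
  have e2 : p - (1, 1) + (1, 0) = p - (0, 1) := by ext <;> simp
  have e3 : p - (1, 1) + (0, 1) = p - (1, 0) := by ext <;> simp
  have e4 : p - (0, 1) + (1, 1) = p + (1, 0) := by ext <;> simp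
  have ite_le : ∀ {P R : Prop} [Decidable P] [Decidable R], (R → ¬ P) → (if P then (1 : ℤ) else 0) ≤ if R then 0 else 1 := by
    intro P R _ _ h
    split_ifs <;> simp_all
  refine h1.trans ?_
  rw [Fin.sum_univ_six]
  gcongr <;> refine ite_le fun h => ?_ <;>
    simp [hQ, star, complex, TMeets, e1, e2, e3, e4, hp, h] <;> exact fun h _ => h

theorem sum_changes_le_two {b₀ b₁ b₂ b₃ b₄ b₅ : Prop}
    (h : (¬ b₂ ∧ ¬ b₃ ∧ ¬ b₄ ∧ ¬ b₅) ∨ (¬ b₀ ∧ ¬ b₁ ∧ ¬ b₂ ∧ ¬ b₅) ∨ (¬ b₀ ∧ ¬ b₃ ∧ ¬ b₄ ∧ ¬ b₅) ∨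
      (¬ b₀ ∧ ¬ b₁ ∧ ¬ b₂ ∧ ¬ b₃)) :
    (if b₀ ↔ b₁ then 0 else 1) + (if b₁ ↔ b₂ then 0 else 1) + (if b₂ ↔ b₃ then 0 else 1) +
      (if b₃ ↔ b₄ then 0 else 1) + (if b₄ ↔ b₅ then 0 else 1) + (if b₅ ↔ b₀ then 0 else 1) ≤
      (2 : ℤ) := by
  rcases h with ⟨h1, h2, h3, h4⟩ | ⟨h1, h2, h3, h4⟩ | ⟨h1, h2, h3, h4⟩ | ⟨h1, h2, h3, h4⟩
  · by_cases k1 : b₀ <;> by_cases k2 : b₁ <;> simp [h1, h2, h3, h4, k1, k2]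
  · by_cases k1 : b₃ <;> by_cases k2 : b₄ <;> simp [h1, h2, h3, h4, k1, k2]
  · by_cases k1 : b₁ <;> by_cases k2 : b₂ <;> simp [h1, h2, h3, h4, k1, k2]
  · by_cases k1 : b₄ <;> by_cases k2 : b₅ <;> simp [h1, h2, h3, h4, k1, k2]

theorem sum_changes_le_two' {b₀ b₁ b₂ b₃ b₄ b₅ : Prop} (h1 : b₁ ↔ b₀ ∨ b₂) (h4 : b₄ ↔ b₃ ∨ b₅)
    (h : ¬ (b₀ ∧ b₃)) (h' : ¬ (b₂ ∧ b₅)) :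
    (if b₀ ↔ b₁ then 0 else 1) + (if b₁ ↔ b₂ then 0 else 1) + (if b₂ ↔ b₃ then 0 else 1) +
      (if b₃ ↔ b₄ then 0 else 1) + (if b₄ ↔ b₅ then 0 else 1) + (if b₅ ↔ b₀ then 0 else 1) ≤
      (2 : ℤ) := by
  by_cases k0 : b₀ <;> by_cases k2 : b₂ <;> by_cases k3 : b₃ <;> by_cases k5 : b₅ <;>
    simp_all

variable {a b c d : ℕ}

theorem cnt_star_box_le {p : ZMod M × ZMod M} (hp : p ∉ box M a b c d) (ha : 0 < a) (hab : a < b)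
    (hb : b < M) (hc : 0 < c) (hd : d < M) :
    cnt (fun t => (complex M).TMeets {p} t ∧ (complex M).TMeets (box M a b c d) t ∧
      (complex M).TMeets ({p} ∪ box M a b c d)ᶜ t) ≤ 2 := by
  have hM : 1 < M := by omega
  refine (cnt_star_le hp).trans (sum_changes_le_two ?_)
  have h1 := val_add_one hM p.1
  have h2 := val_add_one hM p.2
  have h3 := val_sub_one hM p.1
  have h4 := val_sub_one hM p.2
  have h5 := ZMod.val_lt p.1
  have h6 := ZMod.val_lt p.2
  simp only [mem_box, Prod.fst_add, Prod.snd_add, Prod.fst_sub, Prod.snd_sub, add_zero,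
    sub_zero] at hp ⊢
  rcases (by omega : p.1.val < a ∨ b ≤ p.1.val ∨ p.2.val < c ∨ d ≤ p.2.val) with h | h | h | h
  · have : ¬ (a ≤ (p.1 - 1).val ∧ (p.1 - 1).val < b) := by rw [h3]; split_ifs <;> omega
    left; omega
  · have : ¬ (a ≤ (p.1 + 1).val ∧ (p.1 + 1).val < b) := by rw [h1]; split_ifs <;> omega
    right; left; omega
  · have : ¬ (c ≤ (p.2 - 1).val ∧ (p.2 - 1).val < d) := by rw [h4]; split_ifs <;> omega
    right; right; left; omega
  · have : ¬ (c ≤ (p.2 + 1).val ∧ (p.2 + 1).val < d) := by rw [h2]; split_ifs <;> omega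
    right; right; right; omega

theorem cnt_star_compl_box_le {p : ZMod M × ZMod M} (hp : p ∈ box M a b c d) (hab : a + 1 < b)
    (hb : b < M) (hcd : c + 1 < d) (hd : d < M) :
    cnt (fun t => (complex M).TMeets {p} t ∧ (complex M).TMeets (box M a b c d)ᶜ t ∧
      (complex M).TMeets ({p} ∪ (box M a b c d)ᶜ)ᶜ t) ≤ 2 := by
  have hM : 1 < M := by omega
  have h1 := val_add_one hM p.1
  have h2 := val_add_one hM p.2
  have h3 := val_sub_one hM p.1
  have h4 := val_sub_one hM p.2
  have h5 := ZMod.val_lt p.1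
  have h6 := ZMod.val_lt p.2
  have l : (a ≤ (p.1 + 1).val ∧ (p.1 + 1).val < b) ∨ (a ≤ (p.1 - 1).val ∧ (p.1 - 1).val < b) := by
    rw [mem_box] at hp; rw [h1, h3]; split_ifs <;> omega
  have r : (c ≤ (p.2 + 1).val ∧ (p.2 + 1).val < d) ∨ (c ≤ (p.2 - 1).val ∧ (p.2 - 1).val < d) := by
    rw [mem_box] at hp; rw [h2, h4]; split_ifs <;> omega
  refine (cnt_star_le (Set.notMem_compl_iff.2 hp)).trans (sum_changes_le_two' ?_ ?_ ?_ ?_) <;>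
  · simp only [mem_box, Prod.fst_add, Prod.snd_add, Prod.fst_sub, Prod.snd_sub, add_zero,
      sub_zero, Set.mem_compl_iff] at hp ⊢
    omega

end TorusLattice

namespace TorusLattice

open TriComplex

variable {M : ℕ} [NeZero M]

theorem StepInvariant.row_iff {A B : Set (ZMod M × ZMod M)} (h : StepInvariant A B) {y : ZMod M}
    (hA : ∀ x, (x, y) ∈ A) (x x' : ZMod M) : (x, y) ∈ B ↔ (x', y) ∈ B :=
  (h.row' (Nat.zero_le _) fun k _ _ => hA k).trans
    (h.row' (x := x') (Nat.zero_le _) fun k _ _ => hA k).symm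

theorem StepInvariant.col_iff {A B : Set (ZMod M × ZMod M)} (h : StepInvariant A B) {x : ZMod M}
    (hA : ∀ y, (x, y) ∈ A) (y y' : ZMod M) : (x, y) ∈ B ↔ (x, y') ∈ B :=
  (h.col' (Nat.zero_le _) fun k _ _ => hA k).trans
    (h.col' (y := y') (Nat.zero_le _) fun k _ _ => hA k).symm

theorem conn_compl_singleton (hM : 1 < M) (x : ZMod M × ZMod M) : (complex M).Conn {x}ᶜ := by
  have : Fact (1 < M) := ⟨hM⟩
  refine conn_of_stepInvariant (x.1 + 1, x.2 + 1) fun B h y hy => ?_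
  by_cases h1 : y.1 = x.1
  · have h2 : y.2 ≠ x.2 := fun h2 => hy (Prod.ext h1 h2)
    exact (h.row_iff (y := y.2) (fun k hk => h2 (show (k, y.2).2 = x.2 from congrArg Prod.snd (show (k, y.2) = x from hk))) y.1 (x.1 + 1)).trans
      (h.col_iff (x := x.1 + 1) (fun k hk => by simpa using congrArg Prod.fst hk) y.2 (x.2 + 1))
  · exact (h.col_iff (x := y.1) (fun k hk => h1 (show (y.1, k).1 = x.1 from congrArg Prod.fst (show (y.1, k) = x from hk))) y.2 (x.2 + 1)).trans
      (h.row_iff (y := x.2 + 1) (fun k hk => by simpa using congrArg Prod.snd hk) y.1 (x.1 + 1))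

theorem dualConn_singleton (hM : 1 < M) (x : ZMod M × ZMod M) : (complex M).DualConn {x} :=
  dualConn_of_conn_compl (conn_compl_singleton hM x)

end TorusLattice

namespace SphereCurve

variable {S : Type*} [TopologicalSpace S] {V : Set S} {v w x y : S}

/-- The interior of the path avoids `V`. -/
def Off (V : Set S) (p : Path v w) : Prop := ∀ t : I, t ≠ 0 → t ≠ 1 → p t ∉ V

/-- The path avoids `V` except possibly at its source. -/
def OffSource (V : Set S) (p : Path v w) : Prop := ∀ t : I, t ≠ 0 → p t ∉ V

/-- The path avoids `V` except possibly at its target. -/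
def OffTarget (V : Set S) (p : Path v w) : Prop := ∀ t : I, t ≠ 1 → p t ∉ V

/-- Homotopy of paths relative to the end points whose interior avoids `V`. -/
def HomOff (V : Set S) (p q : Path v w) : Prop :=
  ∃ H : Path.Homotopy p q, ∀ s t : I, s ≠ 0 → s ≠ 1 → t ≠ 0 → t ≠ 1 → H (s, t) ∉ V

theorem trans_cases (p : Path v x) (q : Path x w) (t : I) :
    (∃ s : I, p.trans q t = p s ∧ (s = 0 → t = 0)) ∨
      ∃ s : I, p.trans q t = q s ∧ (s = 1 → t = 1) := by
  rw [Path.trans_apply]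
  split_ifs with h
  · refine Or.inl ⟨_, rfl, fun h0 => ?_⟩
    have := congrArg Subtype.val h0
    simp only [Set.Icc.coe_zero] at this
    exact Subtype.ext (by simp only [Set.Icc.coe_zero]; linarith)
  · refine Or.inr ⟨_, rfl, fun h0 => ?_⟩
    have := congrArg Subtype.val h0
    simp only [Set.Icc.coe_one] at this
    exact Subtype.ext (by simp only [Set.Icc.coe_one]; linarith)

theorem OffSource.trans {p : Path v x} {q : Path x w} (hp : OffSource V p) (hq : OffTarget V q) :
    Off V (p.trans q) := by
  intro t h0 h1
  rcases trans_cases p q t with ⟨s, hs, h⟩ | ⟨s, hs, h⟩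
  · rw [hs]; exact hp s fun e => h0 (h e)
  · rw [hs]; exact hq s fun e => h1 (h e)

theorem OffSource.trans' {p : Path v x} {q : Path x w} (hp : OffSource V p) (hq : ∀ t, q t ∉ V) :
    OffSource V (p.trans q) := by
  intro t h0
  rcases trans_cases p q t with ⟨s, hs, h⟩ | ⟨s, hs, h⟩
  · rw [hs]; exact hp s fun e => h0 (h e)
  · rw [hs]; exact hq s

theorem OffTarget.trans' {p : Path v x} {q : Path x w} (hp : ∀ t, p t ∉ V) (hq : OffTarget V q) :
    OffTarget V (p.trans q) := by
  intro t h0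
  rcases trans_cases p q t with ⟨s, hs, h⟩ | ⟨s, hs, h⟩
  · rw [hs]; exact hp s
  · rw [hs]; exact hq s fun e => h0 (h e)

theorem trans_mem {p : Path v x} {q : Path x w} {U : Set S} (hp : ∀ t, p t ∈ U)
    (hq : ∀ t, q t ∈ U) (t : I) : p.trans q t ∈ U := by
  rcases trans_cases p q t with ⟨s, hs, -⟩ | ⟨s, hs, -⟩
  · rw [hs]; exact hp s
  · rw [hs]; exact hq s

namespace HomOff

theorem refl {p : Path v w} (hp : Off V p) : HomOff V p p :=
  ⟨Path.Homotopy.refl p, fun _ t _ _ h0 h1 => hp t h0 h1⟩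

theorem symm {p q : Path v w} (h : HomOff V p q) : HomOff V q p := by
  obtain ⟨H, hH⟩ := h
  refine ⟨H.symm, fun s t hs0 hs1 h0 h1 => ?_⟩
  have : H.symm (s, t) = H (σ s, t) := rfl
  rw [this]
  exact hH _ _ (by simpa using fun e => hs1 (by simpa using congrArg σ e))
    (by simpa using fun e => hs0 (by simpa using congrArg σ e)) h0 h1

theorem trans {p q r : Path v w} (h : HomOff V p q) (h' : HomOff V q r) (hq : Off V q) :
    HomOff V p r := by
  obtain ⟨H, hH⟩ := h
  obtain ⟨H', hH'⟩ := h'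
  have key : ∀ (K : Path.Homotopy p q), (∀ s t : I, s ≠ 0 → s ≠ 1 → t ≠ 0 → t ≠ 1 → K (s, t) ∉ V) →
      ∀ s t : I, s ≠ 0 → t ≠ 0 → t ≠ 1 → K (s, t) ∉ V := by
    intro K hK s t hs h0 h1
    by_cases h : s = 1
    · rw [h, K.apply_one]; exact hq t h0 h1
    · exact hK s t hs h h0 h1
  have key' : ∀ s t : I, s ≠ 1 → t ≠ 0 → t ≠ 1 → H' (s, t) ∉ V := by
    intro s t hs h0 h1
    by_cases h : s = 0
    · rw [h, H'.apply_zero]; exact hq t h0 h1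
    · exact hH' s t h hs h0 h1
  refine ⟨H.trans H', fun s t hs0 hs1 h0 h1 => ?_⟩
  rw [Path.Homotopy.trans_apply]
  split_ifs with hs
  · refine key H hH _ t (fun e => hs0 ?_) h0 h1
    have := congrArg Subtype.val e
    simp only [Set.Icc.coe_zero] at this
    exact Subtype.ext (by simp only [Set.Icc.coe_zero]; linarith)
  · refine key' _ t (fun e => hs1 ?_) h0 h1
    have := congrArg Subtype.val e
    simp only [Set.Icc.coe_one] at this
    exact Subtype.ext (by simp only [Set.Icc.coe_one]; linarith)

theorem symm₂ {p q : Path v w} (h : HomOff V p q) : HomOff V p.symm q.symm := by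
  obtain ⟨H, hH⟩ := h
  refine ⟨H.symm₂, fun s t hs0 hs1 h0 h1 => ?_⟩
  rw [Path.Homotopy.symm₂_apply]
  exact hH _ _ hs0 hs1 (by simpa using fun e => h1 (by simpa using congrArg σ e))
    (by simpa using fun e => h0 (by simpa using congrArg σ e))

theorem hcomp {p q : Path v x} {p' q' : Path x w} (h : HomOff V p q) (h' : HomOff V p' q')
    (hx : x ∉ V) : HomOff V (p.trans p') (q.trans q') := by
  obtain ⟨H, hH⟩ := h
  obtain ⟨H', hH'⟩ := h'
  refine ⟨H.hcomp H', fun s t hs0 hs1 h0 h1 => ?_⟩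
  rw [Path.Homotopy.hcomp_apply]
  split_ifs with ht
  · change H (s, _) ∉ V
    generalize hr : (⟨2 * (t : ℝ), _⟩ : I) = r
    by_cases h : r = 1
    · rw [h, H.target]; exact hx
    · refine hH s r hs0 hs1 (fun e => h0 ?_) h
      rw [e] at hr
      have := congrArg Subtype.val hr
      simp only [Set.Icc.coe_zero] at this
      exact Subtype.ext (by simp only [Set.Icc.coe_zero]; linarith)
  · change H' (s, _) ∉ V
    generalize hr : (⟨2 * (t : ℝ) - 1, _⟩ : I) = r
    by_cases h : r = 0
    · rw [h, H'.source]; exact hx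
    · refine hH' s r hs0 hs1 h (fun e => h1 ?_)
      rw [e] at hr
      have := congrArg Subtype.val hr
      simp only [Set.Icc.coe_one] at this
      exact Subtype.ext (by simp only [Set.Icc.coe_one]; linarith)

theorem reparam {p : Path v w} (hp : Off V p) (f : I → I) (hf : Continuous f) (hf₀ : f 0 = 0)
    (hf₁ : f 1 = 1) : HomOff V p (p.reparam f hf hf₀ hf₁) := by
  refine ⟨Path.Homotopy.reparam p f hf hf₀ hf₁, fun s t hs0 hs1 h0 h1 => ?_⟩
  have hs0' : (0 : ℝ) < s := unitInterval.pos_iff_ne_zero.2 hs0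
  have hs1' : (s : ℝ) < 1 := unitInterval.lt_one_iff_ne_one.2 hs1
  have h0' : (0 : ℝ) < t := unitInterval.pos_iff_ne_zero.2 h0
  have h1' : (t : ℝ) < 1 := unitInterval.lt_one_iff_ne_one.2 h1
  have hf0 := (f t).2.1
  have hf1 := (f t).2.2
  refine hp _ (fun e => ?_) (fun e => ?_)
  · have := congrArg Subtype.val e
    simp only [unitInterval.coe_symm_eq, Set.Icc.coe_zero] at this
    nlinarith
  · have := congrArg Subtype.val e
    simp only [unitInterval.coe_symm_eq, Set.Icc.coe_one] at this
    nlinarith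

theorem assoc {p : Path v x} {q : Path x y} {r : Path y w} (h : Off V (p.trans (q.trans r))) :
    HomOff V ((p.trans q).trans r) (p.trans (q.trans r)) := by
  rw [Path.Homotopy.trans_assoc_reparam]
  exact (reparam h _ _ _ _).symm

end HomOff

/-- Splitting a curve into three consecutive pieces. -/
theorem homOff_split {f : Path v w} (hf : Off V f) {s s' : I} (A : Path v x) (C : Path x y)
    (B : Path y w) (hA : ∀ t, A t = f (Set.Icc.convexComb 0 s t))
    (hC : ∀ t, C t = f (Set.Icc.convexComb s s' t))
    (hB : ∀ t, B t = f (Set.Icc.convexComb s' 1 t)) :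
    HomOff V f ((A.trans C).trans B) := by
  let P : ∀ a b : I, Path a b := fun a b =>
    { toFun := Set.Icc.convexComb a b
      continuous_toFun := by
        refine Continuous.subtype_mk ?_ _
        fun_prop
      source' := by simp
      target' := by simp }
  let φ : Path (0 : I) 1 := ((P 0 s).trans (P s s')).trans (P s' 1)
  have : (A.trans C).trans B = f.reparam φ φ.continuous φ.source φ.target := by
    ext t
    simp only [Path.coe_reparam, Function.comp_apply, φ, Path.trans_apply]
    split_ifs
    · exact hA _
    · exact hC _
    · exact hB _
  rw [this]
  exact HomOff.reparam hf _ _ _ _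

/-- A neighbourhood `U` of the point `v` in which curves issuing from `v` may be straightened
away from `V`. -/
structure Conical (V U : Set S) (v : S) : Prop where
  cone : ∀ {x : S} (P Q : Path v x), (∀ t, P t ∈ U) → (∀ t, Q t ∈ U) → OffSource V P →
    OffSource V Q → HomOff V P Q
  loop : ∀ P : Path v v, (∀ t, P t ∈ U) → Off V P → HomOff V P (Path.refl v)

theorem OffSource.symm {p : Path v w} (h : OffSource V p) : OffTarget V p.symm :=
  fun t ht => h _ fun e => ht (by simpa using congrArg σ e)

theorem OffTarget.symm {p : Path v w} (h : OffTarget V p) : OffSource V p.symm :=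
  fun t ht => h _ fun e => ht (by simpa using congrArg σ e)

theorem Conical.cone' {U : Set S} (h : Conical V U v) (P Q : Path x v) (hP : ∀ t, P t ∈ U)
    (hQ : ∀ t, Q t ∈ U) (hP' : OffTarget V P) (hQ' : OffTarget V Q) : HomOff V P Q := by
  have := (h.cone P.symm Q.symm (fun t => hP _) (fun t => hQ _) hP'.symm hQ'.symm).symm₂
  simpa using this

variable {Y : Type*} [TopologicalSpace Y]

theorem homOff_map (ι : C(Y, S)) (hι : ∀ y, ι y ∉ V) {a b : Y} {p q : Path a b}
    (h : p.Homotopic q) : HomOff V (p.map ι.continuous) (q.map ι.continuous) := by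
  obtain ⟨H⟩ := h
  exact ⟨H.map ι, fun s t _ _ _ _ => hι _⟩

/-- A curve whose middle part can be deformed into the conical neighbourhood of its
coinciding end points is trivial. -/
theorem homOff_refl_of_middle (ι : C(Y, S)) (hι : ∀ y, ι y ∉ V) {a b : Y} {U : Set S}
    (hU : Conical V U v) {f : Path v v} {A : Path v (ι a)} {γ α : Path a b} {B : Path (ι b) v}
    (hf : HomOff V f ((A.trans (γ.map ι.continuous)).trans B))
    (hA : OffSource V A) (hB : OffTarget V B) (hA' : ∀ t, A t ∈ U) (hB' : ∀ t, B t ∈ U)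
    (hγ : γ.Homotopic α) (hα : ∀ t, ι (α t) ∈ U) : HomOff V f (Path.refl v) := by
  have h0 : ∀ {a b : Y} (p : Path a b) t, p.map ι.continuous t ∉ V := fun p t => hι _
  have hmid : HomOff V ((A.trans (γ.map ι.continuous)).trans B)
      ((A.trans (α.map ι.continuous)).trans B) := by
    refine ((HomOff.refl fun t h _ => hA t h).hcomp (homOff_map ι hι hγ) (hι a)).hcomp
      (HomOff.refl fun t _ h => hB t h) (hι b)
  have hoff : Off V ((A.trans (α.map ι.continuous)).trans B) := (hA.trans' (h0 α)).trans hB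
  refine (hf.trans hmid ((hA.trans' (h0 γ)).trans hB)).trans (hU.loop _ ?_ hoff) hoff
  exact trans_mem (trans_mem hA' hα) hB'

/-- Two curves whose middle parts differ by paths in conical neighbourhoods of the ends
are homotopic. -/
theorem homOff_of_middle (ι : C(Y, S)) (hι : ∀ y, ι y ∉ V) {a b a' b' : Y} {U W : Set S}
    (hU : Conical V U v) (hW : Conical V W w) {f f' : Path v w}
    {A : Path v (ι a)} {γ : Path a b} {B : Path (ι b) w}
    {A' : Path v (ι a')} {γ' : Path a' b'} {B' : Path (ι b') w}
    (hf : HomOff V f ((A.trans (γ.map ι.continuous)).trans B))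
    (hf' : HomOff V f' ((A'.trans (γ'.map ι.continuous)).trans B'))
    (hA : OffSource V A) (hB : OffTarget V B) (hAU : ∀ t, A t ∈ U) (hBW : ∀ t, B t ∈ W)
    (hA' : OffSource V A') (hB' : OffTarget V B') (hAU' : ∀ t, A' t ∈ U) (hBW' : ∀ t, B' t ∈ W)
    {α : Path a' a} {β : Path b b'} (hα : ∀ t, ι (α t) ∈ U) (hβ : ∀ t, ι (β t) ∈ W)
    (h : γ'.Homotopic ((α.trans γ).trans β)) : HomOff V f f' := by
  have h0 : ∀ {a b : Y} (p : Path a b) t, p.map ι.continuous t ∉ V := fun p t => hι _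
  have hr : ∀ {a b : Y} (p : Path a b), HomOff V (p.map ι.continuous) (p.map ι.continuous) :=
    fun p => HomOff.refl fun t _ _ => hι _
  have hBr : HomOff V B' B' := HomOff.refl fun t _ h => hB' t h
  have hAr : HomOff V A' A' := HomOff.refl fun t h _ => hA' t h
  have h1 := (hAr.hcomp (homOff_map ι hι h) (hι a')).hcomp hBr (hι b')
  rw [Path.map_trans, Path.map_trans] at h1
  set γm := γ.map ι.continuous with hγm
  set αm := α.map ι.continuous with hαm
  set βm := β.map ι.continuous with hβm
  have hαm0 : ∀ t, αm t ∉ V := h0 α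
  have hβm0 : ∀ t, βm t ∉ V := h0 β
  have hγm0 : ∀ t, γm t ∉ V := h0 γ
  have hαγ : ∀ t, αm.trans γm t ∉ V := trans_mem (U := Vᶜ) hαm0 hγm0
  have hαγβ : ∀ t, (αm.trans γm).trans βm t ∉ V := trans_mem (U := Vᶜ) hαγ hβm0
  have hββ : OffTarget V (βm.trans B') := OffTarget.trans' hβm0 hB'
  have e2 : HomOff V ((A'.trans ((αm.trans γm).trans βm)).trans B')
      (A'.trans (((αm.trans γm).trans βm).trans B')) :=
    HomOff.assoc (hA'.trans (OffTarget.trans' hαγβ hB'))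
  have e3 : HomOff V (A'.trans (((αm.trans γm).trans βm).trans B'))
      (A'.trans ((αm.trans γm).trans (βm.trans B'))) := by
    refine hAr.hcomp (HomOff.assoc ?_) (hι a')
    exact fun t _ h => OffTarget.trans' hαγ hββ t h
  have e4 : HomOff V (A'.trans ((αm.trans γm).trans (βm.trans B')))
      ((A'.trans (αm.trans γm)).trans (βm.trans B')) :=
    (HomOff.assoc (hA'.trans (OffTarget.trans' hαγ hββ))).symm
  have e5 : HomOff V ((A'.trans (αm.trans γm)).trans (βm.trans B'))
      (((A'.trans αm).trans γm).trans (βm.trans B')) := by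
    refine HomOff.hcomp (HomOff.assoc ?_).symm (HomOff.refl fun t _ h => hββ t h) (hι b)
    exact fun t h _ => hA'.trans' hαγ t h
  have e6 : HomOff V (((A'.trans αm).trans γm).trans (βm.trans B')) ((A.trans γm).trans B) := by
    refine HomOff.hcomp (HomOff.hcomp ?_ (hr γ) (hι a)) ?_ (hι b)
    · exact hU.cone _ _ (trans_mem hAU' hα) hAU (hA'.trans' hαm0) hA
    · exact hW.cone' _ _ (trans_mem hβ hBW') hBW hββ hB
  have o0 := (hA'.trans' (h0 γ')).trans hB'
  have o1 : Off V _ := (hA'.trans' hαγβ).trans hB'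
  have o2 : Off V _ := hA'.trans (OffTarget.trans' hαγβ hB')
  have o3 : Off V _ := hA'.trans (OffTarget.trans' hαγ hββ)
  have o4 : Off V _ := (hA'.trans' hαγ).trans hββ
  have o5 : Off V _ := ((hA'.trans' hαm0).trans' hγm0).trans hββ
  have o6 : Off V _ := (hA.trans' hγm0).trans hB
  exact ((((((((hf'.trans h1 o0).trans e2 o1).trans e3 o2).trans e4 o3).trans e5 o4).trans e6
    o5).trans hf.symm o6)).symm

end SphereCurve

open Filter Topology

section Inversion

variable {E : Type*} [NormedAddCommGroup E] [NormedSpace ℝ E]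

/-- Inversion in the unit sphere. -/
noncomputable def sphereInv (z : E) : E := (‖z‖ ^ 2)⁻¹ • z

theorem norm_sphereInv (z : E) : ‖sphereInv z‖ = ‖z‖⁻¹ := by
  rw [sphereInv, norm_smul, norm_inv, norm_pow, norm_norm]
  by_cases h : ‖z‖ = 0
  · simp [h]
  · field_simp

theorem sphereInv_ne_zero {z : E} (hz : z ≠ 0) : sphereInv z ≠ 0 := by
  rw [← norm_ne_zero_iff, norm_sphereInv]
  exact inv_ne_zero (norm_ne_zero_iff.2 hz)

theorem sphereInv_sphereInv (z : E) : sphereInv (sphereInv z) = z := by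
  by_cases h : ‖z‖ = 0
  · simp [sphereInv, norm_eq_zero.1 h]
  · rw [sphereInv, norm_sphereInv, sphereInv, smul_smul]
    rw [show ((‖z‖⁻¹) ^ 2)⁻¹ * (‖z‖ ^ 2)⁻¹ = 1 by field_simp, one_smul]

theorem continuousAt_sphereInv {z : E} (hz : z ≠ 0) : ContinuousAt (sphereInv (E := E)) z := by
  refine ContinuousAt.smul (ContinuousAt.inv₀ (by fun_prop) ?_) continuousAt_id
  exact pow_ne_zero 2 (norm_ne_zero_iff.2 hz)

open scoped Classical in
/-- Inversion of the one-point compactification, exchanging `0` and `∞`. -/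
noncomputable def onePointInv : OnePoint E → OnePoint E :=
  fun x => OnePoint.elim x ((0 : E) : OnePoint E)
    (fun z : E => if z = 0 then OnePoint.infty else ((sphereInv z : E) : OnePoint E))

theorem onePointInv_infty : onePointInv (OnePoint.infty : OnePoint E) = ((0 : E) : OnePoint E) :=
  rfl

theorem onePointInv_zero : onePointInv ((0 : E) : OnePoint E) = OnePoint.infty := by
  simp [onePointInv]

theorem onePointInv_coe {z : E} (hz : z ≠ 0) :
    onePointInv (z : OnePoint E) = ((sphereInv z : E) : OnePoint E) := by
  simp [onePointInv, hz]

theorem onePointInv_onePointInv (x : OnePoint E) : onePointInv (onePointInv x) = x := by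
  induction x using OnePoint.rec with
  | infty => rw [onePointInv_infty, onePointInv_zero]
  | coe z =>
    by_cases hz : z = 0
    · rw [hz, onePointInv_zero, onePointInv_infty]
    · rw [onePointInv_coe hz, onePointInv_coe (sphereInv_ne_zero hz), sphereInv_sphereInv]

theorem continuous_onePointInv [ProperSpace E] :
    Continuous (onePointInv : OnePoint E → OnePoint E) := by
  have hcc : coclosedCompact E = Bornology.cobounded E := by
    rw [coclosedCompact_eq_cocompact, Metric.cobounded_eq_cocompact]
  rw [OnePoint.continuous_iff]
  constructor
  · have h1 : Tendsto (fun x : E => ((sphereInv x : E) : OnePoint E)) (coclosedCompact E)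
        (𝓝 ((0 : E) : OnePoint E)) := by
      refine (OnePoint.continuous_coe.tendsto 0).comp ?_
      rw [tendsto_zero_iff_norm_tendsto_zero, hcc]
      simp only [norm_sphereInv]
      exact tendsto_inv_atTop_zero.comp tendsto_norm_cobounded_atTop
    refine h1.congr' ?_
    rw [hcc]
    filter_upwards [Metric.cobounded_eq_cocompact (α := E) ▸
      (isCompact_singleton (x := (0 : E))).compl_mem_cocompact] with x hx
    exact (onePointInv_coe hx).symm
  · refine continuous_iff_continuousAt.2 fun x => ?_
    by_cases hx : x = 0
    · subst hx
      rw [continuousAt_iff_punctured_nhds, onePointInv_zero]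
      have h1 : Tendsto (fun x : E => ((sphereInv x : E) : OnePoint E)) (𝓝[≠] 0)
          (𝓝 OnePoint.infty) := by
        refine OnePoint.tendsto_coe_infty.comp ?_
        rw [hcc, ← tendsto_norm_atTop_iff_cobounded]
        simp only [norm_sphereInv]
        refine tendsto_inv_nhdsGT_zero.comp ?_
        refine tendsto_nhdsWithin_iff.2 ⟨?_, ?_⟩
        · exact (tendsto_norm_zero (E := E)).mono_left nhdsWithin_le_nhds
        · filter_upwards [self_mem_nhdsWithin] with x hx
          exact norm_pos_iff.2 hx
      refine h1.congr' ?_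
      filter_upwards [self_mem_nhdsWithin] with x hx
      exact (onePointInv_coe hx).symm
    · have : ContinuousAt (fun x : E => ((sphereInv x : E) : OnePoint E)) x :=
        OnePoint.continuous_coe.continuousAt.comp (continuousAt_sphereInv hx)
      refine this.congr ?_
      filter_upwards [isOpen_ne.mem_nhds hx] with y hy
      exact (onePointInv_coe hy).symm

/-- Inversion of the one-point compactification, exchanging `0` and `∞`. -/
noncomputable def onePointInvHomeo [ProperSpace E] : OnePoint E ≃ₜ OnePoint E where
  toFun := onePointInv
  invFun := onePointInv
  left_inv := onePointInv_onePointInv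
  right_inv := onePointInv_onePointInv
  continuous_toFun := continuous_onePointInv
  continuous_invFun := continuous_onePointInv

end Inversion

namespace SphereCurve

variable {S : Type*} [TopologicalSpace S] {V : Set S}
variable {E : Type*} [NormedAddCommGroup E] [NormedSpace ℝ E]

theorem exists_lift {φ : E → S} (hφ : IsEmbedding φ) {r : ℝ} {x y : S} (P : Path x y)
    (hP : ∀ t, P t ∈ φ '' Metric.ball 0 r) :
    ∃ F : I → E, Continuous F ∧ ∀ t, φ (F t) = P t ∧ ‖F t‖ < r := by
  choose F hF hF' using hP
  refine ⟨F, ?_, fun t => ⟨hF' t, by simpa using hF t⟩⟩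
  rw [hφ.continuous_iff]
  exact P.continuous.congr fun t => (hF' t).symm

/-- The image under a chart of a straight segment issuing from the centre. -/
def radial {φ : E → S} (hφ : Continuous φ) (z : E) : Path (φ 0) (φ z) where
  toFun t := φ ((t : ℝ) • z)
  continuous_toFun := by fun_prop
  source' := by simp
  target' := by simp

theorem continuous_scale {F : I → E} (hF : Continuous F) (hF0 : F 0 = 0) :
    Continuous fun p : I × I => ((p.2 : ℝ) / (max p.1 p.2 : I)) • F (max p.1 p.2) := by
  refine continuous_iff_continuousAt.2 fun p => ?_
  have hm : Continuous fun p : I × I => max p.1 p.2 := continuous_fst.max continuous_snd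
  by_cases h : max p.1 p.2 = 0
  · have h0 : ((p.2 : ℝ) / (max p.1 p.2 : I)) • F (max p.1 p.2) = 0 := by rw [h, hF0, smul_zero]
    rw [ContinuousAt, h0]
    refine squeeze_zero_norm (a := fun p : I × I => ‖F (max p.1 p.2)‖) (fun q => ?_) ?_
    · rw [norm_smul, Real.norm_eq_abs, abs_of_nonneg (div_nonneg q.2.2.1 (max q.1 q.2).2.1)]
      refine mul_le_of_le_one_left (norm_nonneg _) ?_
      exact div_le_one_of_le₀ (le_max_right q.1 q.2) (max q.1 q.2).2.1
    · have : Continuous fun p : I × I => ‖F (max p.1 p.2)‖ := (hF.comp hm).norm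
      have h2 := this.tendsto p
      rwa [h, hF0, norm_zero] at h2
  · refine ContinuousAt.smul (ContinuousAt.div ?_ ?_ ?_) ?_
    · exact (continuous_subtype_val.comp continuous_snd).continuousAt
    · exact (continuous_subtype_val.comp hm).continuousAt
    · exact fun e => h (Subtype.ext e)
    · exact (hF.comp hm).continuousAt

theorem homOff_radial {φ : E → S} (hφ : IsEmbedding φ) {r : ℝ} (h0 : φ 0 ∈ V)
    (hV : ∀ z, z ≠ 0 → ‖z‖ < r → φ z ∉ V) {z : E} (P : Path (φ 0) (φ z))
    (hP : ∀ t, P t ∈ φ '' Metric.ball 0 r) (hoff : OffSource V P) :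
    HomOff V P (radial hφ.continuous z) := by
  obtain ⟨F, hF, hFP⟩ := exists_lift hφ P hP
  have hF0 : F 0 = 0 := hφ.injective (by rw [(hFP 0).1, P.source])
  have hF1 : F 1 = z := hφ.injective (by rw [(hFP 1).1, P.target])
  have hFne : ∀ t, t ≠ 0 → F t ≠ 0 := fun t ht e => hoff t ht (by rwa [← (hFP t).1, e])
  have hm0 : ∀ t : I, max 0 t = t := fun t => max_eq_right t.2.1
  have hm1 : ∀ t : I, max 1 t = 1 := fun t => max_eq_left t.2.2
  refine ⟨{ toFun := fun p => φ (((p.2 : ℝ) / (max p.1 p.2 : I)) • F (max p.1 p.2))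
            continuous_toFun := hφ.continuous.comp (continuous_scale hF hF0)
            map_zero_left := fun t => ?_
            map_one_left := fun t => ?_
            prop' := fun s t ht => ?_ }, fun s t hs0 hs1 ht0 ht1 => ?_⟩
  · change φ (((t : ℝ) / (max 0 t : I)) • F (max 0 t)) = P t
    rw [hm0, ← (hFP t).1]
    by_cases ht : t = 0
    · simp [ht, hF0]
    · rw [div_self (fun e => ht (Subtype.ext e)), one_smul]
  · change φ (((t : ℝ) / (max 1 t : I)) • F (max 1 t)) = φ ((t : ℝ) • z)
    rw [hm1, hF1]; simp
  · change φ (((t : ℝ) / (max s t : I)) • F (max s t)) = P t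
    rcases ht with rfl | ht
    · rw [Set.Icc.coe_zero, zero_div, zero_smul, P.source]
    · rw [Set.mem_singleton_iff.1 ht, max_eq_right (show s ≤ 1 from s.2.2), hF1, P.target]
      simp
  · change φ (((t : ℝ) / (max s t : I)) • F (max s t)) ∉ V
    have htm : t ≤ max s t := le_max_right s t
    have ht0' : (0 : ℝ) < t := unitInterval.pos_iff_ne_zero.2 ht0
    have hm0' : (0 : ℝ) < (max s t : I) := ht0'.trans_le htm
    refine hV _ (smul_ne_zero (div_pos ht0' hm0').ne' (hFne _ ?_)) ?_
    · exact fun e => by simp [e] at hm0'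
    · rw [norm_smul, Real.norm_eq_abs, abs_of_pos (div_pos ht0' hm0')]
      refine lt_of_le_of_lt (mul_le_of_le_one_left (norm_nonneg _) ?_) (hFP _).2
      exact div_le_one_of_le₀ htm hm0'.le

theorem conical_of_chart {φ : E → S} (hφ : IsEmbedding φ) {r : ℝ} (h0 : φ 0 ∈ V)
    (hV : ∀ z, z ≠ 0 → ‖z‖ < r → φ z ∉ V) : Conical V (φ '' Metric.ball 0 r) (φ 0) where
  cone {x} P Q hP hQ hP' hQ' := by
    obtain ⟨z, hz, rfl⟩ : x ∈ φ '' Metric.ball 0 r := by simpa using hP 1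
    refine (homOff_radial hφ h0 hV P hP hP').trans (homOff_radial hφ h0 hV Q hQ hQ').symm ?_
    intro t ht0 ht1
    have ht0' : (0 : ℝ) < t := unitInterval.pos_iff_ne_zero.2 ht0
    have hzne : z ≠ 0 := by
      rintro rfl
      exact hP' 1 one_ne_zero (by rwa [P.target])
    refine hV _ (smul_ne_zero ht0'.ne' hzne) ?_
    rw [norm_smul, Real.norm_eq_abs, abs_of_pos ht0']
    exact lt_of_le_of_lt (mul_le_of_le_one_left (norm_nonneg _) t.2.2) (by simpa using hz)
  loop P hP hoff := by
    obtain ⟨F, hF, hFP⟩ := exists_lift hφ P hP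
    have hF0 : F 0 = 0 := hφ.injective (by rw [(hFP 0).1, P.source])
    have hF1 : F 1 = 0 := hφ.injective (by rw [(hFP 1).1, P.target])
    refine ⟨{ toFun := fun p => φ ((1 - (p.1 : ℝ)) • F p.2)
              continuous_toFun := hφ.continuous.comp (by fun_prop)
              map_zero_left := fun t => ?_
              map_one_left := fun t => ?_
              prop' := fun s t ht => ?_ }, fun s t hs0 hs1 ht0 ht1 => ?_⟩
    · change φ ((1 - ((0 : I) : ℝ)) • F t) = P t
      simp [(hFP t).1]
    · change φ ((1 - ((1 : I) : ℝ)) • F t) = φ 0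
      simp
    · change φ ((1 - (s : ℝ)) • F t) = P t
      rcases ht with rfl | ht
      · rw [hF0, smul_zero, P.source]
      · rw [Set.mem_singleton_iff.1 ht, hF1, smul_zero, P.target]
    · change φ ((1 - (s : ℝ)) • F t) ∉ V
      have hs0' : (0 : ℝ) < s := unitInterval.pos_iff_ne_zero.2 hs0
      have hs1' : (s : ℝ) < 1 := unitInterval.lt_one_iff_ne_one.2 hs1
      have hne : F t ≠ 0 := fun e => hoff t ht0 ht1 (by rwa [← (hFP t).1, e])
      refine hV _ (smul_ne_zero (by linarith) hne) ?_
      rw [norm_smul, Real.norm_eq_abs, abs_of_pos (by linarith)]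
      exact lt_of_le_of_lt (mul_le_of_le_one_left (norm_nonneg _) (by linarith)) (hFP t).2

variable [ProperSpace E]

/-- Balls around a finite vertex are conical. -/
theorem conical_ball {V : Set (OnePoint E)} {u : E} {r : ℝ} (hu : (u : OnePoint E) ∈ V)
    (hV : ∀ z : E, z ≠ u → ‖z - u‖ < r → (z : OnePoint E) ∉ V) :
    Conical V ((↑) '' Metric.ball u r) (u : OnePoint E) := by
  have hφ : IsEmbedding fun z : E => ((u + z : E) : OnePoint E) :=
    OnePoint.isOpenEmbedding_coe.isEmbedding.comp (Homeomorph.addLeft u).isEmbedding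
  have := conical_of_chart (V := V) hφ (r := r) (by simpa using hu)
    (fun z hz hr => hV _ (by simpa using hz) (by simpa using hr))
  have himg : (fun z : E => ((u + z : E) : OnePoint E)) '' Metric.ball 0 r =
      (↑) '' Metric.ball u r := by
    rw [show (fun z : E => ((u + z : E) : OnePoint E)) = (↑) ∘ (fun z : E => u + z) from rfl,
      Set.image_comp]
    congr 1
    simp
  rw [himg] at this
  simpa using this

/-- Complements of large balls are conical neighbourhoods of the vertex at infinity. -/
theorem conical_compl_ball {V : Set (OnePoint E)} {R : ℝ} (hR : 0 < R)
    (hu : OnePoint.infty ∈ V) (hV : ∀ z : E, R < ‖z‖ → (z : OnePoint E) ∉ V) :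
    Conical V (insert OnePoint.infty ((↑) '' {z : E | R < ‖z‖})) OnePoint.infty := by
  have hφ : IsEmbedding fun z : E => onePointInv (z : OnePoint E) :=
    (onePointInvHomeo (E := E)).isEmbedding.comp OnePoint.isOpenEmbedding_coe.isEmbedding
  have key : ∀ z : E, z ≠ 0 → (‖z‖ < R⁻¹ ↔ R < ‖sphereInv z‖) := by
    intro z hz
    rw [norm_sphereInv, lt_inv_comm₀ (norm_pos_iff.2 hz) hR]
  have := conical_of_chart (V := V) hφ (r := R⁻¹) (by simpa [onePointInv_zero] using hu)
    (fun z hz hr => by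
      change onePointInv (z : OnePoint E) ∉ V
      rw [onePointInv_coe hz]; exact hV _ ((key z hz).1 hr))
  have himg : (fun z : E => onePointInv (z : OnePoint E)) '' Metric.ball 0 R⁻¹ =
      insert OnePoint.infty ((↑) '' {z : E | R < ‖z‖}) := by
    ext x
    constructor
    · rintro ⟨z, hz, rfl⟩
      by_cases h : z = 0
      · left; simp only [h, onePointInv_zero]
      · right
        simp only [onePointInv_coe h]
        exact ⟨_, (key z h).1 (by simpa using hz), rfl⟩
    · rintro (rfl | ⟨z, hz, rfl⟩)
      · exact ⟨0, by simpa using hR, onePointInv_zero⟩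
      · have hz0 : z ≠ 0 := by
          rintro rfl
          simp only [Set.mem_ofPred_eq, norm_zero] at hz
          linarith
        refine ⟨sphereInv z, ?_, ?_⟩
        · rw [mem_ball_zero_iff, key _ (sphereInv_ne_zero hz0), sphereInv_sphereInv]
          exact hz
        · simp only [onePointInv_coe (sphereInv_ne_zero hz0), sphereInv_sphereInv]
  rw [himg] at this
  simpa [onePointInv_zero] using this

end SphereCurve

/-- A parallel transport on `Y` which determines paths up to homotopy. -/
structure Holonomy (Y : Type*) [TopologicalSpace Y] (G : Type*) [Group G] where
  hol : ∀ {a b : Y}, Path a b → G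
  hol_trans : ∀ {a b c : Y} (p : Path a b) (q : Path b c), hol (p.trans q) = hol p * hol q
  hol_eq_iff : ∀ {a b : Y} (p q : Path a b), hol p = hol q ↔ p.Homotopic q

theorem exists_holonomy (Y : Type) [TopologicalSpace Y] [PathConnectedSpace Y] :
    ∃ (G : Type) (_ : Group G), Nonempty (Holonomy Y G) := by
  obtain ⟨y₀⟩ := PathConnectedSpace.nonempty (X := Y)
  let conn : ∀ y, FundamentalGroupoid.mk y₀ ⟶ FundamentalGroupoid.mk y :=
    fun y => Path.Homotopic.Quotient.mk (PathConnectedSpace.somePath y₀ y)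
  let cl : ∀ {a b : Y}, Path a b → (FundamentalGroupoid.mk a ⟶ FundamentalGroupoid.mk b) :=
    fun p => Path.Homotopic.Quotient.mk p
  refine ⟨(CategoryTheory.End (FundamentalGroupoid.mk y₀))ᵐᵒᵖ, inferInstance,
    ⟨fun {a b} p => MulOpposite.op (CategoryTheory.CategoryStruct.comp (conn a)
      (CategoryTheory.CategoryStruct.comp (cl p) (CategoryTheory.Groupoid.inv (conn b)))), ?_, ?_⟩⟩
  · intro a b c p q
    rw [← MulOpposite.op_mul]
    congr 1
    rw [CategoryTheory.End.mul_def]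
    have : cl (p.trans q) = CategoryTheory.CategoryStruct.comp (cl p) (cl q) := rfl
    rw [this]
    simp
  · intro a b p q
    rw [← Path.Homotopic.Quotient.eq]
    constructor
    · intro h
      have h1 := MulOpposite.op_injective h
      rw [CategoryTheory.cancel_epi, CategoryTheory.cancel_mono] at h1
      exact h1
    · intro h
      have : cl p = cl q := h
      rw [this]

namespace Holonomy

section
variable {Y : Type*} [TopologicalSpace Y] {G : Type*} [Group G] (Λ : Holonomy Y G)

theorem hol_refl (a : Y) : Λ.hol (Path.refl a) = 1 := by
  have := Λ.hol_trans (Path.refl a) (Path.refl a)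
  rw [(Λ.hol_eq_iff _ _).2 ⟨Path.Homotopy.transRefl (Path.refl a)⟩] at this
  simpa using this

theorem hol_symm {a b : Y} (p : Path a b) : Λ.hol p.symm = (Λ.hol p)⁻¹ := by
  rw [eq_inv_iff_mul_eq_one, ← Λ.hol_trans,
    ← (Λ.hol_eq_iff _ _).2 ⟨Path.Homotopy.reflSymmTrans p⟩, Λ.hol_refl]

end

variable {E : Type*} [NormedAddCommGroup E] [NormedSpace ℝ E] {Z : Set E}
variable {G : Type*} [Group G] (Λ : Holonomy ↥Zᶜ G)

/-- `x` is the holonomy of a path from `a` to `b` inside `W`. -/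
def HolIn (W : Set E) (a b : E) (x : G) : Prop :=
  ∃ (a' b' : ↥Zᶜ) (p : Path a' b'), (a' : E) = a ∧ (b' : E) = b ∧ (∀ t, (p t : E) ∈ W) ∧
    Λ.hol p = x

namespace HolIn

variable {Λ} {W W' C : Set E} {a b c : E} {x y : G}

theorem mono (h : Λ.HolIn W a b x) (hW : W ⊆ W') : Λ.HolIn W' a b x := by
  obtain ⟨a', b', p, ha, hb, hp, hx⟩ := h
  exact ⟨a', b', p, ha, hb, fun t => hW (hp t), hx⟩

theorem trans (h : Λ.HolIn W a b x) (h' : Λ.HolIn W b c y) : Λ.HolIn W a c (x * y) := by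
  obtain ⟨a', b', p, rfl, rfl, hp, rfl⟩ := h
  obtain ⟨b'', c', q, hb, rfl, hq, rfl⟩ := h'
  obtain rfl := Subtype.ext hb
  exact ⟨a', c', p.trans q, rfl, rfl, SphereCurve.trans_mem (U := Subtype.val ⁻¹' W) hp hq,
    Λ.hol_trans _ _⟩

theorem symm (h : Λ.HolIn W a b x) : Λ.HolIn W b a x⁻¹ := by
  obtain ⟨a', b', p, rfl, rfl, hp, rfl⟩ := h
  exact ⟨b', a', p.symm, rfl, rfl, fun t => hp _, Λ.hol_symm p⟩

theorem refl (ha : a ∈ W) (hZ : a ∉ Z) : Λ.HolIn W a a 1 :=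
  ⟨⟨a, hZ⟩, ⟨a, hZ⟩, Path.refl _, rfl, rfl, fun _ => ha, Λ.hol_refl _⟩

theorem left_mem (h : Λ.HolIn W a b x) : a ∈ W := by
  obtain ⟨a', b', p, rfl, rfl, hp, rfl⟩ := h
  simpa using hp 0

theorem right_mem (h : Λ.HolIn W a b x) : b ∈ W := by
  obtain ⟨a', b', p, rfl, rfl, hp, rfl⟩ := h
  simpa using hp 1

theorem eq_of_convex (h : Λ.HolIn C a b x) (h' : Λ.HolIn C a b y) (hC : Convex ℝ C)
    (hCZ : Disjoint C Z) : x = y := by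
  obtain ⟨a', b', p, rfl, rfl, hp, rfl⟩ := h
  obtain ⟨a'', b'', q, ha, hb, hq, rfl⟩ := h'
  obtain rfl := Subtype.ext ha
  obtain rfl := Subtype.ext hb
  rw [Λ.hol_eq_iff]
  have hmem : ∀ s t : I, (1 - (s : ℝ)) • (p t : E) + (s : ℝ) • (q t : E) ∈ C := fun s t =>
    hC (hp t) (hq t) (by linarith [s.2.2]) s.2.1 (by ring)
  refine ⟨{ toFun := fun st => ⟨(1 - (st.1 : ℝ)) • (p st.2 : E) + (st.1 : ℝ) • (q st.2 : E),
              fun hz => Set.disjoint_left.1 hCZ (hmem st.1 st.2) hz⟩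
            continuous_toFun := ?_
            map_zero_left := fun t => ?_
            map_one_left := fun t => ?_
            prop' := fun s t ht => ?_ }⟩
  · refine Continuous.subtype_mk ?_ _
    fun_prop
  · exact Subtype.ext (by simp)
  · exact Subtype.ext (by simp)
  · rcases ht with rfl | ht
    · exact Subtype.ext (by simp [← add_smul])
    · rw [Set.mem_singleton_iff.1 ht]
      exact Subtype.ext (by simp [← add_smul])

theorem of_joinedIn (h : JoinedIn W a b) (hW : Disjoint W Z) : ∃ x, Λ.HolIn W a b x := by
  obtain ⟨p, hp⟩ := h
  have hq : ∀ t, p t ∈ Zᶜ := fun t => Set.disjoint_left.1 hW (hp t)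
  refine ⟨_, ⟨a, by simpa using hq 0⟩, ⟨b, by simpa using hq 1⟩,
    { toFun := fun t => ⟨p t, hq t⟩
      continuous_toFun := p.continuous.subtype_mk _
      source' := Subtype.ext p.source
      target' := Subtype.ext p.target }, rfl, rfl, hp, rfl⟩

end HolIn

open scoped Classical in
/-- The holonomy of the straight segment from `a` to `b`. -/
noncomputable def seg (a b : E) : G :=
  if h : ∃ x, Λ.HolIn (segment ℝ a b) a b x then h.choose else 1

variable {Λ} {C : Set E} {a b c : E} {x : G}

theorem holIn_seg (h : Disjoint (segment ℝ a b) Z) :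
    Λ.HolIn (segment ℝ a b) a b (Λ.seg a b) := by
  have h' : ∃ x, Λ.HolIn (segment ℝ a b) a b x := by
    refine HolIn.of_joinedIn ?_ h
    exact JoinedIn.of_segment_subset subset_rfl
  rw [seg, dif_pos h']
  exact h'.choose_spec

theorem holIn_seg_of_convex (hC : Convex ℝ C) (hCZ : Disjoint C Z) (ha : a ∈ C) (hb : b ∈ C) :
    Λ.HolIn C a b (Λ.seg a b) :=
  (holIn_seg (hCZ.mono_left (hC.segment_subset ha hb))).mono (hC.segment_subset ha hb)

theorem HolIn.eq_seg (h : Λ.HolIn C a b x) (hC : Convex ℝ C) (hCZ : Disjoint C Z) :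
    x = Λ.seg a b :=
  h.eq_of_convex (holIn_seg_of_convex hC hCZ h.left_mem h.right_mem) hC hCZ

theorem seg_mul_seg (hC : Convex ℝ C) (hCZ : Disjoint C Z) (ha : a ∈ C) (hb : b ∈ C)
    (hc : c ∈ C) : Λ.seg a b * Λ.seg b c = Λ.seg a c :=
  ((holIn_seg_of_convex hC hCZ ha hb).trans (holIn_seg_of_convex hC hCZ hb hc)).eq_seg hC hCZ

theorem seg_inv (hC : Convex ℝ C) (hCZ : Disjoint C Z) (ha : a ∈ C) (hb : b ∈ C) :
    (Λ.seg a b)⁻¹ = Λ.seg b a :=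
  (holIn_seg_of_convex hC hCZ ha hb).symm.eq_seg hC hCZ

theorem seg_self (ha : a ∉ Z) : Λ.seg a a = 1 := by
  have h : Disjoint ({a} : Set E) Z := Set.disjoint_singleton_left.2 ha
  exact ((HolIn.refl (Set.mem_singleton a) ha).eq_seg (convex_singleton a) h).symm

theorem holIn_subpath {a b : ↥Zᶜ} (γ : Path a b) {s t : I} {W : Set E}
    (h : ∀ r ∈ Set.uIcc s t, (γ r : E) ∈ W) :
    Λ.HolIn W (γ s) (γ t) (Λ.hol (γ.subpath s t)) := by
  refine ⟨_, _, γ.subpath s t, rfl, rfl, fun r => ?_, rfl⟩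
  refine h _ ?_
  rw [← Path.range_subpathAux s t]
  exact ⟨r, rfl⟩

theorem hol_subpath_mul {Y : Type*} [TopologicalSpace Y] (Λ : Holonomy Y G) {a b : Y}
    (γ : Path a b) (r s t : I) :
    Λ.hol (γ.subpath r s) * Λ.hol (γ.subpath s t) = Λ.hol (γ.subpath r t) := by
  rw [← Λ.hol_trans, Λ.hol_eq_iff]
  exact ⟨Path.Homotopy.subpathTransSubpath γ r s t⟩

end Holonomy

section Annulus

variable {E : Type*} [NormedAddCommGroup E] [NormedSpace ℝ E]

/-- Round annuli are path connected. -/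
theorem isPathConnected_annulus (hE : 1 < Module.rank ℝ E) (u : E) {J : Set ℝ} (hJ : Convex ℝ J)
    (hne : J.Nonempty) (hpos : ∀ r ∈ J, 0 < r) : IsPathConnected {z : E | ‖z - u‖ ∈ J} := by
  have h1 : IsPathConnected (J ×ˢ Metric.sphere (0 : E) 1) :=
    (hJ.isPathConnected hne).prod (isPathConnected_sphere hE 0 zero_le_one)
  have h2 := h1.image (f := fun p : ℝ × E => u + p.1 • p.2) (by fun_prop)
  convert h2 using 1
  ext z
  constructor
  · intro hz
    have h0 := hpos _ hz
    refine ⟨(‖z - u‖, ‖z - u‖⁻¹ • (z - u)), ⟨hz, ?_⟩, ?_⟩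
    · simp [norm_smul, h0.ne']
    · simp [smul_smul, h0.ne']
  · rintro ⟨⟨r, y⟩, ⟨hr, hy⟩, rfl⟩
    have hy : ‖y‖ = 1 := by simpa using hy
    simp only [Set.mem_ofPred_eq, add_sub_cancel_left, norm_smul, hy, mul_one, Real.norm_eq_abs]
    rwa [abs_of_pos (hpos r hr)]

end Annulus

namespace TorusLattice

variable {M : ℕ} [NeZero M] {L ε : ℝ}

/-- The coordinate in the interval `[-L, L]` of an element of `ZMod M`. -/
noncomputable def coord (M : ℕ) (L ε : ℝ) (x : ZMod M) : ℝ := -L + ε * x.val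

/-- The position in the plane of a lattice point. -/
noncomputable def pos (M : ℕ) (L ε : ℝ) (x : ZMod M × ZMod M) : ℝ × ℝ :=
  (coord M L ε x.1, coord M L ε x.2)

theorem coord_add_one (hM : 1 < M) (hε : 0 < ε) (hL : 2 * L ≤ ε * (M - 1)) {x : ZMod M}
    (h : coord M L ε x < L ∨ -L < coord M L ε (x + 1)) :
    coord M L ε (x + 1) = coord M L ε x + ε := by
  have h1 : (x + 1).val = x.val + 1 := by
    rw [val_add_one hM]
    refine if_neg fun h0 => ?_
    rcases h with h | h
    · have : (x.val : ℝ) = M - 1 := by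
        have := congrArg (Nat.cast : ℕ → ℝ) h0
        push_cast at this
        linarith
      rw [coord, this] at h
      linarith
    · have h2 : (x + 1).val = 0 := by rw [val_add_one hM, if_pos h0]
      rw [coord, h2] at h
      simp at h
  rw [coord, coord, h1]
  push_cast
  ring

theorem abs_coord_le (hM : 1 < M) (hε : 0 < ε) (hL : 2 * L ≤ ε * (M - 1)) {x y : ZMod M}
    (hy : y = x ∨ y = x + 1) (h : |coord M L ε x| < L ∨ |coord M L ε y| < L) :
    |coord M L ε x - coord M L ε y| ≤ ε := by
  rcases hy with rfl | rfl
  · simpa using hε.le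
  · rw [coord_add_one hM hε hL (h.imp (fun h => (abs_lt.1 h).2) fun h => (abs_lt.1 h).1)]
    simp [abs_of_pos hε]

/-- The two lattice points are joined by an edge. -/
def Link (M : ℕ) (x y : ZMod M × ZMod M) : Prop :=
  ∃ e, ((complex M).src e = x ∧ (complex M).tgt e = y) ∨
    ((complex M).src e = y ∧ (complex M).tgt e = x)

theorem Link.symm {x y : ZMod M × ZMod M} (h : Link M x y) : Link M y x :=
  h.imp fun _ h => Or.symm h

theorem adj_iff {A B : Set (ZMod M × ZMod M)} :
    (complex M).Adj A B ↔ ∃ a ∈ A, ∃ b ∈ B, Link M a b := by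
  constructor
  · rintro ⟨e, ⟨h, h'⟩ | ⟨h, h'⟩⟩
    · exact ⟨_, h, _, h', e, Or.inl ⟨rfl, rfl⟩⟩
    · exact ⟨_, h', _, h, e, Or.inr ⟨rfl, rfl⟩⟩
  · rintro ⟨a, ha, b, hb, e, ⟨rfl, rfl⟩ | ⟨rfl, rfl⟩⟩
    · exact ⟨e, Or.inl ⟨ha, hb⟩⟩
    · exact ⟨e, Or.inr ⟨hb, ha⟩⟩

theorem dist_pos_src_tgt (hM : 1 < M) (hε : 0 < ε) (hL : 2 * L ≤ ε * (M - 1)) (e)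
    (h : ‖pos M L ε ((complex M).src e)‖ < L ∨ ‖pos M L ε ((complex M).tgt e)‖ < L) :
    dist (pos M L ε ((complex M).src e)) (pos M L ε ((complex M).tgt e)) ≤ ε := by
  obtain ⟨i, x⟩ := e
  have hn : ∀ x, ‖pos M L ε x‖ < L → |coord M L ε x.1| < L ∧ |coord M L ε x.2| < L := by
    intro x hx
    simpa [Prod.norm_def, pos] using hx
  have h1 := h.imp (fun h => (hn _ h).1) fun h => (hn _ h).1
  have h2 := h.imp (fun h => (hn _ h).2) fun h => (hn _ h).2
  rw [Prod.dist_eq, max_le_iff, Real.dist_eq, Real.dist_eq]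
  refine ⟨abs_coord_le hM hε hL ?_ h1, abs_coord_le hM hε hL ?_ h2⟩ <;>
  · fin_cases i <;> simp [complex, dir]

theorem Link.dist_pos (hM : 1 < M) (hε : 0 < ε) (hL : 2 * L ≤ ε * (M - 1))
    {x y : ZMod M × ZMod M} (hl : Link M x y) (h : ‖pos M L ε x‖ < L ∨ ‖pos M L ε y‖ < L) :
    dist (pos M L ε x) (pos M L ε y) ≤ ε := by
  obtain ⟨e, ⟨rfl, rfl⟩ | ⟨rfl, rfl⟩⟩ := hl
  · exact dist_pos_src_tgt hM hε hL e h
  · rw [dist_comm]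
    exact dist_pos_src_tgt hM hε hL e h.symm

/-- The vertices of a triangle are pairwise equal or linked. -/
theorem link_va_vb (t) : Link M ((complex M).va t) ((complex M).vb t) :=
  ⟨_, Or.inl ⟨(complex M).src_d2 t, (complex M).tgt_d2 t⟩⟩

theorem link_va_vc (t) : Link M ((complex M).va t) ((complex M).vc t) :=
  ⟨_, Or.inl ⟨(complex M).src_d1 t, (complex M).tgt_d1 t⟩⟩

theorem link_vb_vc (t) : Link M ((complex M).vb t) ((complex M).vc t) :=
  ⟨_, Or.inl ⟨(complex M).src_d0 t, (complex M).tgt_d0 t⟩⟩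

/-- The lattice coordinate just below a real number. -/
noncomputable def idx (M : ℕ) (L ε : ℝ) (x : ℝ) : ZMod M := (⌊(x + L) / ε⌋₊ : ℕ)

theorem val_idx (hε : 0 < ε) (hL : 2 * L ≤ ε * (M - 1)) {x : ℝ} (hx : |x| ≤ L) :
    (idx M L ε x).val = ⌊(x + L) / ε⌋₊ := by
  refine ZMod.val_cast_of_lt ?_
  have hx := abs_le.1 hx
  rw [Nat.floor_lt (div_nonneg (by linarith) hε.le), div_lt_iff₀ hε]
  nlinarith

theorem abs_coord_idx_le (hε : 0 < ε) (hL : 2 * L ≤ ε * (M - 1)) {x : ℝ} (hx : |x| ≤ L) :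
    |coord M L ε (idx M L ε x) - x| ≤ ε := by
  rw [coord, val_idx hε hL hx]
  have hx := abs_le.1 hx
  have h1 := Nat.floor_le (show 0 ≤ (x + L) / ε from div_nonneg (by linarith) hε.le)
  have h2 := Nat.lt_floor_add_one ((x + L) / ε)
  rw [le_div_iff₀ hε] at h1
  rw [div_lt_iff₀ hε] at h2
  rw [abs_le]
  constructor <;> nlinarith

theorem idx_succ (hε : 0 < ε) {x y : ℝ} (hx : |x| ≤ L) (hy : |y| ≤ L)
    (hxy : |x - y| ≤ ε) :
    idx M L ε y = idx M L ε x ∨ idx M L ε y = idx M L ε x + 1 ∨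
      idx M L ε x = idx M L ε y + 1 := by
  have key : ∀ x y : ℝ, |x| ≤ L → |x - y| ≤ ε → ⌊(y + L) / ε⌋₊ ≤ ⌊(x + L) / ε⌋₊ + 1 := by
    intro x y hx hxy
    have hx := abs_le.1 hx
    rw [← Nat.floor_add_one (div_nonneg (by linarith) hε.le)]
    refine Nat.floor_le_floor ?_
    rw [div_add_one hε.ne', div_le_div_iff_of_pos_right hε]
    linarith [(abs_le.1 hxy).1]
  have h1 := key x y hx hxy
  have h2 := key y x hy (by rwa [abs_sub_comm])
  unfold idx
  rcases (by omega : ⌊(y + L) / ε⌋₊ = ⌊(x + L) / ε⌋₊ ∨ ⌊(y + L) / ε⌋₊ = ⌊(x + L) / ε⌋₊ + 1 ∨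
    ⌊(x + L) / ε⌋₊ = ⌊(y + L) / ε⌋₊ + 1) with h | h | h
  · exact Or.inl (by rw [h])
  · exact Or.inr (Or.inl (by rw [h]; push_cast; rfl))
  · exact Or.inr (Or.inr (by rw [h]; push_cast; rfl))

theorem link_of_snd {a b c : ZMod M} (h : c = b ∨ c = b + 1 ∨ b = c + 1) :
    (a, c) = (a, b) ∨ Link M (a, b) (a, c) := by
  rcases h with rfl | rfl | rfl
  · exact Or.inl rfl
  · exact Or.inr ⟨(1, (a, b)), Or.inl ⟨rfl, by simp [complex, dir]⟩⟩
  · exact Or.inr ⟨(1, (a, c)), Or.inr ⟨rfl, by simp [complex, dir]⟩⟩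

theorem link_of_fst {a b c : ZMod M} (h : b = a ∨ b = a + 1 ∨ a = b + 1) :
    (b, c) = (a, c) ∨ Link M (a, c) (b, c) := by
  rcases h with rfl | rfl | rfl
  · exact Or.inl rfl
  · exact Or.inr ⟨(0, (a, c)), Or.inl ⟨rfl, by simp [complex, dir]⟩⟩
  · exact Or.inr ⟨(0, (b, c)), Or.inr ⟨rfl, by simp [complex, dir]⟩⟩

/-- Approximation of a plane curve by a lattice walk. -/
theorem exists_walk (hε : 0 < ε) (hL : 2 * L ≤ ε * (M - 1)) {γ : I → ℝ × ℝ}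
    (hγ : Continuous γ) (hb : ∀ t, ‖γ t‖ ≤ L) :
    ∃ (n₀ : ℕ) (τ : ℕ → I) (z : ℕ → ZMod M × ZMod M), Monotone τ ∧ τ 0 = 0 ∧ τ n₀ = 1 ∧
      (∀ n, dist (pos M L ε (z n)) (γ (τ n)) ≤ 2 * ε) ∧
      (∀ n t, τ n ≤ t → t ≤ τ (n + 1) → dist (γ t) (γ (τ n)) ≤ ε) ∧
      ∀ n, z (n + 1) = z n ∨ Link M (z n) (z (n + 1)) := by
  obtain ⟨δ, hδ, hu⟩ := Metric.uniformContinuous_iff.1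
    (CompactSpace.uniformContinuous_of_continuous hγ) ε hε
  obtain ⟨N, hN⟩ := exists_nat_gt δ⁻¹
  have hN0 : (0 : ℝ) < N := (inv_pos.2 hδ).trans hN
  let A : ℕ → I := fun k => Set.projIcc 0 1 zero_le_one ((k : ℝ) / N)
  have hA : Monotone A := fun i j hij => Set.monotone_projIcc _ (by gcongr)
  have hA1 : ∀ k, (A (k + 1) : ℝ) ≤ A k + 1 / N := by
    intro k
    simp only [A, Set.coe_projIcc]
    push_cast
    rw [add_div]
    have h1 : (0 : ℝ) ≤ 1 / N := by positivity
    have h2 : (0 : ℝ) ≤ k / N := by positivity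
    refine max_le (by positivity) ?_
    rw [max_eq_right (le_min zero_le_one h2)]
    rcases le_total 1 ((k : ℝ) / N) with h | h
    · rw [min_eq_left h]
      exact (min_le_left _ _).trans (by linarith)
    · rw [min_eq_right h]
      exact min_le_right _ _
  have hstep : ∀ k t, A k ≤ t → t ≤ A (k + 1) → dist (γ t) (γ (A k)) < ε := by
    intro k t h1 h2
    refine hu ?_
    have h1' : (A k : ℝ) ≤ t := h1
    have h2' : (t : ℝ) ≤ A (k + 1) := h2
    rw [Subtype.dist_eq, Real.dist_eq, abs_of_nonneg (by linarith)]
    have := hA1 k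
    have h3 : 1 / (N : ℝ) < δ := by
      rw [one_div]
      exact inv_lt_of_inv_lt₀ hδ hN
    linarith
  have hc : ∀ x : ℝ × ℝ, ∀ c, ‖x‖ ≤ c → |x.1| ≤ c ∧ |x.2| ≤ c := by
    intro x c hx
    simpa [Prod.norm_def] using hx
  have hb1 : ∀ t, |(γ t).1| ≤ L := fun t => (hc _ _ (hb t)).1
  have hb2 : ∀ t, |(γ t).2| ≤ L := fun t => (hc _ _ (hb t)).2
  have hstep' : ∀ k, |(γ (A (k + 1))).1 - (γ (A k)).1| ≤ ε ∧
      |(γ (A (k + 1))).2 - (γ (A k)).2| ≤ ε := by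
    intro k
    have := hstep k _ (hA (Nat.le_succ k)) le_rfl
    rw [dist_eq_norm] at this
    exact hc _ _ this.le
  refine ⟨2 * N, fun n => A (n / 2), fun n => (idx M L ε (γ (A (n / 2))).1,
    idx M L ε (γ (A ((n + 1) / 2))).2), fun i j hij => hA (Nat.div_le_div_right hij), ?_, ?_, ?_,
    ?_, ?_⟩
  · simp [A]
  · simp [A, hN0.ne']
  · intro n
    rw [Prod.dist_eq, max_le_iff, Real.dist_eq, Real.dist_eq]
    have h1 := abs_coord_idx_le (M := M) hε hL (hb1 (A (n / 2)))
    have h2 := abs_coord_idx_le (M := M) hε hL (hb2 (A ((n + 1) / 2)))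
    refine ⟨h1.trans (by linarith), ?_⟩
    change |coord M L ε (idx M L ε (γ (A ((n + 1) / 2))).2) - (γ (A (n / 2))).2| ≤ 2 * ε
    rcases Nat.even_or_odd' n with ⟨k, rfl | rfl⟩
    · simp only [show (2 * k + 1) / 2 = k by omega, show 2 * k / 2 = k by omega] at h2 ⊢
      exact h2.trans (by linarith)
    · simp only [show (2 * k + 1 + 1) / 2 = k + 1 by omega,
        show (2 * k + 1) / 2 = k by omega] at h2 ⊢
      calc _ ≤ _ := abs_sub_le _ (γ (A (k + 1))).2 _
        _ ≤ ε + ε := add_le_add h2 (hstep' k).2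
        _ = 2 * ε := by ring
  · intro n t h1 h2
    rcases Nat.even_or_odd' n with ⟨k, rfl | rfl⟩
    · simp only [show (2 * k + 1) / 2 = 2 * k / 2 by omega] at h2
      rw [le_antisymm h2 h1, dist_self]
      exact hε.le
    · simp only [show (2 * k + 1) / 2 = k by omega, show (2 * k + 1 + 1) / 2 = k + 1 by omega]
        at h1 h2 ⊢
      exact (hstep k t h1 h2).le
  · intro n
    rcases Nat.even_or_odd' n with ⟨k, rfl | rfl⟩
    · simp only [show (2 * k + 1 + 1) / 2 = k + 1 by omega, show (2 * k + 1) / 2 = k by omega,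
        show 2 * k / 2 = k by omega]
      refine link_of_snd ?_
      have := idx_succ (M := M) hε (hb2 (A k)) (hb2 (A (k + 1)))
        (by rw [abs_sub_comm]; exact (hstep' k).2)
      exact this
    · simp only [show (2 * k + 1 + 1) / 2 = k + 1 by omega, show (2 * k + 1) / 2 = k by omega,
        show (2 * k + 1 + 1 + 1) / 2 = k + 1 by omega]
      refine link_of_fst ?_
      have := idx_succ (M := M) hε (hb1 (A k)) (hb1 (A (k + 1)))
        (by rw [abs_sub_comm]; exact (hstep' k).1)
      exact this

end TorusLattice

open TorusLattice

/-- A neighbourhood `K u` of each puncture, with a collar `W u`, at the scale of a lattice of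
mesh `ε`. -/
structure PlanarSetup (M : ℕ) (L ε : ℝ) (Z : Set (ℝ × ℝ)) {ι : Type*} (K W : ι → Set (ℝ × ℝ))
    (o : ι) : Prop where
  one_lt : 1 < M
  eps_pos : 0 < ε
  two_mul_le : 2 * L ≤ ε * (M - 1)
  sep : ∀ u w, u ≠ w → ∀ a ∈ K u, ∀ b ∈ K w, 10 * ε < dist a b
  disjoint_W : ∀ u, Disjoint (W u) Z
  conn_W : ∀ u, IsPathConnected (W u)
  far : ∀ z, (∀ u, z ∉ K u) → Disjoint (Metric.closedBall z (8 * ε)) Z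
  near : ∀ z, (∀ u, z ∉ K u) → ∀ u, ∀ a ∈ K u, dist z a ≤ 2 * ε →
    Metric.closedBall z (8 * ε) ⊆ W u
  norm_lt : ∀ z, z ∉ K o → ‖z‖ < L
  box : ∀ u, ∃ a b c d, 0 < a ∧ a + 1 < b ∧ b < M ∧ 0 < c ∧ c + 1 < d ∧ d < M ∧
    (u ≠ o → pos M L ε ⁻¹' K u = box M a b c d) ∧ (u = o → pos M L ε ⁻¹' K u = (box M a b c d)ᶜ)

namespace PlanarSetup

variable {M : ℕ} {L ε : ℝ} {Z : Set (ℝ × ℝ)} {ι : Type*} {K W : ι → Set (ℝ × ℝ)} {o : ι}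

theorem notMem_of_mem (P : PlanarSetup M L ε Z K W o) {x : ℝ × ℝ} {u w : ι} (h : x ∈ K u)
    (hw : w ≠ u) : x ∉ K w := fun h' => by
  have := P.sep _ _ hw x h' x h
  rw [dist_self] at this
  linarith [P.eps_pos]

/-- The lattice point lies in the region of `u` or is linked to it. -/
def Near (M : ℕ) [NeZero M] (L ε : ℝ) (K : ι → Set (ℝ × ℝ)) (u : ι) (x : ZMod M × ZMod M) : Prop :=
  ∃ y, pos M L ε y ∈ K u ∧ (y = x ∨ Link M x y)

theorem near_of_mem [NeZero M] {u : ι} {x : ZMod M × ZMod M} (h : pos M L ε x ∈ K u) : Near M L ε K u x :=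
  ⟨x, h, Or.inl rfl⟩

theorem near_of_link [NeZero M] {u : ι} {x y : ZMod M × ZMod M} (h : pos M L ε x ∈ K u)
    (hl : y = x ∨ Link M x y) : Near M L ε K u y :=
  ⟨x, h, hl.imp Eq.symm Link.symm⟩

variable [NeZero M]

theorem exists_dist_le_of_near (P : PlanarSetup M L ε Z K W o) {u : ι} {x : ZMod M × ZMod M}
    (h : Near M L ε K u x) : ∃ a ∈ K u, dist (pos M L ε x) a ≤ ε := by
  obtain ⟨y, hy, rfl | hl⟩ := h
  · exact ⟨_, hy, by simpa using P.eps_pos.le⟩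
  by_cases hx : pos M L ε x ∈ K u
  · exact ⟨_, hx, by simpa using P.eps_pos.le⟩
  refine ⟨_, hy, hl.dist_pos P.one_lt P.eps_pos P.two_mul_le ?_⟩
  by_cases hu : u = o
  · exact Or.inl (P.norm_lt _ (hu ▸ hx))
  · exact Or.inr (P.norm_lt _ (P.notMem_of_mem hy (Ne.symm hu)))

theorem dist_pos_le (P : PlanarSetup M L ε Z K W o) {x y : ZMod M × ZMod M} (hl : Link M x y)
    (hx : ∀ w, pos M L ε x ∉ K w) : dist (pos M L ε x) (pos M L ε y) ≤ ε :=
  hl.dist_pos P.one_lt P.eps_pos P.two_mul_le (Or.inl (P.norm_lt _ (hx o)))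

theorem closedBall_subset (P : PlanarSetup M L ε Z K W o) {u : ι} {x : ZMod M × ZMod M}
    (hx : ∀ w, pos M L ε x ∉ K w) (h : Near M L ε K u x) :
    Metric.closedBall (pos M L ε x) (8 * ε) ⊆ W u := by
  obtain ⟨a, ha, hd⟩ := P.exists_dist_le_of_near h
  exact P.near _ hx u a ha (by linarith [P.eps_pos])

end PlanarSetup

/-- A curve in the complement of the punctures, from `K s` to `K e`, at the scale `ε`. -/
structure PlanarCurve (L ε : ℝ) {ι : Type*} (K W : ι → Set (ℝ × ℝ)) (γ : I → ℝ × ℝ)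
    (s e : ι) (T₁ T₂ : I) : Prop where
  continuous : Continuous γ
  lt : T₁ < T₂
  source : Metric.closedBall (γ 0) (2 * ε) ⊆ K s
  target : Metric.closedBall (γ 1) (2 * ε) ⊆ K e
  left : ∀ t ≤ T₁, γ t ∈ W s
  right : ∀ t, T₂ ≤ t → γ t ∈ W e
  left_far : ∀ t ≤ T₁, ∀ w ≠ s, ∀ a ∈ K w, 5 * ε < dist (γ t) a
  right_far : ∀ t, T₂ ≤ t → ∀ w ≠ e, ∀ a ∈ K w, 5 * ε < dist (γ t) a
  mid_far : ∀ t, T₁ ≤ t → t ≤ T₂ → ∀ w, ∀ a ∈ K w, 5 * ε < dist (γ t) a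
  norm_le : ∀ t, ‖γ t‖ ≤ L

namespace PlanarSetup

variable {M : ℕ} {L ε : ℝ} {Z : Set (ℝ × ℝ)} {ι : Type*} {K W : ι → Set (ℝ × ℝ)} {o : ι}

theorem conn_image_Icc [NeZero M] {z : ℕ → ZMod M × ZMod M} {i j : ℕ}
    (hz : ∀ n, z (n + 1) = z n ∨ Link M (z n) (z (n + 1))) :
    (complex M).Conn (z '' Set.Icc i j) := by
  rintro B hB ⟨b, hb⟩ hne
  by_contra! hcon
  obtain ⟨n₀, hn₀, rfl⟩ := hB hb
  have step : ∀ n, i ≤ n → n + 1 ≤ j → (z n ∈ B ↔ z (n + 1) ∈ B) := by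
    intro n h1 h2
    have m1 : z n ∈ z '' Set.Icc i j := ⟨n, ⟨h1, by omega⟩, rfl⟩
    have m2 : z (n + 1) ∈ z '' Set.Icc i j := ⟨n + 1, ⟨by omega, h2⟩, rfl⟩
    rcases hz n with h | ⟨e, ⟨h, h'⟩ | ⟨h, h'⟩⟩
    · rw [h]
    · have := hcon e ⟨h ▸ m1, h' ▸ m2⟩
      rw [TriComplex.Cut, h, h', not_not] at this
      exact this
    · have := hcon e ⟨h ▸ m2, h' ▸ m1⟩
      rw [TriComplex.Cut, h, h', not_not] at this
      exact this.symm
  have all : ∀ d, i + d ≤ j → (z i ∈ B ↔ z (i + d) ∈ B) := by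
    intro d
    induction d with
    | zero => simp
    | succ d ih => exact fun h => (ih (by omega)).trans (step (i + d) (by omega) h)
  have all' : ∀ n, i ≤ n → n ≤ j → (z i ∈ B ↔ z n ∈ B) := fun n h1 h2 => by
    have := all (n - i) (by omega)
    rwa [show i + (n - i) = n by omega] at this
  refine hne (hB.antisymm ?_)
  rintro _ ⟨n, hn, rfl⟩
  exact (all' n hn.1 hn.2).1 ((all' n₀ hn₀.1 hn₀.2).2 hb)

variable {G : Type*} [Group G] {Λ : Holonomy ↥Zᶜ G}

/-- The portion of the approximating walk between its last visit near the start of the curve and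
the next visit near its end. -/
theorem exists_trim [NeZero M] (P : PlanarSetup M L ε Z K W o) {γ : I → ℝ × ℝ} {s e : ι}
    {T₁ T₂ : I} (C : PlanarCurve L ε K W γ s e T₁ T₂) {n₀ : ℕ} {τ : ℕ → I}
    {z : ℕ → ZMod M × ZMod M} (hτ : Monotone τ) (hτ0 : τ 0 = 0) (hτ1 : τ n₀ = 1)
    (hd : ∀ n, dist (pos M L ε (z n)) (γ (τ n)) ≤ 2 * ε)
    (hs : ∀ n t, τ n ≤ t → t ≤ τ (n + 1) → dist (γ t) (γ (τ n)) ≤ ε)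
    (hz : ∀ n, z (n + 1) = z n ∨ Link M (z n) (z (n + 1))) :
    ∃ i j, i < j ∧ τ i ≤ T₁ ∧ T₂ ≤ τ j ∧ Near M L ε K s (z i) ∧ Near M L ε K e (z j) ∧
      (∀ n, i ≤ n → n ≤ j → ∀ w, pos M L ε (z n) ∉ K w) ∧
      (∀ n, i ≤ n → n ≤ j → ∀ w, Near M L ε K w (z n) → n = i ∧ w = s ∨ n = j ∧ w = e) := by
  classical
  have hε := P.eps_pos
  have near_dist : ∀ n w, Near M L ε K w (z n) → ∃ a ∈ K w, dist (γ (τ n)) a ≤ 3 * ε := by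
    intro n w h
    obtain ⟨a, ha, h'⟩ := P.exists_dist_le_of_near h
    refine ⟨a, ha, (dist_triangle_left _ _ (pos M L ε (z n))).trans ?_⟩
    linarith [hd n]
  have hleft : ∀ n w, τ n ≤ T₁ → Near M L ε K w (z n) → w = s := by
    intro n w h h'
    by_contra hw
    obtain ⟨a, ha, h2⟩ := near_dist n w h'
    linarith [C.left_far _ h w hw a ha]
  have hright : ∀ n w, T₂ ≤ τ n → Near M L ε K w (z n) → w = e := by
    intro n w h h'
    by_contra hw
    obtain ⟨a, ha, h2⟩ := near_dist n w h'
    linarith [C.right_far _ h w hw a ha]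
  have hmid : ∀ n w, T₁ ≤ τ n → τ n ≤ T₂ → ¬ Near M L ε K w (z n) := by
    intro n w h1 h2 h'
    obtain ⟨a, ha, h3⟩ := near_dist n w h'
    linarith [C.mid_far _ h1 h2 w a ha]
  let p : ℕ → Prop := fun n => τ n ≤ T₁ ∧ Near M L ε K s (z n)
  let q : ℕ → Prop := fun n => T₂ ≤ τ n ∧ Near M L ε K e (z n)
  have hp0 : p 0 := by
    refine ⟨hτ0 ▸ unitInterval.nonneg', near_of_mem (C.source ?_)⟩
    rw [Metric.mem_closedBall, ← hτ0]
    exact hd 0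
  have hqn : q n₀ := by
    refine ⟨hτ1 ▸ unitInterval.le_one', near_of_mem (C.target ?_)⟩
    rw [Metric.mem_closedBall, ← hτ1]
    exact hd n₀
  have hq : ∃ n, q n := ⟨n₀, hqn⟩
  set j := Nat.find hq with hj
  have hqj : q j := Nat.find_spec hq
  have hjmin : ∀ n, q n → j ≤ n := fun n hn => Nat.find_min' hq hn
  set i := Nat.findGreatest p j with hi
  have hpi : p i := Nat.findGreatest_spec (Nat.zero_le _) hp0
  have himax : ∀ n, n ≤ j → p n → n ≤ i := fun n hn h => Nat.le_findGreatest hn h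
  have hij : i < j := by
    by_contra! h
    exact absurd ((hqj.1.trans (hτ h)).trans hpi.1) (not_le.2 C.lt)
  have hnear : ∀ n, i ≤ n → n ≤ j → ∀ w, Near M L ε K w (z n) → n = i ∧ w = s ∨ n = j ∧ w = e := by
    intro n h1 h2 w hw
    rcases le_total (τ n) T₁ with h | h
    · obtain rfl := hleft n w h hw
      exact Or.inl ⟨le_antisymm (himax n h2 ⟨h, hw⟩) h1, rfl⟩
    rcases le_total (τ n) T₂ with h' | h'
    · exact absurd hw (hmid n w h h')
    · obtain rfl := hright n w h' hw
      exact Or.inr ⟨le_antisymm h2 (hjmin n ⟨h', hw⟩), rfl⟩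
  refine ⟨i, j, hij, hpi.1, hqj.1, hpi.2, hqj.2, ?_, hnear⟩
  intro n h1 h2 w hw
  rcases hnear n h1 h2 w (near_of_mem hw) with ⟨rfl, rfl⟩ | ⟨rfl, rfl⟩
  · have h3 : τ (i + 1) ≤ T₁ := by
      by_contra! h
      obtain ⟨a, ha, h'⟩ := near_dist i _ hpi.2
      have h4 := C.mid_far T₁ le_rfl C.lt.le _ a ha
      linarith [hs i T₁ hpi.1 h.le, dist_triangle (γ T₁) (γ (τ i)) a]
    have := himax (i + 1) hij ⟨h3, near_of_link hw (hz i)⟩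
    omega
  · obtain ⟨k, hk⟩ : ∃ k, j = k + 1 := ⟨j - 1, by omega⟩
    have h3 : T₂ ≤ τ k := by
      by_contra! h
      obtain ⟨a, ha, h'⟩ := near_dist j _ hqj.2
      have h4 := C.mid_far T₂ C.lt.le le_rfl _ a ha
      have h5 := hs k T₂ h.le (hk ▸ hqj.1)
      have h6 := hs k (τ (k + 1)) (hτ (Nat.le_succ k)) le_rfl
      rw [← hk] at h6
      have h7 := dist_triangle (γ T₂) (γ (τ k)) a
      have h8 := dist_triangle_left (γ (τ k)) a (γ (τ j))
      linarith
    have := hjmin k ⟨h3, near_of_link (x := z (k + 1)) (by rw [← hk]; exact hw) ?_⟩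
    · omega
    · exact (hz k).imp Eq.symm Link.symm

end PlanarSetup

open TorusLattice

theorem Holonomy.hol_subpath_zero_one {Y G : Type*} [TopologicalSpace Y] [Group G]
    (Λ : Holonomy Y G) {a b : Y} (γ : Path a b) : Λ.hol (γ.subpath 0 1) = Λ.hol γ := by
  have h : ∀ {a' b' : Y} (ha : a' = a) (hb : b' = b), Λ.hol (γ.cast ha hb) = Λ.hol γ := by
    rintro _ _ rfl rfl
    rfl
  rw [Path.subpath_zero_one]
  exact h _ _

namespace PlanarSetup

variable {M : ℕ} {L ε : ℝ} {Z : Set (ℝ × ℝ)} {ι : Type*} {K W : ι → Set (ℝ × ℝ)} {o : ι}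
  {G : Type*} [Group G] {Λ : Holonomy ↥Zᶜ G}

theorem exists_walk [NeZero M] (P : PlanarSetup M L ε Z K W o) {a b : ↥Zᶜ} (γ : Path a b) {s e : ι}
    {T₁ T₂ : I} (C : PlanarCurve L ε K W (fun t => (γ t : ℝ × ℝ)) s e T₁ T₂) :
    ∃ (N : Set (ZMod M × ZMod M)) (p q : ZMod M × ZMod M) (k A B : G),
      p ∈ N ∧ (complex M).IsWalk (fun x y => Λ.seg (pos M L ε x) (pos M L ε y)) N p q k ∧
      (complex M).Conn N ∧ (∀ x ∈ N, ∀ w, pos M L ε x ∉ K w) ∧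
      (∀ x ∈ N, ∃ t, dist (pos M L ε x) (γ t) ≤ 2 * ε) ∧
      Near M L ε K s p ∧ Near M L ε K e q ∧
      (∀ x ∈ N, ∀ w, Near M L ε K w x → x = p ∧ w = s ∨ x = q ∧ w = e) ∧
      Λ.HolIn (W s) a (pos M L ε p) A ∧ Λ.HolIn (W e) (pos M L ε q) b B ∧
      Λ.hol γ = A * k * B := by
  obtain ⟨n₀, τ, z, hτ, hτ0, hτ1, hd, hs, hz⟩ :=
    TorusLattice.exists_walk P.eps_pos P.two_mul_le C.continuous C.norm_le
  obtain ⟨i, j, hij, hi, hj, hpi, hqj, hout, hnear⟩ := P.exists_trim C hτ hτ0 hτ1 hd hs hz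
  have hε := P.eps_pos
  set N := z '' Set.Icc i j with hN
  have hmem : ∀ n, i ≤ n → n ≤ j → z n ∈ N := fun n h1 h2 => ⟨n, ⟨h1, h2⟩, rfl⟩
  have hball : ∀ n, i ≤ n → n ≤ j → Disjoint (Metric.closedBall (pos M L ε (z n)) (8 * ε)) Z :=
    fun n h1 h2 => P.far _ (hout n h1 h2)
  have hcen : ∀ x : ℝ × ℝ, x ∈ Metric.closedBall x (8 * ε) :=
    fun x => Metric.mem_closedBall_self (by linarith)
  have hγz : ∀ n, (γ (τ n) : ℝ × ℝ) ∈ Metric.closedBall (pos M L ε (z n)) (8 * ε) := fun n => by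
    rw [Metric.mem_closedBall']
    linarith [hd n]
  have key : ∀ n, i ≤ n → n ≤ j → ∃ k,
      (complex M).IsWalk (fun x y => Λ.seg (pos M L ε x) (pos M L ε y)) N (z i) (z n) k ∧
      Λ.hol (γ.subpath (τ i) (τ n)) =
        Λ.seg (γ (τ i)) (pos M L ε (z i)) * k * Λ.seg (pos M L ε (z n)) (γ (τ n)) := by
    intro n hin
    induction n, hin using Nat.le_induction with
    | base =>
      intro _
      refine ⟨1, .refl _ (hmem i le_rfl hij.le), ?_⟩
      rw [mul_one, Holonomy.seg_mul_seg (convex_closedBall _ _) (hball i le_rfl hij.le) (hγz i)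
        (hcen _) (hγz i), Holonomy.seg_self (γ (τ i)).2, Path.subpath_self, Λ.hol_refl]
    | succ n hin ih =>
      intro hnj
      obtain ⟨k, hk, he⟩ := ih (by omega)
      have hb := hball n hin (by omega)
      have hc := convex_closedBall (pos M L ε (z n)) (8 * ε)
      have h1 : (γ (τ (n + 1)) : ℝ × ℝ) ∈ Metric.closedBall (pos M L ε (z n)) (8 * ε) := by
        rw [Metric.mem_closedBall']
        linarith [hd n, hs n _ (hτ (Nat.le_succ n)) le_rfl,
          dist_triangle_right (pos M L ε (z n)) (γ (τ (n + 1)) : ℝ × ℝ) (γ (τ n))]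
      have h2 : Λ.hol (γ.subpath (τ n) (τ (n + 1))) =
          Λ.seg (γ (τ n) : ℝ × ℝ) (γ (τ (n + 1))) := by
        refine Holonomy.HolIn.eq_seg (Holonomy.holIn_subpath γ fun r hr => ?_) hc hb
        rw [Set.uIcc_of_le (hτ (Nat.le_succ n))] at hr
        rw [Metric.mem_closedBall']
        linarith [hd n, hs n r hr.1 hr.2,
          dist_triangle_right (pos M L ε (z n)) (γ r : ℝ × ℝ) (γ (τ n))]
      have h3 : Λ.hol (γ.subpath (τ i) (τ (n + 1))) =
          Λ.seg (γ (τ i)) (pos M L ε (z i)) * k * Λ.seg (pos M L ε (z n)) (γ (τ (n + 1))) := by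
        rw [← Holonomy.hol_subpath_mul Λ γ (τ i) (τ n), he, h2, mul_assoc,
          Holonomy.seg_mul_seg hc hb (hcen _) (hγz n) h1]
      rcases hz n with h | h
      · exact ⟨k, by rw [h]; exact hk, by rw [h3, h]⟩
      · have h4 := P.dist_pos_le h (hout n hin (by omega))
        have h5 : pos M L ε (z (n + 1)) ∈ Metric.closedBall (pos M L ε (z n)) (8 * ε) := by
          rw [Metric.mem_closedBall']
          linarith
        refine ⟨k * Λ.seg (pos M L ε (z n)) (pos M L ε (z (n + 1))), ?_, ?_⟩
        · have hm := hmem (n + 1) (by omega) hnj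
          obtain ⟨e, ⟨h, h'⟩ | ⟨h, h'⟩⟩ := h
          · have := TriComplex.IsWalk.fwd (K := complex M) _ k e (h ▸ hk) (h' ▸ hm)
            rwa [h, h'] at this
          · have := TriComplex.IsWalk.bwd (K := complex M) _ k e (h' ▸ hk) (h ▸ hm)
            rw [h, h'] at this
            simpa only [Holonomy.seg_inv hc hb h5 (hcen _)] using this
        · rw [h3, mul_assoc, mul_assoc, mul_assoc, Holonomy.seg_mul_seg hc hb (hcen _) h5 h1]
  obtain ⟨k, hk, he⟩ := key j hij.le le_rfl
  refine ⟨N, z i, z j, k, Λ.hol (γ.subpath 0 (τ i)) * Λ.seg (γ (τ i)) (pos M L ε (z i)),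
    Λ.seg (pos M L ε (z j)) (γ (τ j)) * Λ.hol (γ.subpath (τ j) 1), hmem i le_rfl hij.le, hk,
    conn_image_Icc hz, ?_, ?_, hpi, hqj, ?_, ?_, ?_, ?_⟩
  · rintro _ ⟨n, hn, rfl⟩
    exact hout n hn.1 hn.2
  · rintro _ ⟨n, hn, rfl⟩
    exact ⟨_, hd n⟩
  · rintro _ ⟨n, hn, rfl⟩ w hw
    rcases hnear n hn.1 hn.2 w hw with ⟨rfl, rfl⟩ | ⟨rfl, rfl⟩
    · exact Or.inl ⟨rfl, rfl⟩
    · exact Or.inr ⟨rfl, rfl⟩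
  · have h1 := Holonomy.holIn_subpath (Λ := Λ) γ (s := 0) (t := τ i) (W := W s) fun r hr => by
      rw [Set.uIcc_of_le unitInterval.nonneg'] at hr
      exact C.left r (hr.2.trans hi)
    rw [show (a : ℝ × ℝ) = γ 0 by rw [γ.source]]
    exact h1.trans ((Holonomy.holIn_seg_of_convex (convex_closedBall _ _) (hball i le_rfl hij.le)
      (hγz i) (hcen _)).mono (P.closedBall_subset (hout i le_rfl hij.le) hpi))
  · have h1 := Holonomy.holIn_subpath (Λ := Λ) γ (s := τ j) (t := 1) (W := W e) fun r hr => by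
      rw [Set.uIcc_of_le unitInterval.le_one'] at hr
      exact C.right r (hj.trans hr.1)
    rw [show (b : ℝ × ℝ) = γ 1 by rw [γ.target]]
    exact ((Holonomy.holIn_seg_of_convex (convex_closedBall _ _) (hball j hij.le le_rfl)
      (hcen _) (hγz j)).mono (P.closedBall_subset (hout j hij.le le_rfl) hqj)).trans h1
  · rw [← Λ.hol_subpath_zero_one γ, ← Holonomy.hol_subpath_mul Λ γ 0 (τ j),
      ← Holonomy.hol_subpath_mul Λ γ 0 (τ i), he]
    group

end PlanarSetup

open TorusLattice

theorem TriComplex.cnt_le_add {α : Type*} [Fintype α] {p q r : α → Prop}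
    (h : ∀ x, p x → q x ∨ r x) : cnt p ≤ cnt q + cnt r := by
  rw [cnt, cnt, cnt, ← Finset.sum_add_distrib]
  refine Finset.sum_le_sum fun x _ => ?_
  have := h x
  grind

theorem TorusLattice.link_of_meets {M : ℕ} [NeZero M] {A B : Set (ZMod M × ZMod M)} {t}
    (hA : (complex M).TMeets A t) (hB : (complex M).TMeets B t) :
    ∃ x ∈ A, ∃ y ∈ B, y = x ∨ Link M x y := by
  have h1 := link_va_vb t
  have h2 := link_va_vc t
  have h3 := link_vb_vc t
  rcases hA with hA | hA | hA <;> rcases hB with hB | hB | hB <;> refine ⟨_, hA, _, hB, ?_⟩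
  · exact Or.inl rfl
  · exact Or.inr h1
  · exact Or.inr h2
  · exact Or.inr h1.symm
  · exact Or.inl rfl
  · exact Or.inr h3
  · exact Or.inr h2.symm
  · exact Or.inr h3.symm
  · exact Or.inl rfl

namespace PlanarSetup

variable {M : ℕ} {L ε : ℝ} {Z : Set (ℝ × ℝ)} {ι : Type*} {K W : ι → Set (ℝ × ℝ)} {o : ι}
  {G : Type*} [Group G] {Λ : Holonomy ↥Zᶜ G}

theorem not_adj [NeZero M] (P : PlanarSetup M L ε Z K W o) {u w : ι} (h : u ≠ w) :
    ¬ (complex M).Adj (pos M L ε ⁻¹' K u) (pos M L ε ⁻¹' K w) := by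
  rw [adj_iff]
  rintro ⟨a, ha, b, hb, hl⟩
  have h1 : dist (pos M L ε a) (pos M L ε b) ≤ ε := by
    refine hl.dist_pos P.one_lt P.eps_pos P.two_mul_le ?_
    by_cases hu : u = o
    · exact Or.inr (P.norm_lt _ (P.notMem_of_mem hb (hu ▸ h)))
    · exact Or.inl (P.norm_lt _ (P.notMem_of_mem ha (Ne.symm hu)))
  linarith [P.sep u w h _ ha _ hb, P.eps_pos]

theorem conn_region [NeZero M] (P : PlanarSetup M L ε Z K W o) (u : ι) :
    (complex M).Conn (pos M L ε ⁻¹' K u) ∧ (complex M).DualConn (pos M L ε ⁻¹' K u) ∧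
      (pos M L ε ⁻¹' K u).Nonempty ∧ (u ≠ o → (complex M).chi (pos M L ε ⁻¹' K u) = 1) ∧
      (u = o → (complex M).chi (pos M L ε ⁻¹' K u) = -1) := by
  obtain ⟨a, b, c, d, ha, hab, hb, hc, hcd, hd, h1, h2⟩ := P.box u
  by_cases hu : u = o
  · rw [h2 hu]
    refine ⟨conn_compl_box ha hb hc hd, dualConn_of_conn_compl ?_, ⟨0, fun h => ?_⟩,
      fun h => absurd hu h, fun _ => chi_compl_box (by omega) hb (by omega) hd⟩
    · rw [compl_compl]
      exact conn_box (by omega) hb (by omega) hd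
    · rw [mem_box] at h
      simp only [Prod.fst_zero, ZMod.val_zero] at h
      omega
  · rw [h1 hu]
    refine ⟨conn_box (by omega) hb (by omega) hd, dualConn_of_conn_compl
      (conn_compl_box ha hb hc hd), ⟨(a, c), ?_⟩, fun _ => chi_box (by omega) hb (by omega) hd,
      fun h => absurd h hu⟩
    rw [mem_box]
    simp only [ZMod.val_cast_of_lt (show a < M by omega), ZMod.val_cast_of_lt (show c < M by omega)]
    omega

theorem cnt_star_le [NeZero M] (P : PlanarSetup M L ε Z K W o) {u : ι} {p : ZMod M × ZMod M}
    (hp : pos M L ε p ∉ K u) :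
    TriComplex.cnt (fun t => (complex M).TMeets {p} t ∧
      (complex M).TMeets (pos M L ε ⁻¹' K u) t ∧
      (complex M).TMeets ({p} ∪ pos M L ε ⁻¹' K u)ᶜ t) ≤ 2 := by
  obtain ⟨a, b, c, d, ha, hab, hb, hc, hcd, hd, h1, h2⟩ := P.box u
  change p ∉ pos M L ε ⁻¹' K u at hp
  by_cases hu : u = o
  · rw [h2 hu] at hp ⊢
    exact cnt_star_compl_box_le (not_not.1 hp) hab hb hcd hd
  · rw [h1 hu] at hp ⊢
    exact cnt_star_box_le hp ha (by omega) hb hc hd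

theorem contacts [NeZero M] (P : PlanarSetup M L ε Z K W o) {N : Set (ZMod M × ZMod M)}
    {p q : ZMod M × ZMod M} {s e : ι} (hp : p ∈ N) (hq : q ∈ N)
    (hN : ∀ x ∈ N, ∀ w, pos M L ε x ∉ K w)
    (hnear : ∀ x ∈ N, ∀ w, Near M L ε K w x → x = p ∧ w = s ∨ x = q ∧ w = e) :
    TriComplex.cnt (fun t => (complex M).TMeets N t ∧
      (complex M).TMeets (⋃ u, pos M L ε ⁻¹' K u) t ∧
      (complex M).TMeets (N ∪ ⋃ u, pos M L ε ⁻¹' K u)ᶜ t) ≤ 4 := by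
  have h1 := P.cnt_star_le (hN p hp s)
  have h2 := P.cnt_star_le (hN q hq e)
  refine (TriComplex.cnt_le_add ?_).trans ((add_le_add h1 h2).trans (by norm_num))
  rintro t ⟨ht, ht', ht''⟩
  have mono : ∀ {A B : Set (ZMod M × ZMod M)}, (complex M).TMeets A t → A ⊆ B →
      (complex M).TMeets B t := fun h hAB => h.imp (fun h => hAB h) (Or.imp (fun h => hAB h) fun h => hAB h)
  have split : ∀ {A : Set (ZMod M × ZMod M)}, (complex M).TMeets A t → ∃ x ∈ A,
      (complex M).TMeets {x} t := by
    rintro A (h | h | h)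
    · exact ⟨_, h, Or.inl rfl⟩
    · exact ⟨_, h, Or.inr (Or.inl rfl)⟩
    · exact ⟨_, h, Or.inr (Or.inr rfl)⟩
  obtain ⟨x, hx, hxt⟩ := split ht
  obtain ⟨y, hy, hyt⟩ := split ht'
  obtain ⟨w, hw⟩ := Set.mem_iUnion.1 hy
  obtain ⟨x', hx', y', hy', hl⟩ := link_of_meets hxt hyt
  rw [Set.mem_singleton_iff.1 hx', Set.mem_singleton_iff.1 hy'] at hl
  have hw' : (complex M).TMeets (pos M L ε ⁻¹' K w) t :=
    mono hyt (Set.singleton_subset_iff.2 hw)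
  have hc : (complex M).TMeets ({x} ∪ pos M L ε ⁻¹' K w)ᶜ t := by
    refine mono ht'' (Set.compl_subset_compl.2 (Set.union_subset_union
      (Set.singleton_subset_iff.2 hx) ?_))
    exact Set.subset_iUnion (fun u => pos M L ε ⁻¹' K u) w
  rcases hnear x hx w ⟨y, hw, hl⟩ with ⟨rfl, rfl⟩ | ⟨rfl, rfl⟩
  · exact Or.inl ⟨hxt, hw', hc⟩
  · exact Or.inr ⟨hxt, hw', hc⟩

/-- The edge bound, for a plane drawing at the scale of a lattice. -/
theorem card_le (P : PlanarSetup M L ε Z K W o) [Fintype ι] (h3 : 3 ≤ Fintype.card ι) {m : ℕ}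
    {a b : Fin m → ↥Zᶜ} (γ : ∀ i, Path (a i) (b i)) {s e : Fin m → ι} {T₁ T₂ : Fin m → I}
    (C : ∀ i, PlanarCurve L ε K W (fun t => (γ i t : ℝ × ℝ)) (s i) (e i) (T₁ i) (T₂ i))
    (hsep : ∀ i j, i ≠ j → ∀ t t', 10 * ε < dist (γ i t : ℝ × ℝ) (γ j t'))
    (hnt : ∀ i, s i = e i → ¬ Λ.HolIn (W (s i)) (a i) (b i) (Λ.hol (γ i)))
    (hnh : ∀ i j, i ≠ j → s i = s j → e i = e j → ∀ x y, Λ.HolIn (W (s i)) (a j) (a i) x →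
      Λ.HolIn (W (e i)) (b i) (b j) y → Λ.hol (γ j) ≠ x * Λ.hol (γ i) * y)
    (hnh' : ∀ i j, i ≠ j → s i = e j → e i = s j → ∀ x y, Λ.HolIn (W (s i)) (b j) (a i) x →
      Λ.HolIn (W (e i)) (b i) (a j) y → (Λ.hol (γ j))⁻¹ ≠ x * Λ.hol (γ i) * y) :
    (m : ℤ) + 6 ≤ 3 * Fintype.card ι := by
  classical
  have hM := P.one_lt
  have : NeZero M := ⟨by omega⟩
  have hε := P.eps_pos
  choose N p q k A B hp hwalk hconn hout hdist hps hqe hnear hA hB hhol using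
    fun i => P.exists_walk (γ i) (C i) (Λ := Λ)
  have hq : ∀ i, q i ∈ N i := fun i => (hwalk i).mem_right
  choose w hwW hwj using P.conn_W
  let c : ι → ZMod M × ZMod M → G := fun u x =>
    if h : ∃ g, Λ.HolIn (W u) (w u) (pos M L ε x) g then h.choose else 1
  have hc : ∀ u x, pos M L ε x ∈ W u → Λ.HolIn (W u) (w u) (pos M L ε x) (c u x) := by
    intro u x hx
    have h : ∃ g, Λ.HolIn (W u) (w u) (pos M L ε x) g :=
      Holonomy.HolIn.of_joinedIn (hwj u hx) (P.disjoint_W u)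
    simp only [c, dif_pos h]
    exact h.choose_spec
  let H : ι → Subgroup G := fun u =>
    { carrier := {g | Λ.HolIn (W u) (w u) (w u) g}
      mul_mem' := fun h h' => Holonomy.HolIn.trans h h'
      one_mem' := .refl (hwW u) (Set.disjoint_left.1 (P.disjoint_W u) (hwW u))
      inv_mem' := fun h => Holonomy.HolIn.symm h }
  have hH : ∀ {u g}, g ∈ H u → Λ.HolIn (W u) (w u) (w u) g := fun h => h
  have hcW : ∀ {u x}, (∀ v, pos M L ε x ∉ K v) → Near M L ε K u x →
      Λ.HolIn (W u) (w u) (pos M L ε x) (c u x) := fun {u x} h h' =>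
    hc u x (P.closedBall_subset h h' (Metric.mem_closedBall_self (by linarith)))
  have hcen : ∀ x : ℝ × ℝ, x ∈ Metric.closedBall x (8 * ε) :=
    fun x => Metric.mem_closedBall_self (by linarith)
  have hlink : ∀ {x y}, Link M x y → (∀ v, pos M L ε x ∉ K v) →
      pos M L ε y ∈ Metric.closedBall (pos M L ε x) (8 * ε) := fun hl h => by
    rw [Metric.mem_closedBall']
    linarith [P.dist_pos_le hl h]
  have flatD : ∀ {u x y z}, pos M L ε z ∈ K u → (∀ v, pos M L ε x ∉ K v) →
      (∀ v, pos M L ε y ∉ K v) → Link M x z → Link M y z → Link M x y →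
      c u x * Λ.seg (pos M L ε x) (pos M L ε y) * (c u y)⁻¹ ∈ H u := by
    intro u x y z hz hx hy hxz hyz hxy
    have hn : Near M L ε K u x := ⟨z, hz, Or.inr hxz⟩
    have hn' : Near M L ε K u y := ⟨z, hz, Or.inr hyz⟩
    exact ((hcW hx hn).trans ((Holonomy.holIn_seg_of_convex (convex_closedBall _ _)
      (P.far _ hx) (hcen _) (hlink hxy hx)).mono (P.closedBall_subset hx hn))).trans
      (hcW hy hn').symm
  have hAi : ∀ i, Λ.HolIn (W (s i)) (w (s i)) (a i) (c (s i) (p i) * (A i)⁻¹) := fun i =>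
    (hcW (hout i _ (hp i)) (hps i)).trans (hA i).symm
  have hBi : ∀ i, Λ.HolIn (W (e i)) (w (e i)) (b i) (c (e i) (q i) * B i) := fun i =>
    (hcW (hout i _ (hq i)) (hqe i)).trans (hB i)
  have hcanon : ∀ i, c (s i) (p i) * k i * (c (e i) (q i))⁻¹ =
      (c (s i) (p i) * (A i)⁻¹) * Λ.hol (γ i) * (c (e i) (q i) * B i)⁻¹ := fun i => by
    rw [hhol]
    group
  have hadj : ∀ {u x}, (∀ v, pos M L ε x ∉ K v) → Near M L ε K u x →
      (complex M).Adj {x} (pos M L ε ⁻¹' K u) := by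
    rintro u x hx ⟨y, hy, rfl | hl⟩
    · exact absurd hy (hx u)
    · exact adj_iff.2 ⟨x, rfl, y, hy, hl⟩
  have hsepN : ∀ i j, i ≠ j → ∀ x ∈ N i, ∀ y ∈ N j, ¬ (y = x ∨ Link M x y) := by
    intro i j hij x hx y hy hl
    have h1 : dist (pos M L ε x) (pos M L ε y) ≤ ε := by
      rcases hl with rfl | hl
      · simpa using hε.le
      · exact P.dist_pos_le hl (hout i x hx)
    obtain ⟨t, ht⟩ := hdist i x hx
    obtain ⟨t', ht'⟩ := hdist j y hy
    have h2 := dist_triangle4 (γ i t : ℝ × ℝ) (pos M L ε x) (pos M L ε y) (γ j t')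
    rw [dist_comm (γ i t : ℝ × ℝ) (pos M L ε x)] at h2
    linarith [hsep i j hij t t']
  let Q : DiscreteDrawing (complex M) ι m G :=
    { closed := TorusLattice.closed
      loopless := TorusLattice.loopless hM
      conn_univ := TorusLattice.conn_univ
      exists_triangle := TorusLattice.exists_triangle
      D := fun u => pos M L ε ⁻¹' K u
      D_disjoint := fun u v huv => Set.disjoint_left.2 fun x hx hx' => P.notMem_of_mem hx' huv hx
      D_nonadj := fun u v huv => P.not_adj huv
      D_conn := fun u => (P.conn_region u).1
      D_nonempty := fun u => (P.conn_region u).2.2.1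
      D_dual := fun u => (P.conn_region u).2.1
      dual_singleton := TorusLattice.dualConn_singleton hM
      o := o
      chi_D := fun u => (P.conn_region u).2.2.2.1
      euler := by
        rw [TorusLattice.chi_univ, Fintype.sum_eq_add_sum_compl o, (P.conn_region o).2.2.2.2 rfl,
          Finset.sum_congr rfl fun u hu => (P.conn_region u).2.2.2.1 (by simpa using hu)]
        rw [Finset.sum_const, Finset.card_compl, Finset.card_singleton, nsmul_eq_mul, mul_one,
          Nat.cast_sub (by omega)]
        push_cast
        linarith
      three_le := h3
      N := N
      N_disjoint := fun i j hij => Set.disjoint_left.2 fun x hx hx' =>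
        hsepN i j hij x hx x hx' (Or.inl rfl)
      N_nonadj := fun i j hij h => by
        obtain ⟨x, hx, y, hy, hl⟩ := adj_iff.1 h
        exact hsepN i j hij x hx y hy (Or.inr hl)
      N_conn := hconn
      N_out := fun i x hx u => hout i x hx u
      contacts := fun i => P.contacts (hp i) (hq i) (hout i) (hnear i)
      H := H
      c := c
      g := fun x y => Λ.seg (pos M L ε x) (pos M L ε y)
      flat := fun t ht => Holonomy.seg_mul_seg (convex_closedBall _ _)
        (P.far _ fun u => (ht u).1) (hcen _) (hlink (link_va_vb t) fun u => (ht u).1)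
        (hlink (link_va_vc t) fun u => (ht u).1)
      flat_D := fun u t =>
        ⟨fun h1 h2 h3 => flatD h1 h2 h3 (link_va_vb t).symm (link_va_vc t).symm (link_vb_vc t),
        fun h1 h2 h3 => flatD h1 h2 h3 (link_va_vb t) (link_vb_vc t).symm (link_va_vc t),
        fun h1 h2 h3 => flatD h1 h2 h3 (link_va_vc t) (link_vb_vc t) (link_va_vb t)⟩
      st := s
      en := e
      p := p
      q := q
      k := k
      p_mem := hp
      p_adj := fun i => hadj (hout i _ (hp i)) (hps i)
      q_adj := fun i => hadj (hout i _ (hq i)) (hqe i)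
      walk := hwalk
      nontrivial := fun i hi h => by
        refine hnt i hi ?_
        rw [hcanon] at h
        have h4 := hBi i
        rw [← hi] at h4 h
        convert ((hAi i).symm.trans (hH h)).trans h4 using 1
        group
      nonhomotopic := fun i j hij hs he h hh h' hh' heq => by
        have h4 := hAi j
        have h5 := hBi j
        rw [← hs] at h4
        rw [← he] at h5
        refine hnh i j hij hs he _ _ ((h4.symm.trans (hH hh)).trans (hAi i))
          (((hBi i).symm.trans (hH hh')).trans h5) ?_
        rw [hcanon, hcanon, ← hs, ← he] at heq
        rw [mul_inv_eq_iff_eq_mul, ← eq_inv_mul_iff_mul_eq] at heq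
        rw [heq]
        group
      nonhomotopic' := fun i j hij hs he h hh h' hh' heq => by
        have h4 := hBi j
        have h5 := hAi j
        rw [← hs] at h4
        rw [← he] at h5
        refine hnh' i j hij hs he _ _ ((h4.symm.trans (hH hh)).trans (hAi i))
          (((hBi i).symm.trans (hH hh')).trans h5) ?_
        rw [hcanon, hcanon, ← hs, ← he, mul_inv_rev, inv_inv, mul_inv_rev _ (Λ.hol (γ j))] at heq
        rw [← eq_inv_mul_iff_mul_eq, mul_inv_eq_iff_eq_mul] at heq
        rw [heq]
        group }
  exact Q.card_le

end PlanarSetup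

namespace SphereCurve

open Filter Topology

section BallAt

variable {E : Type*} [NormedAddCommGroup E]

/-- The finite part of the basic neighbourhood of radius `r` of a point of the sphere. -/
def ballAt (r : ℝ) : OnePoint E → Set E
  | none => {z | r⁻¹ < ‖z‖}
  | some u => Metric.ball u r

@[simp] theorem ballAt_infty (r : ℝ) : ballAt r (OnePoint.infty : OnePoint E) = {z | r⁻¹ < ‖z‖} :=
  rfl

@[simp] theorem ballAt_coe (r : ℝ) (u : E) : ballAt r (u : OnePoint E) = Metric.ball u r := rfl

/-- The basic neighbourhood of radius `r` of a point of the sphere. -/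
def nbhdAt (r : ℝ) (v : OnePoint E) : Set (OnePoint E) := insert v ((↑) '' ballAt r v)

theorem coe_mem_nbhdAt {r : ℝ} (hr : 0 < r) {v : OnePoint E} {z : E} :
    (z : OnePoint E) ∈ nbhdAt r v ↔ z ∈ ballAt r v := by
  induction v using OnePoint.rec with
  | infty => simp [nbhdAt]
  | coe u =>
    simp only [nbhdAt, ballAt_coe, Set.mem_insert_iff, OnePoint.coe_eq_coe, Set.mem_image]
    constructor
    · rintro (rfl | ⟨x, hx, rfl⟩)
      · exact Metric.mem_ball_self hr
      · exact hx
    · exact fun h => Or.inr ⟨z, h, rfl⟩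

theorem ballAt_mono {r s : ℝ} (hr : 0 < r) (h : r ≤ s) (v : OnePoint E) :
    ballAt r v ⊆ ballAt s v := by
  induction v using OnePoint.rec with
  | infty => exact fun z hz => (inv_anti₀ hr h).trans_lt hz
  | coe u => exact Metric.ball_subset_ball h

theorem nbhdAt_mono {r s : ℝ} (hr : 0 < r) (h : r ≤ s) (v : OnePoint E) :
    nbhdAt r v ⊆ nbhdAt s v :=
  Set.insert_subset_insert (Set.image_mono (ballAt_mono hr h v))

theorem eventually_thicken {r s : ℝ} (hr : 0 < r) (h : r < s) : ∀ᶠ δ in 𝓝[>] (0 : ℝ),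
    ∀ v : OnePoint E, ∀ a ∈ ballAt r v, ∀ z, dist z a ≤ δ → z ∈ ballAt s v := by
  have h1 : 0 < s - r := by linarith
  have h2 : 0 < r⁻¹ - s⁻¹ := by linarith [inv_strictAnti₀ hr h]
  filter_upwards [Ioo_mem_nhdsGT (lt_min h1 h2)] with δ hδ v a ha z hz
  have hδ1 := hδ.2.trans_le (min_le_left _ _)
  have hδ2 := hδ.2.trans_le (min_le_right _ _)
  induction v using OnePoint.rec with
  | infty =>
    have ha : r⁻¹ < ‖a‖ := ha
    have := norm_sub_norm_le a z
    rw [← dist_eq_norm, dist_comm] at this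
    change s⁻¹ < ‖z‖
    linarith
  | coe u =>
    have ha : dist a u < r := ha
    have := dist_triangle z a u
    change dist z u < s
    linarith

variable [ProperSpace E]

theorem nbhdAt_mem_nhds {r : ℝ} (hr : 0 < r) (v : OnePoint E) : nbhdAt r v ∈ 𝓝 v := by
  induction v using OnePoint.rec with
  | infty =>
    rw [OnePoint.nhds_infty_eq, coclosedCompact_eq_cocompact, ← Metric.cobounded_eq_cocompact]
    refine ⟨Filter.mem_map.2 ?_, Set.mem_insert _ _⟩
    refine hasBasis_cobounded_norm.mem_iff.2 ⟨r⁻¹ + 1, trivial, fun z hz => ?_⟩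
    have hz : r⁻¹ + 1 ≤ ‖z‖ := hz
    exact (coe_mem_nbhdAt hr).2 (show r⁻¹ < ‖z‖ by linarith)
  | coe u =>
    rw [OnePoint.nhds_coe_eq]
    refine Filter.mem_map.2 (Filter.mem_of_superset (Metric.ball_mem_nhds u hr) fun z hz => ?_)
    exact (coe_mem_nbhdAt hr).2 hz

theorem eventually_nbhdAt_subset {v : OnePoint E} {U : Set (OnePoint E)} (hU : U ∈ 𝓝 v) :
    ∀ᶠ r in 𝓝[>] (0 : ℝ), nbhdAt r v ⊆ U := by
  suffices ∃ r > 0, nbhdAt r v ⊆ U by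
    obtain ⟨r, hr, h⟩ := this
    filter_upwards [Ioc_mem_nhdsGT hr] with s hs
    exact (nbhdAt_mono hs.1 hs.2 v).trans h
  induction v using OnePoint.rec with
  | infty =>
    rw [OnePoint.nhds_infty_eq, coclosedCompact_eq_cocompact, ← Metric.cobounded_eq_cocompact,
      mem_sup, mem_pure, mem_map, hasBasis_cobounded_norm.mem_iff] at hU
    obtain ⟨⟨R, -, hR⟩, h⟩ := hU
    refine ⟨(max R 1)⁻¹, by positivity, Set.insert_subset h ?_⟩
    rintro _ ⟨z, hz, rfl⟩
    have hz : (max R 1)⁻¹⁻¹ < ‖z‖ := hz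
    rw [inv_inv] at hz
    exact hR ((le_max_left _ _).trans hz.le)
  | coe u =>
    rw [OnePoint.nhds_coe_eq] at hU
    obtain ⟨r, hr, h⟩ := Metric.mem_nhds_iff.1 (Filter.mem_map.1 hU)
    refine ⟨r, hr, Set.insert_subset (h (Metric.mem_ball_self hr)) ?_⟩
    rintro _ ⟨z, hz, rfl⟩
    exact h hz

end BallAt

theorem conical_nbhdAt {E : Type*} [NormedAddCommGroup E] [NormedSpace ℝ E] [ProperSpace E]
    {V : Set (OnePoint E)} {v : OnePoint E} (hv : v ∈ V) {r : ℝ} (hr : 0 < r)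
    (hV : ∀ w ∈ V, w ∈ nbhdAt r v → w = v) : Conical V (nbhdAt r v) v := by
  induction v using OnePoint.rec with
  | infty =>
    refine conical_compl_ball (inv_pos.2 hr) hv fun z hz hzV => ?_
    have := hV _ hzV ((coe_mem_nbhdAt hr).2 hz)
    simp at this
  | coe u =>
    rw [show nbhdAt r (u : OnePoint E) = (↑) '' Metric.ball u r from
      Set.insert_eq_of_mem ⟨u, Metric.mem_ball_self hr, rfl⟩]
    refine conical_ball hv fun z hz hzu hzV => hz ?_
    have := hV _ hzV ((coe_mem_nbhdAt hr).2 (by simpa [dist_eq_norm] using hzu))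
    simpa using this

end SphereCurve

namespace TorusLattice

variable {M : ℕ} {L ε c ρ : ℝ}

theorem exists_abs_coord_sub_lt_iff (hε : 0 < ε) (hM : 2 * L ≤ ε * (M - 1)) (hc : |c| + ρ ≤ L)
    (hρ : ε < ρ) : ∃ a b, 0 < a ∧ a + 1 < b ∧ b < M ∧
      ∀ x : ZMod M, |coord M L ε x - c| < ρ ↔ a ≤ x.val ∧ x.val < b := by
  obtain ⟨h1, h2⟩ := abs_le.1 (show |c| ≤ L - ρ by linarith)
  refine ⟨⌊(c - ρ + L) / ε⌋₊ + 1, ⌈(c + ρ + L) / ε⌉₊, by omega, ?_, ?_, fun x => ?_⟩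
  · rw [Nat.lt_ceil, lt_div_iff₀ hε]
    have := Nat.floor_le (show 0 ≤ (c - ρ + L) / ε from div_nonneg (by linarith) hε.le)
    rw [le_div_iff₀ hε] at this
    push_cast
    nlinarith
  · have h3 : 0 ≤ (c + ρ + L) / ε := div_nonneg (by linarith) hε.le
    have h4 := Nat.ceil_lt_add_one h3
    rw [← sub_lt_iff_lt_add, lt_div_iff₀ hε] at h4
    suffices (⌈(c + ρ + L) / ε⌉₊ : ℝ) < M by exact_mod_cast this
    nlinarith
  · rw [abs_lt, Nat.lt_ceil, lt_div_iff₀ hε, Nat.add_one_le_iff,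
      Nat.floor_lt (div_nonneg (by linarith) hε.le), div_lt_iff₀ hε, coord]
    constructor <;> rintro ⟨h, h'⟩ <;> constructor <;> linarith

theorem exists_abs_coord_le_iff (hε : 0 < ε) (hM : 2 * L ≤ ε * (M - 1)) (hρL : ρ < L)
    (hρ : ε ≤ ρ) : ∃ a b, 0 < a ∧ a + 1 < b ∧ b < M ∧
      ∀ x : ZMod M, |coord M L ε x| ≤ ρ ↔ a ≤ x.val ∧ x.val < b := by
  have h0 : 0 ≤ (ρ + L) / ε := div_nonneg (by linarith) hε.le
  have h0' : 0 ≤ (-ρ + L) / ε := div_nonneg (by linarith) hε.le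
  have hf := Nat.floor_le h0
  rw [le_div_iff₀ hε] at hf
  refine ⟨⌈(-ρ + L) / ε⌉₊, ⌊(ρ + L) / ε⌋₊ + 1, ?_, ?_, ?_, fun x => ?_⟩
  · exact Nat.ceil_pos.2 (div_pos (by linarith) hε)
  · have h1 := Nat.ceil_lt_add_one h0'
    have h2 := Nat.lt_floor_add_one ((ρ + L) / ε)
    rw [div_lt_iff₀ hε] at h2
    rw [← sub_lt_iff_lt_add, lt_div_iff₀ hε] at h1
    suffices ((⌈(-ρ + L) / ε⌉₊ : ℝ)) + 1 < ⌊(ρ + L) / ε⌋₊ + 1 by exact_mod_cast this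
    nlinarith
  · suffices ((⌊(ρ + L) / ε⌋₊ : ℝ)) + 1 < M by exact_mod_cast this
    nlinarith
  · rw [abs_le, Nat.lt_add_one_iff, Nat.le_floor_iff h0, le_div_iff₀ hε, Nat.ceil_le,
      div_le_iff₀ hε, coord]
    constructor <;> rintro ⟨h, h'⟩ <;> constructor <;> linarith

end TorusLattice

namespace SphereCurve

open TorusLattice

variable {V : Set (OnePoint (ℝ × ℝ))} {M : ℕ} {L ε r ρ δ : ℝ}

theorem isPathConnected_ballAt_sdiff (hr : 0 < r)
    (hd : ∀ v ∈ V, ∀ w ∈ V, v ≠ w → Disjoint (ballAt r v) (ballAt r w)) {v} (hv : v ∈ V) :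
    IsPathConnected (ballAt r v \ (↑) ⁻¹' V) := by
  have h1 : 1 < Module.rank ℝ (ℝ × ℝ) := by
    rw [rank_prod']
    norm_num
  induction v using OnePoint.rec with
  | infty =>
    have : ballAt r OnePoint.infty \ (↑) ⁻¹' V = {z : ℝ × ℝ | ‖z - 0‖ ∈ Set.Ioi r⁻¹} := by
      ext z
      simp only [ballAt_infty, sub_zero, Set.mem_Ioi]
      refine ⟨fun h => h.1, fun h => ⟨h, fun hz => ?_⟩⟩
      exact Set.disjoint_left.1 (hd _ hv _ hz (by simp)) h (Metric.mem_ball_self hr)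
    rw [this]
    exact isPathConnected_annulus h1 0 (convex_Ioi _) Set.nonempty_Ioi
      fun s hs => (inv_pos.2 hr).trans hs
  | coe u =>
    have : ballAt r (u : OnePoint (ℝ × ℝ)) \ (↑) ⁻¹' V = {z : ℝ × ℝ | ‖z - u‖ ∈ Set.Ioo 0 r} := by
      ext z
      have h0 : 0 < ‖z - u‖ ↔ z ≠ u := by rw [norm_pos_iff, sub_ne_zero]
      simp only [ballAt_coe, Set.mem_Ioo, Set.mem_sdiff, Metric.mem_ball, dist_eq_norm]
      refine ⟨fun h => ⟨h0.2 ?_, h.1⟩, fun h => ⟨h.2, fun hz => ?_⟩⟩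
      · rintro rfl
        exact h.2 hv
      · have h' : z ∈ ballAt r (u : OnePoint (ℝ × ℝ)) := by simpa [dist_eq_norm] using h.2
        refine Set.disjoint_left.1 (hd _ hv _ hz fun h'' => h0.1 h.1 ?_) h'
          (Metric.mem_ball_self hr)
        exact (OnePoint.coe_injective h'').symm
    rw [this]
    exact isPathConnected_annulus h1 u (convex_Ioo _ _) (Set.nonempty_Ioo.2 hr) fun s hs => hs.1

theorem planarSetup (hinf : OnePoint.infty ∈ V) (hr : 0 < r)
    (hd : ∀ v ∈ V, ∀ w ∈ V, v ≠ w → Disjoint (ballAt r v) (ballAt r w)) (hρ : 0 < ρ) (hρr : ρ < r)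
    (hρ1 : ρ < 1)
    (hth : ∀ v : OnePoint (ℝ × ℝ), ∀ a ∈ ballAt ρ v, ∀ z, dist z a ≤ 10 * ε → z ∈ ballAt r v)
    (hε : 0 < ε) (hερ : 10 * ε < ρ) (hM1 : 1 < M) (hM : 2 * L ≤ ε * (M - 1))
    (hL : ρ⁻¹ + 1 < L) :
    PlanarSetup M L ε ((↑) ⁻¹' V : Set (ℝ × ℝ)) (fun v : V => ballAt ρ v)
      (fun v : V => ballAt r v \ (↑) ⁻¹' V) ⟨OnePoint.infty, hinf⟩ := by
  have far : ∀ z : ℝ × ℝ, (∀ u : V, z ∉ ballAt ρ (u : OnePoint (ℝ × ℝ))) →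
      Disjoint (Metric.closedBall z (8 * ε)) ((↑) ⁻¹' V) := by
    refine fun z hz => Set.disjoint_left.2 fun p hp hpV => hz ⟨_, hpV⟩ ?_
    rw [ballAt_coe, Metric.mem_ball, dist_comm]
    have : dist p z ≤ 8 * ε := hp
    linarith
  have hdV : ∀ u w : V, u ≠ w → Disjoint (ballAt r u.1) (ballAt r w.1) :=
    fun u w huw => hd _ u.2 _ w.2 fun h => huw (Subtype.ext h)
  have hρ1' : 1 < ρ⁻¹ := (one_lt_inv₀ hρ).2 hρ1
  refine ⟨hM1, hε, hM, fun u w huw a ha b hb => ?_, fun u => Set.disjoint_sdiff_left, fun u =>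
    isPathConnected_ballAt_sdiff hr hd u.2, far, fun z hz u a ha haz y hy => ⟨?_, ?_⟩,
    fun z hz => ?_, fun u => ?_⟩
  · by_contra! h
    exact Set.disjoint_left.1 (hdV u w huw) (ballAt_mono hρ hρr.le _ ha)
      (hth _ b hb a h)
  · refine hth _ a ha y ((dist_triangle y z a).trans ?_)
    have : dist y z ≤ 8 * ε := hy
    linarith
  · exact Set.disjoint_left.1 (far z hz) hy
  · have : ¬ ρ⁻¹ < ‖z‖ := hz
    linarith
  · obtain ⟨u, hu⟩ := u
    induction u using OnePoint.rec with
    | infty =>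
      obtain ⟨a, b, ha, hab, hb, h⟩ := exists_abs_coord_le_iff (ρ := ρ⁻¹) hε hM (by linarith) (by linarith)
      refine ⟨a, b, a, b, ha, hab, hb, ha, hab, hb, fun h => absurd rfl h, fun _ => ?_⟩
      ext x
      simp only [Set.mem_preimage, ballAt_infty, Set.mem_ofPred_eq, Set.mem_compl_iff, mem_box, ← h,
        pos, Prod.norm_def, lt_sup_iff, Real.norm_eq_abs, not_and_or, not_le]
    | coe u =>
      have hu' : ‖u‖ ≤ ρ⁻¹ := not_lt.1 fun h => Set.disjoint_left.1 (hd _ hinf _ hu (by simp))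
        (ballAt_mono hρ hρr.le _ h) (Metric.mem_ball_self hr)
      have hu1 := (norm_fst_le u).trans hu'
      have hu2 := (norm_snd_le u).trans hu'
      obtain ⟨a, b, ha, hab, hb, h⟩ := exists_abs_coord_sub_lt_iff (c := u.1) (ρ := ρ) hε hM
        (by rw [← Real.norm_eq_abs]; linarith) (by linarith)
      obtain ⟨c, d, hc, hcd, hd, h'⟩ := exists_abs_coord_sub_lt_iff (c := u.2) (ρ := ρ) hε hM
        (by rw [← Real.norm_eq_abs]; linarith) (by linarith)
      refine ⟨a, b, c, d, ha, hab, hb, hc, hcd, hd, fun _ => ?_, fun h => absurd h (by simp)⟩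
      ext x
      simp [mem_box, ← h, ← h', pos, Prod.dist_eq, Real.dist_eq]

end SphereCurve

namespace SphereCurve

variable {E : Type*} [NormedAddCommGroup E] {V : Set (OnePoint E)} {r : ℝ} {v w : OnePoint E}

/-- The inclusion of the complement of the finite vertices into the sphere. -/
def coeCompl (V : Set (OnePoint E)) : C(↥((↑) ⁻¹' V : Set E)ᶜ, OnePoint E) where
  toFun z := ((z : E) : OnePoint E)
  continuous_toFun := OnePoint.continuous_coe.comp continuous_subtype_val

theorem coeCompl_notMem (z : ↥((↑) ⁻¹' V : Set E)ᶜ) : coeCompl V z ∉ V := z.2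

/-- The curve `f` consists of the path `γ` preceded and followed by curves close to the ends. -/
def IsMiddle (V : Set (OnePoint E)) (r : ℝ) (f : Path v w) {a b : ↥((↑) ⁻¹' V : Set E)ᶜ}
    (γ : Path a b) : Prop :=
  ∃ (A : Path v (coeCompl V a)) (B : Path (coeCompl V b) w),
    HomOff V f ((A.trans (γ.map (coeCompl V).continuous)).trans B) ∧ OffSource V A ∧
      OffTarget V B ∧ (∀ t, A t ∈ nbhdAt r v) ∧ ∀ t, B t ∈ nbhdAt r w

theorem isMiddle_of_convexComb {f : Path v w} (hf : Off V f) {s s' : I} (hs0 : s ≠ 0) (hs1 : s ≠ 1)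
    (hs0' : s' ≠ 0) (hs1' : s' ≠ 1)     {a b : ↥((↑) ⁻¹' V : Set E)ᶜ} {γ : Path a b}
    (hγ : ∀ t, coeCompl V (γ t) = f (Set.Icc.convexComb s s' t))
    (hl : ∀ t ≤ s, f t ∈ nbhdAt r v) (hr : ∀ t, s' ≤ t → f t ∈ nbhdAt r w) :
    IsMiddle V r f γ := by
  have hcont : ∀ x y : I, Continuous (Set.Icc.convexComb x y) := by
    intro x y
    refine Continuous.subtype_mk ?_ _
    fun_prop
  let A : Path v (coeCompl V a) :=
    { toFun t := f (Set.Icc.convexComb 0 s t)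
      continuous_toFun := f.continuous.comp (hcont _ _)
      source' := by simp
      target' := by simpa using (hγ 0).symm }
  let B : Path (coeCompl V b) w :=
    { toFun t := f (Set.Icc.convexComb s' 1 t)
      continuous_toFun := f.continuous.comp (hcont _ _)
      source' := by simpa using (hγ 1).symm
      target' := by simp }
  rw [← unitInterval.pos_iff_ne_zero] at hs0 hs0'
  rw [← unitInterval.lt_one_iff_ne_one] at hs1 hs1'
  have hs0 : (0 : ℝ) < s := hs0
  have hs0' : (0 : ℝ) < s' := hs0'
  have hs1 : (s : ℝ) < 1 := hs1
  have hs1' : (s' : ℝ) < 1 := hs1'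
  have hA : ∀ t : I, (Set.Icc.convexComb 0 s t : ℝ) = t * s := fun t => by simp
  have hB : ∀ t : I, (Set.Icc.convexComb s' 1 t : ℝ) = (1 - t) * s' + t := fun t => by simp
  refine ⟨A, B, homOff_split hf A _ B (fun t => rfl) hγ fun t => rfl, fun t ht => ?_,
    fun t ht => ?_, fun t => hl _ ?_, fun t => hr _ ?_⟩
  · rw [← unitInterval.pos_iff_ne_zero] at ht
    have ht : (0 : ℝ) < t := ht
    refine hf _ (unitInterval.pos_iff_ne_zero.1 ?_) (unitInterval.lt_one_iff_ne_one.1 ?_)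
    · rw [← Subtype.coe_lt_coe, hA]
      exact mul_pos ht hs0
    · rw [← Subtype.coe_lt_coe, hA]
      exact mul_lt_one_of_nonneg_of_lt_one_right t.2.2 hs0.le hs1
  · rw [← unitInterval.lt_one_iff_ne_one] at ht
    have ht : (t : ℝ) < 1 := ht
    refine hf _ (unitInterval.pos_iff_ne_zero.1 ?_) (unitInterval.lt_one_iff_ne_one.1 ?_)
    · rw [← Subtype.coe_lt_coe, hB]
      exact add_pos_of_pos_of_nonneg (mul_pos (by linarith) hs0') t.2.1
    · rw [← Subtype.coe_lt_coe, hB, Set.Icc.coe_one]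
      nlinarith
  · rw [← Subtype.coe_le_coe, hA]
    exact mul_le_of_le_one_left hs0.le t.2.2
  · rw [← Subtype.coe_le_coe, hB]
    nlinarith [t.2.1]

theorem IsMiddle.symm {f : Path v w} {a b : ↥((↑) ⁻¹' V : Set E)ᶜ} {γ : Path a b}
    (h : IsMiddle V r f γ) : IsMiddle V r f.symm γ.symm := by
  obtain ⟨A, B, h, hA, hB, hA', hB'⟩ := h
  have h' := h.symm₂
  rw [Path.trans_symm, Path.trans_symm, Path.map_symm] at h'
  have hoff : Off V (B.symm.trans ((γ.symm.map (coeCompl V).continuous).trans A.symm)) :=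
    OffSource.trans hB.symm (OffTarget.trans' (fun t => coeCompl_notMem _) hA.symm)
  exact ⟨B.symm, A.symm, h'.trans (HomOff.assoc hoff).symm hoff, hB.symm, hA.symm,
    fun t => hB' _, fun t => hA' _⟩

variable [NormedSpace ℝ E] [ProperSpace E] {G : Type} [Group G]
  {Λ : Holonomy ↥((↑) ⁻¹' V : Set E)ᶜ G}

theorem IsMiddle.homOff_refl (hr : 0 < r) (hv : v ∈ V) (hV : ∀ w ∈ V, w ∈ nbhdAt r v → w = v)
    {f : Path v v} {a b : ↥((↑) ⁻¹' V : Set E)ᶜ} {γ : Path a b} (h : IsMiddle V r f γ)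
    (hγ : Λ.HolIn (ballAt r v \ (↑) ⁻¹' V) a b (Λ.hol γ)) : HomOff V f (Path.refl v) := by
  obtain ⟨A, B, h, hA, hB, hA', hB'⟩ := h
  obtain ⟨a', b', α, ha, hb, hα, he⟩ := hγ
  obtain rfl := Subtype.ext ha
  obtain rfl := Subtype.ext hb
  exact homOff_refl_of_middle (coeCompl V) coeCompl_notMem (conical_nbhdAt hv hr hV) h hA hB hA' hB'
    ((Λ.hol_eq_iff _ _).1 he.symm) fun t => (coe_mem_nbhdAt hr).2 (hα t).1

theorem IsMiddle.homOff (hr : 0 < r) (hv : v ∈ V) (hV : ∀ w ∈ V, w ∈ nbhdAt r v → w = v)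
    (hw : w ∈ V) (hW : ∀ x ∈ V, x ∈ nbhdAt r w → x = w)
    {f f' : Path v w} {a b a' b' : ↥((↑) ⁻¹' V : Set E)ᶜ} {γ : Path a b} {γ' : Path a' b'}
    (h : IsMiddle V r f γ) (h' : IsMiddle V r f' γ') {x y : G}
    (hx : Λ.HolIn (ballAt r v \ (↑) ⁻¹' V) a' a x) (hy : Λ.HolIn (ballAt r w \ (↑) ⁻¹' V) b b' y)
    (he : Λ.hol γ' = x * Λ.hol γ * y) : HomOff V f f' := by
  obtain ⟨A, B, h, hA, hB, hA', hB'⟩ := h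
  obtain ⟨A₁, B₁, h₁, hA₁, hB₁, hA₁', hB₁'⟩ := h'
  obtain ⟨p, q, α, hp, hq, hα, rfl⟩ := hx
  obtain rfl := Subtype.ext hp
  obtain rfl := Subtype.ext hq
  obtain ⟨p', q', β, hp', hq', hβ, rfl⟩ := hy
  obtain rfl := Subtype.ext hp'
  obtain rfl := Subtype.ext hq'
  exact homOff_of_middle (coeCompl V) coeCompl_notMem (conical_nbhdAt hv hr hV)
    (conical_nbhdAt hw hr hW) h h₁ hA hB hA' hB' hA₁ hB₁ hA₁' hB₁'
    (fun t => (coe_mem_nbhdAt hr).2 (hα t).1) (fun t => (coe_mem_nbhdAt hr).2 (hβ t).1)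
    ((Λ.hol_eq_iff _ _).1 (by rw [he, Λ.hol_trans, Λ.hol_trans]))

end SphereCurve

namespace SphereCurve

open Filter Topology

theorem eventually_lt_dist {E : Type*} [NormedAddCommGroup E] {g h : I → E} (hg : Continuous g) (hh : Continuous h)
    (hne : ∀ t t', g t ≠ h t') : ∀ᶠ δ in 𝓝[>] (0 : ℝ), ∀ t t', δ < dist (g t) (h t') := by
  obtain ⟨x, -, hx⟩ := isCompact_univ.exists_isMinOn Set.univ_nonempty
    (f := fun x : I × I => dist (g x.1) (h x.2)) (by fun_prop)
  filter_upwards [Ioo_mem_nhdsGT (dist_pos.2 (hne x.1 x.2))] with δ hδ t t'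
  exact hδ.2.trans_le (hx (Set.mem_univ (t, t')))

section

variable {E : Type*} [NormedAddCommGroup E] [ProperSpace E] {f : I → OnePoint E} {r : ℝ}

theorem exists_forall_le_mem_nbhdAt (hf : Continuous f) (hr : 0 < r) {c : I} (hc : 0 < c) :
    ∃ t : I, 0 < t ∧ t < c ∧ ∀ t' ≤ t, f t' ∈ nbhdAt r (f 0) := by
  obtain ⟨δ, hδ, h⟩ := Metric.mem_nhds_iff.1 (hf.continuousAt (nbhdAt_mem_nhds hr (f 0)))
  have hc : (0 : ℝ) < c := hc
  have hδc : 0 < min δ c := lt_min hδ hc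
  have h1 := min_le_left δ c
  have h2 := min_le_right δ c
  refine ⟨⟨min δ c / 2, by positivity, by linarith [c.2.2]⟩, ?_, ?_, fun t' ht' => h ?_⟩
  · rw [← Subtype.coe_lt_coe]
    exact half_pos hδc
  · rw [← Subtype.coe_lt_coe]
    change min δ c / 2 < c
    linarith
  · have ht' : (t' : ℝ) ≤ min δ c / 2 := ht'
    rw [Metric.mem_ball, Subtype.dist_eq, Real.dist_eq, Set.Icc.coe_zero, sub_zero,
      abs_of_nonneg t'.2.1]
    linarith

theorem exists_forall_ge_mem_nbhdAt (hf : Continuous f) (hr : 0 < r) {c : I} (hc : c < 1) :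
    ∃ t : I, t < 1 ∧ c < t ∧ ∀ t', t ≤ t' → f t' ∈ nbhdAt r (f 1) := by
  obtain ⟨t, h0, hc, h⟩ := exists_forall_le_mem_nbhdAt (hf.comp unitInterval.continuous_symm) hr
    (c := σ c) (by rwa [← unitInterval.symm_one, unitInterval.symm_lt_symm])
  refine ⟨σ t, ?_, ?_, fun t' ht' => ?_⟩
  · rwa [← unitInterval.symm_zero, unitInterval.symm_lt_symm]
  · rwa [← unitInterval.symm_lt_symm, unitInterval.symm_symm]
  · simpa using h (σ t') (by rwa [← unitInterval.symm_le_symm, unitInterval.symm_symm])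

theorem eventually_notMem_nbhdAt (hf : Continuous f) {t₁ t₂ : I} {v : OnePoint E}
    (hv : ∀ t, t₁ ≤ t → t ≤ t₂ → f t ≠ v) :
    ∀ᶠ ρ in 𝓝[>] (0 : ℝ), ∀ t, t₁ ≤ t → t ≤ t₂ → f t ∉ nbhdAt ρ v := by
  have hK : IsClosed (f '' Set.Icc t₁ t₂) := (isCompact_Icc.image hf).isClosed
  have hvK : v ∈ (f '' Set.Icc t₁ t₂)ᶜ := by
    rintro ⟨t, ht, h⟩
    exact hv t ht.1 ht.2 h
  filter_upwards [eventually_nbhdAt_subset (hK.isOpen_compl.mem_nhds hvK)] with ρ hρ t h1 h2 h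
  exact hρ h ⟨t, ⟨h1, h2⟩, rfl⟩

theorem exists_path_coeCompl {V : Set (OnePoint E)} (hV : OnePoint.infty ∈ V) (hf : Continuous f)
    {s s' : I} (hoff : ∀ t, f (Set.Icc.convexComb s s' t) ∉ V) :
    ∃ (a b : ↥((↑) ⁻¹' V : Set E)ᶜ) (γ : Path a b),
      ∀ t, coeCompl V (γ t) = f (Set.Icc.convexComb s s' t) := by
  have : ∀ t, ∃ z : E, (z : OnePoint E) = f (Set.Icc.convexComb s s' t) := fun t =>
    OnePoint.ne_infty_iff_exists.1 fun h => hoff t (h ▸ hV)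
  choose g hg using this
  have hgc : Continuous g := by
    rw [OnePoint.isOpenEmbedding_coe.isInducing.continuous_iff]
    refine Continuous.congr (f := fun t => f (Set.Icc.convexComb s s' t)) (hf.comp ?_)
      fun t => (hg t).symm
    refine Continuous.subtype_mk ?_ _
    fun_prop
  have hgV : ∀ t, g t ∈ ((↑) ⁻¹' V : Set E)ᶜ := fun t h => hoff t (hg t ▸ h)
  exact ⟨⟨g 0, hgV 0⟩, ⟨g 1, hgV 1⟩,
    { toFun := fun t => ⟨g t, hgV t⟩
      continuous_toFun := hgc.subtype_mk _
      source' := rfl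
      target' := rfl }, hg⟩

end

theorem exists_convexComb {s s' t : I} (h : s < t) (h' : t < s') : ∃ T : I,
    Set.Icc.convexComb s s' T = t ∧ ∀ x, (x ≤ T ↔ Set.Icc.convexComb s s' x ≤ t) ∧
      (T ≤ x ↔ t ≤ Set.Icc.convexComb s s' x) := by
  have h : (s : ℝ) < t := h
  have h' : (t : ℝ) < s' := h'
  have hd : (0 : ℝ) < s' - s := by linarith
  refine ⟨⟨(t - s) / (s' - s), div_nonneg (by linarith) hd.le, (div_le_one hd).2 (by linarith)⟩,
    ?_, fun x => ⟨?_, ?_⟩⟩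
  · ext
    simp
    field_simp
    ring
  · rw [← Subtype.coe_le_coe, ← Subtype.coe_le_coe, le_div_iff₀ hd]
    simp
    constructor <;> intro <;> nlinarith
  · rw [← Subtype.coe_le_coe, ← Subtype.coe_le_coe, div_le_iff₀ hd]
    simp
    constructor <;> intro <;> nlinarith

end SphereCurve

namespace SphereCurve

open Filter Topology TorusLattice

variable {V : Set (OnePoint (ℝ × ℝ))}

theorem exists_pairwise_disjoint_nbhdAt (hV : V.Finite) :
    ∃ r > 0, ∀ v ∈ V, ∀ w ∈ V, v ≠ w → Disjoint (nbhdAt r v) (nbhdAt r w) := by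
  obtain ⟨U, hU, hd⟩ := hV.t2_separation
  have h : ∀ᶠ r in 𝓝[>] (0 : ℝ), ∀ v ∈ V, nbhdAt r v ⊆ U v := hV.eventually_all.2
    fun v _ => eventually_nbhdAt_subset ((hU v).2.mem_nhds (hU v).1)
  obtain ⟨r, h, hr⟩ := (h.and self_mem_nhdsWithin).exists
  exact ⟨r, hr, fun v hv w hw hvw => (hd hv hw hvw).mono (h v hv) (h w hw)⟩

theorem tendsto_const_mul_nhdsGT_zero {c : ℝ} (hc : 0 < c) :
    Tendsto (fun ε : ℝ => c * ε) (𝓝[>] 0) (𝓝[>] 0) := by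
  refine tendsto_nhdsWithin_iff.2 ⟨?_, ?_⟩
  · have : Tendsto (fun ε : ℝ => c * ε) (𝓝 0) (𝓝 (c * 0)) :=
      (continuous_const.mul continuous_id).tendsto 0
    rw [mul_zero] at this
    exact this.mono_left nhdsWithin_le_nhds
  · filter_upwards [self_mem_nhdsWithin] with ε hε
    exact mul_pos hc hε

theorem eventually_thicken_mul {r s c : ℝ} (hr : 0 < r) (h : r < s) (hc : 0 < c) :
    ∀ᶠ ε in 𝓝[>] (0 : ℝ), ∀ v : OnePoint (ℝ × ℝ), ∀ a ∈ ballAt r v, ∀ z, dist z a ≤ c * ε →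
      z ∈ ballAt s v := by
  exact (tendsto_const_mul_nhdsGT_zero hc).eventually (eventually_thicken hr h)

theorem card_le_of_infty_mem (hV : V.Finite) (hinf : OnePoint.infty ∈ V) (h3 : 3 ≤ V.ncard) {m : ℕ}
    {f : Fin m → I → OnePoint (ℝ × ℝ)} (hf : ∀ i, Continuous (f i)) (h0 : ∀ i, f i 0 ∈ V)
    (h1 : ∀ i, f i 1 ∈ V) (hoff : ∀ i t, t ≠ 0 → t ≠ 1 → f i t ∉ V)
    (hloose : ∀ i j, i ≠ j → ∀ t t', t ≠ 0 → t ≠ 1 → t' ≠ 0 → t' ≠ 1 → f i t ≠ f j t')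
    (hnt : ∀ i u (p : Path u u), ⇑p = f i → ¬ HomOff V p (Path.refl u))
    (hnh : ∀ i j, i ≠ j → ∀ v w (p q : Path v w), ⇑p = f i → ⇑q = f j → ¬ HomOff V p q)
    (hnh' : ∀ i j, i ≠ j → ∀ v w (p q : Path v w), ⇑p = f i → (∀ t, q t = f j (σ t)) →
      ¬ HomOff V p q) : (m : ℤ) + 6 ≤ 3 * V.ncard := by
  obtain ⟨r, hr, hd⟩ := exists_pairwise_disjoint_nbhdAt hV
  have hdb : ∀ v ∈ V, ∀ w ∈ V, v ≠ w → Disjoint (ballAt r v) (ballAt r w) := fun v hv w hw hvw =>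
    Set.disjoint_left.2 fun z hz hz' => Set.disjoint_left.1 (hd v hv w hw hvw)
      ((coe_mem_nbhdAt hr).2 hz) ((coe_mem_nbhdAt hr).2 hz')
  have hVr : ∀ v ∈ V, ∀ w ∈ V, w ∈ nbhdAt r v → w = v := by
    intro v hv w hw h
    by_contra hwv
    exact Set.disjoint_left.1 (hd w hw v hv hwv) (Set.mem_insert _ _) h
  -- the parts of the curves close to their ends
  have hc0 : (0 : I) < ⟨1 / 2, by norm_num, by norm_num⟩ := by
    rw [← Subtype.coe_lt_coe]
    norm_num
  have hc1 : (⟨1 / 2, by norm_num, by norm_num⟩ : I) < 1 := by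
    rw [← Subtype.coe_lt_coe]
    norm_num
  choose t₁ ht₁0 ht₁ ht₁r using fun i => exists_forall_le_mem_nbhdAt (hf i) hr hc0
  choose t₂ ht₂1 ht₂ ht₂r using fun i => exists_forall_ge_mem_nbhdAt (hf i) hr hc1
  have ht₁₂ : ∀ i, t₁ i < t₂ i := fun i => (ht₁ i).trans (ht₂ i)
  have hρ₃ : ∀ᶠ ρ in 𝓝[>] (0 : ℝ), ∀ w ∈ V, ∀ i t, t₁ i ≤ t → t ≤ t₂ i → f i t ∉ nbhdAt ρ w :=
    hV.eventually_all.2 fun w hw => eventually_all.2 fun i => eventually_notMem_nbhdAt (hf i)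
      fun t ht ht' h => hoff i t ((ht₁0 i).trans_le ht).ne' (ht'.trans_lt (ht₂1 i)).ne (h ▸ hw)
  obtain ⟨ρ₃, hρ₃, hρ₃0, hρ₃r⟩ :=
    (hρ₃.and (Ioo_mem_nhdsGT (lt_min hr one_pos))).exists
  have hρ₃1 : ρ₃ < 1 := hρ₃r.trans_le (min_le_right _ _)
  replace hρ₃r : ρ₃ < r := hρ₃r.trans_le (min_le_left _ _)
  obtain ⟨ρ, hρ0, hρ⟩ := exists_between hρ₃0
  obtain ⟨ρ₂, hρ₂0, hρ₂⟩ := exists_between hρ0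
  have hρ₂r : ρ₂ ≤ r := by linarith
  choose s hs0 hs hsρ using fun i => exists_forall_le_mem_nbhdAt (hf i) hρ₂0 (ht₁0 i)
  choose s' hs1 hs' hsρ' using fun i => exists_forall_ge_mem_nbhdAt (hf i) hρ₂0 (ht₂1 i)
  have hss' : ∀ i t, s i ≤ Set.Icc.convexComb (s i) (s' i) t ∧
      Set.Icc.convexComb (s i) (s' i) t ≤ s' i := by
    intro i t
    have h : ((s i : I) : ℝ) < s' i := ((hs i).trans (ht₁₂ i)).trans (hs' i)
    rw [← Subtype.coe_le_coe, ← Subtype.coe_le_coe]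
    simp only [Set.Icc.coe_convexComb]
    constructor <;> nlinarith [t.2.1, t.2.2]
  have hne : ∀ i t, Set.Icc.convexComb (s i) (s' i) t ≠ 0 ∧ Set.Icc.convexComb (s i) (s' i) t ≠ 1 :=
    fun i t => ⟨((hs0 i).trans_le (hss' i t).1).ne', ((hss' i t).2.trans_lt (hs1 i)).ne⟩
  choose a b γ hγ using fun i => exists_path_coeCompl hinf (hf i) (s := s i) (s' := s' i)
    fun t => hoff i _ (hne i t).1 (hne i t).2
  have hγ' : ∀ i t, (((γ i t : ℝ × ℝ)) : OnePoint (ℝ × ℝ)) =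
    f i (Set.Icc.convexComb (s i) (s' i) t) := hγ
  have hγc : ∀ i, Continuous fun t => (γ i t : ℝ × ℝ) := fun i =>
    continuous_subtype_val.comp (γ i).continuous
  have hmid : ∀ i v w (p : Path v w), ⇑p = f i → IsMiddle V r p (γ i) := by
    intro i v w p hp
    have hp0 : f i 0 = v := by rw [← hp, p.source]
    have hp1 : f i 1 = w := by rw [← hp, p.target]
    refine isMiddle_of_convexComb (fun t ht ht' => ?_) (hs0 i).ne'
      ((hs i).trans (ht₁ i) |>.trans hc1).ne (hc0.trans ((ht₂ i).trans (hs' i))).ne' (hs1 i).ne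
      (fun t => ?_) (fun t ht => ?_) fun t ht => ?_
    · rw [hp]
      exact hoff i t ht ht'
    · rw [hp]
      exact hγ i t
    · rw [hp, ← hp0]
      exact nbhdAt_mono hρ₂0 hρ₂r _ (hsρ i t ht)
    · rw [hp, ← hp1]
      exact nbhdAt_mono hρ₂0 hρ₂r _ (hsρ' i t ht)
  choose T₁ hT₁ hT₁' using fun i => exists_convexComb (hs i) ((ht₁₂ i).trans (hs' i))
  choose T₂ hT₂ hT₂' using fun i => exists_convexComb ((hs i).trans (ht₁₂ i)) (hs' i)
  -- the scales of the lattice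
  have hsep : ∀ᶠ ε in 𝓝[>] (0 : ℝ), ∀ i j, i ≠ j → ∀ t t',
      10 * ε < dist (γ i t : ℝ × ℝ) (γ j t') := by
    refine eventually_all.2 fun i => eventually_all.2 fun j => ?_
    rcases eq_or_ne i j with rfl | hij
    · exact Eventually.of_forall fun ε h => absurd rfl h
    · have := eventually_lt_dist (hγc i) (hγc j) fun t t' h => hloose i j hij _ _ (hne i t).1
        (hne i t).2 (hne j t').1 (hne j t').2 (by rw [← hγ', ← hγ', h])
      filter_upwards [(tendsto_const_mul_nhdsGT_zero (by norm_num : (0 : ℝ) < 10)).eventually this]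
        with ε h _ using h
  obtain ⟨ε, ⟨⟨⟨hsep, hth₂⟩, hth⟩, hth₃⟩, hε, hερ⟩ := ((((hsep.and
    (eventually_thicken_mul hρ₂0 hρ₂ (by norm_num : (0 : ℝ) < 10))).and
    (eventually_thicken_mul hρ0 (hρ.trans hρ₃r) (by norm_num : (0 : ℝ) < 10))).and
    (eventually_thicken_mul hρ0 hρ (by norm_num : (0 : ℝ) < 10))).and
    (Ioo_mem_nhdsGT (show 0 < ρ / 10 by linarith))).exists
  have hLe : ∀ᶠ L in atTop, ∀ i t, ‖(γ i t : ℝ × ℝ)‖ ≤ L := by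
    refine eventually_all.2 fun i => ?_
    obtain ⟨B, hB⟩ := isCompact_univ.exists_bound_of_continuousOn (hγc i).continuousOn
    filter_upwards [eventually_ge_atTop B] with L hL t using (hB t (Set.mem_univ t)).trans hL
  obtain ⟨L, hL, hLρ⟩ := (hLe.and (eventually_gt_atTop (ρ⁻¹ + 1))).exists
  obtain ⟨M, hM1, hM⟩ : ∃ M : ℕ, 1 < M ∧ 2 * L ≤ ε * (M - 1) := by
    obtain ⟨M, hM⟩ := exists_nat_gt (max 1 (2 * L / ε + 1))
    have h1 := (le_max_right _ _).trans_lt hM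
    rw [← lt_sub_iff_add_lt, div_lt_iff₀ hε] at h1
    exact ⟨M, by exact_mod_cast (le_max_left _ _).trans_lt hM, by linarith⟩
  haveI : PathConnectedSpace ↥((↑) ⁻¹' V : Set (ℝ × ℝ))ᶜ := by
    rw [← isPathConnected_iff_pathConnectedSpace]
    refine Set.Countable.isPathConnected_compl_of_one_lt_rank ?_
      (hV.preimage OnePoint.coe_injective.injOn).countable
    rw [rank_prod']
    norm_num
  obtain ⟨G, _, ⟨Λ⟩⟩ := exists_holonomy ↥((↑) ⁻¹' V : Set (ℝ × ℝ))ᶜ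
  have P := planarSetup hinf hr hdb hρ0 (hρ.trans hρ₃r) (hρ.trans hρ₃1) hth hε (by linarith) hM1 hM hLρ
  have C : ∀ i, PlanarCurve L ε (fun v : V => ballAt ρ v) (fun v : V => ballAt r v \ (↑) ⁻¹' V)
      (fun t => (γ i t : ℝ × ℝ)) ⟨f i 0, h0 i⟩ ⟨f i 1, h1 i⟩ (T₁ i) (T₂ i) := by
    intro i
    have hl : ∀ t ≤ T₁ i, (γ i t : ℝ × ℝ) ∈ ballAt r (f i 0) := by
      intro t ht
      rw [← coe_mem_nbhdAt hr, hγ']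
      exact ht₁r i _ (((hT₁' i t).1).1 ht)
    have hr' : ∀ t, T₂ i ≤ t → (γ i t : ℝ × ℝ) ∈ ballAt r (f i 1) := by
      intro t ht
      rw [← coe_mem_nbhdAt hr, hγ']
      exact ht₂r i _ (((hT₂' i t).2).1 ht)
    have hfar : ∀ v ∈ V, ∀ w ∈ V, w ≠ v → ∀ x ∈ ballAt r v, ∀ y ∈ ballAt ρ w, 5 * ε < dist x y := by
      intro v hv w hw hwv x hx y hy
      by_contra! hxy
      exact Set.disjoint_left.1 (hdb w hw v hv hwv) (hth w y hy x (by linarith)) hx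
    have hne' : ∀ {w : V} {v} (hv : v ∈ V), w ≠ ⟨v, hv⟩ → w.1 ≠ v := fun hv h h' => h (Subtype.ext h')
    refine ⟨hγc i, ?_, fun z hz => ?_, fun z hz => ?_, fun t ht => ⟨hl t ht, (γ i t).2⟩,
      fun t ht => ⟨hr' t ht, (γ i t).2⟩,
      fun t ht w hw x hx => hfar _ (h0 i) _ w.2 (hne' _ hw) _ (hl t ht) _ hx,
      fun t ht w hw x hx => hfar _ (h1 i) _ w.2 (hne' _ hw) _ (hr' t ht) _ hx,
      fun t ht ht' w x hx => ?_, hL i⟩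
    · rw [← not_le, (hT₁' i _).1, hT₂, not_le]
      exact ht₁₂ i
    · have hz : dist z _ ≤ 2 * ε := hz
      refine hth₂ _ _ ?_ z (hz.trans (by linarith))
      rw [← coe_mem_nbhdAt hρ₂0, hγ']
      exact hsρ i _ (by simp)
    · have hz : dist z _ ≤ 2 * ε := hz
      refine hth₂ _ _ ?_ z (hz.trans (by linarith))
      rw [← coe_mem_nbhdAt hρ₂0, hγ']
      exact hsρ' i _ (by simp)
    · by_contra! hxy
      refine hρ₃ w w.2 i _ (((hT₁' i t).2).1 ht) (((hT₂' i t).1).1 ht') ?_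
      rw [← hγ', coe_mem_nbhdAt hρ₃0]
      exact hth₃ w x hx _ (by linarith)
  haveI := hV.fintype
  have hcard : Fintype.card V = V.ncard := by
    rw [← Nat.card_eq_fintype_card, Nat.card_coe_set_eq]
  rw [← hcard] at h3 ⊢
  refine P.card_le (Λ := Λ) h3 γ C hsep (fun i hse hol => ?_) (fun i j hij hs he x y hx hy h => ?_)
    fun i j hij hs he x y hx hy h => ?_
  · have he : f i 0 = f i 1 := congrArg Subtype.val hse
    let p : Path (f i 0) (f i 0) := ⟨⟨f i, hf i⟩, rfl, he.symm⟩
    exact hnt i _ p rfl ((hmid i _ _ p rfl).homOff_refl hr (h0 i) (hVr _ (h0 i)) hol)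
  · have hs : f i 0 = f j 0 := congrArg Subtype.val hs
    have he : f i 1 = f j 1 := congrArg Subtype.val he
    let p : Path (f i 0) (f i 1) := ⟨⟨f i, hf i⟩, rfl, rfl⟩
    let q : Path (f i 0) (f i 1) := ⟨⟨f j, hf j⟩, hs.symm, he.symm⟩
    exact hnh i j hij _ _ p q rfl rfl ((hmid i _ _ p rfl).homOff hr (h0 i) (hVr _ (h0 i)) (h1 i)
      (hVr _ (h1 i)) (hmid j _ _ q rfl) hx hy h)
  · have hs : f i 0 = f j 1 := congrArg Subtype.val hs
    have he : f i 1 = f j 0 := congrArg Subtype.val he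
    let p : Path (f i 0) (f i 1) := ⟨⟨f i, hf i⟩, rfl, rfl⟩
    let q : Path (f i 1) (f i 0) := ⟨⟨f j, hf j⟩, he.symm, hs.symm⟩
    exact hnh' i j hij _ _ p q.symm rfl (fun t => rfl) ((hmid i _ _ p rfl).homOff hr (h0 i)
      (hVr _ (h0 i)) (h1 i) (hVr _ (h1 i)) (hmid j _ _ q rfl).symm hx hy (by rw [Λ.hol_symm, h]))

end SphereCurve

namespace SphereCurve

theorem exists_homeomorph_eq_infty (v : OnePoint ℂ) :
    ∃ h : OnePoint ℂ ≃ₜ OnePoint (ℝ × ℝ), h v = OnePoint.infty := by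
  let k : OnePoint ℂ ≃ₜ OnePoint (ℝ × ℝ) := Complex.equivRealProdCLM.toHomeomorph.onePointCongr
  induction v using OnePoint.rec with
  | infty => exact ⟨k, rfl⟩
  | coe z =>
    refine ⟨((Homeomorph.addLeft (-z)).onePointCongr.trans k).trans onePointInvHomeo, ?_⟩
    have : k ((Homeomorph.addLeft (-z)).onePointCongr z) = ((0 : ℝ × ℝ) : OnePoint (ℝ × ℝ)) := by
      change ((Complex.equivRealProdCLM (-z + z) : ℝ × ℝ) : OnePoint (ℝ × ℝ)) = _
      rw [neg_add_cancel, map_zero]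
    rw [Homeomorph.trans_apply, Homeomorph.trans_apply, this]
    exact onePointInv_zero

theorem HomOff.sphereHomotopicIn (h : OnePoint ℂ ≃ₜ OnePoint (ℝ × ℝ)) {V : Set (OnePoint ℂ)}
    {v w} {p q : Path v w} (H : HomOff (h '' V) p q) {a b : I → OnePoint ℂ}
    (ha : ∀ t, p t = h (a t)) (hb : ∀ t, q t = h (b t)) : SphereHomotopicIn V a b := by
  obtain ⟨g, hg⟩ := H
  refine ⟨fun x => h.symm (g x), h.symm.continuous.comp g.continuous, fun t => ?_, fun t => ?_,
    fun s => ?_, fun s => ?_, fun s t hs hs' ht ht' hV => ?_⟩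
  · simp [ha]
  · simp [hb]
  · rw [h.symm_apply_eq, g.source, ← ha, p.source]
  · rw [h.symm_apply_eq, g.target, ← ha, p.target]
  · exact hg s t hs hs' ht ht' ⟨_, hV, h.apply_symm_apply _⟩

end SphereCurve

/-- Every loose non-homotopic drawing in the sphere with `n > 2`
vertices and `m` edges satisfies `m ≤ 3n - 6`. -/
theorem loose_sphere_edge_bound (n m : ℕ) (hn : 2 < n)
    (D : SphereDrawing n m) (hloose : D.Loose) (hD : D.NonHomotopic) :
    m ≤ 3 * n - 6 := by
  obtain ⟨v, hv⟩ : D.V.Nonempty := Set.nonempty_of_ncard_ne_zero (by rw [D.cardV]; omega)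
  obtain ⟨h, hinf⟩ := SphereCurve.exists_homeomorph_eq_infty v
  have hcard : (h '' D.V).ncard = n := by rw [Set.ncard_image_of_injective _ h.injective, D.cardV]
  have key := SphereCurve.card_le_of_infty_mem (D.finV.image h) ⟨v, hv, hinf⟩ (by omega)
    (f := fun i t => h (D.f i t)) (fun i => h.continuous.comp (D.cont i))
    (fun i => ⟨_, D.source_mem i, rfl⟩) (fun i => ⟨_, D.target_mem i, rfl⟩) ?_ ?_ ?_ ?_ ?_
  · omega
  · rintro i t h0 h1 ⟨x, hx, he⟩
    exact D.interior_not_mem i t h0 h1 (h.injective he ▸ hx)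
  · intro i j hij t t' h0 h1 h0' h1' he
    exact hloose i j hij t t' h0 h1 h0' h1' (h.injective he)
  · intro i u p hp H
    refine hD.2 i (Or.inl (H.sphereHomotopicIn h (fun t => congrFun hp t) fun t => ?_))
    rw [← p.source, hp]
    rfl
  · intro i j hij v w p q hp hq H
    exact hD.1 i j hij (Or.inl (H.sphereHomotopicIn h (congrFun hp) (congrFun hq)))
  · intro i j hij v w p q hp hq H
    refine hD.1 i j hij (Or.inr (H.symm₂.sphereHomotopicIn h (fun t => congrFun hp _) fun t => ?_))
    rw [Path.symm_apply, Function.comp_apply, hq, unitInterval.symm_symm]
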